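/- Entanglement testing, arbitrarily varying alternative. Let ℋ_{AB} = ℋ_A ⊗ ℋ_B be a finite-dimensional bipartite Hilbert space and 𝒻₁ ⊆ 𝒟(ℋ_{AB}) a non-empty closed set of states. Then Stein(𝒮‖𝒻₁^{av}) = Stein(𝒮‖co(𝒻₁)^{av}) = Stein(𝒮‖co(𝒻₁)^{iid}) = min*_{μ∈𝒫(co(𝒻₁))} lim_{n→∞} (1/n) inf_{σ∈𝒮_{A^n:B^n}} D(σ ‖ ∫_{co(𝒻₁)} dμ(ρ) ρ^{⊗n}), where the minimum is restricted to those μ for which the inner limit in n exists (a non-empty set on which the minimum is attained). -/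

import Mathlib

open Filter MeasureTheory Topology
open scoped BigOperators Classical ComplexOrder

noncomputable section

namespace QSanov

/-- Matrices representing operators on the single-copy Hilbert space with orthonormal
basis indexed by `ι`. -/
abbrev MatC (ι : Type*) := Matrix ι ι ℂ

/-- Matrices representing operators on the `n`-fold tensor power Hilbert space. -/
abbrev MatN (ι : Type*) (n : ℕ) := Matrix (Fin n → ι) (Fin n → ι) ℂ

instance matMeasurableSpace (m n : Type*) : MeasurableSpace (Matrix m n ℂ) :=
  inferInstanceAs (MeasurableSpace (m → n → ℂ))

/-- A quantum state: a positive semidefinite matrix of trace one. -/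
def IsState {κ : Type*} [Fintype κ] (ρ : Matrix κ κ ℂ) : Prop :=
  ρ.PosSemidef ∧ ρ.trace = 1

/-- Loewner order: `A ≤ B` iff `B - A` is positive semidefinite. -/
def loewnerLE {κ : Type*} [Fintype κ] (A B : Matrix κ κ ℂ) : Prop :=
  (B - A).PosSemidef

/-- The `n`-fold tensor power `ρ^{⊗n}` of a single-copy matrix. -/
def tensorPow {ι : Type*} (ρ : MatC ι) (n : ℕ) : MatN ι n :=
  fun i j => ∏ k, ρ (i k) (j k)

/-- The tensor product `ρ₁ ⊗ ⋯ ⊗ ρ_n` of a family of single-copy matrices. -/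
def tensorProdFam {ι : Type*} {n : ℕ} (ρ : Fin n → MatC ι) : MatN ι n :=
  fun i j => ∏ k, ρ k (i k) (j k)

/-- The tensor product of an `n`-copy matrix and an `m`-copy matrix. -/
def tensorMul {ι : Type*} {n m : ℕ} (ρ : MatN ι n) (σ : MatN ι m) : MatN ι (n + m) :=
  fun i j => ρ (fun t => i (Fin.castAdd m t)) (fun t => j (Fin.castAdd m t)) *
    σ (fun t => i (Fin.natAdd n t)) (fun t => j (Fin.natAdd n t))

/-- Conjugation `U_π ρ U_π†` by the unitary permuting the `n` tensor factors. -/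
def permCopies {ι : Type*} {n : ℕ} (π : Equiv.Perm (Fin n)) (ρ : MatN ι n) : MatN ι n :=
  fun i j => ρ (i ∘ π) (j ∘ π)

/-- Matrix logarithm via functional calculus on the support (eigenvalue `0` is sent
to `0`, since `Real.log 0 = 0`). -/
def matLog {κ : Type*} [Fintype κ] [DecidableEq κ] (A : Matrix κ κ ℂ) : Matrix κ κ ℂ :=
  if hA : A.IsHermitian then
    (hA.eigenvectorUnitary : Matrix κ κ ℂ) *
      (Matrix.diagonal fun i => (Real.log (hA.eigenvalues i) : ℂ)) *
      (star (hA.eigenvectorUnitary : Matrix κ κ ℂ))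
  else 0

/-- Support inclusion `supp ρ ⊆ supp σ`, phrased as inclusion of ranges. -/
def suppLE {κ : Type*} [Fintype κ] [DecidableEq κ] (ρ σ : Matrix κ κ ℂ) : Prop :=
  LinearMap.range (Matrix.toLin' ρ) ≤ LinearMap.range (Matrix.toLin' σ)

/-- Umegaki relative entropy `D(ρ‖σ) = Tr[ρ (log ρ - log σ)]`, equal to `+∞` when
`supp ρ ⊄ supp σ`. -/
def relEnt {κ : Type*} [Fintype κ] [DecidableEq κ] (ρ σ : Matrix κ κ ℂ) : EReal :=
  if suppLE ρ σ then (((ρ * (matLog ρ - matLog σ)).trace.re : ℝ) : EReal) else ⊤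

/-- Relative entropy between two sets of states: `D(𝒜‖ℬ) = inf_{ρ∈𝒜, σ∈ℬ} D(ρ‖σ)`. -/
def relEntSet {κ : Type*} [Fintype κ] [DecidableEq κ] (A B : Set (Matrix κ κ ℂ)) : EReal :=
  ⨅ ρ ∈ A, ⨅ σ ∈ B, relEnt ρ σ

/-- The composite i.i.d. hypothesis `𝒻₁^{⊗n, iid}` built on the base set `F1`. -/
def iidSet {ι : Type*} (F1 : Set (MatC ι)) (n : ℕ) : Set (MatN ι n) :=
  {ρ | ∃ σ ∈ F1, ρ = tensorPow σ n}

/-- The arbitrarily varying hypothesis `𝒻₁^{⊗n, av}` built on the base set `F1`. -/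
def avSet {ι : Type*} (F1 : Set (MatC ι)) (n : ℕ) : Set (MatN ι n) :=
  {ρ | ∃ f : Fin n → MatC ι, (∀ p, f p ∈ F1) ∧ ρ = tensorProdFam f}

/-- Worst-case type II error probability `β_ε(A‖B)` for a threshold `ε` on the
worst-case type I error probability. -/
def typeII {κ : Type*} [Fintype κ] [DecidableEq κ] (A B : Set (Matrix κ κ ℂ)) (ε : ℝ) : ℝ :=
  sInf {b : ℝ | ∃ E : Matrix κ κ ℂ, E.PosSemidef ∧ (1 - E).PosSemidef ∧
    (∀ ρ ∈ A, (ρ * (1 - E)).trace.re ≤ ε) ∧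
    b = sSup {x : ℝ | ∃ σ ∈ B, x = (σ * E).trace.re}}

/-- `- log x`, with value `+∞` for `x ≤ 0`. -/
def negLog (x : ℝ) : EReal := if x ≤ 0 then ⊤ else ((-Real.log x : ℝ) : EReal)

/-- `(1/n : EReal)`. -/
def cFrac (n : ℕ) : EReal := (((n : ℝ)⁻¹ : ℝ) : EReal)

/-- The Stein exponent `Stein(𝒜‖ℬ) = lim_{ε→0⁺} liminf_n -(1/n) log β_ε(𝒜_n‖ℬ_n)`;
since the inner quantity is monotone nondecreasing in `ε`, the limit as `ε → 0⁺`
coincides with the infimum over `ε ∈ (0,1)`. -/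
def steinExponent {ι : Type*} [Fintype ι] [DecidableEq ι]
    (A B : ∀ n : ℕ, Set (MatN ι n)) : EReal :=
  ⨅ ε ∈ Set.Ioo (0 : ℝ) 1,
    Filter.liminf (fun n : ℕ => cFrac n * negLog (typeII (A n) (B n) ε)) Filter.atTop

/-- The mixture `∫ dμ(σ) σ^{⊗n}` of i.i.d. states along a measure `μ` on a set of
states `C` (Bochner integral, computed entrywise). -/
def iidMix {ι : Type*} {C : Set (MatC ι)} (μ : Measure ↥C) (n : ℕ) : MatN ι n :=
  fun i j => ∫ σ, (∏ k, (σ : MatC ι) (i k) (j k)) ∂μ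

/-- The `b`-th block of size `k` of an index of `ℋ^{⊗ mk}`. -/
def blockOf {ι : Type*} {m k : ℕ} (i : Fin (m * k) → ι) (b : Fin m) : Fin k → ι :=
  fun t => i (finProdFinEquiv (b, t))

/-- Replace the blocks in `S` of the index `i` by the values prescribed by `c`. -/
def mergeBlocks {ι : Type*} {m k : ℕ} (S : Finset (Fin m)) (c : Fin m → Fin k → ι)
    (i : Fin (m * k) → ι) : Fin (m * k) → ι :=
  fun p => if (finProdFinEquiv.symm p).1 ∈ S
    then c (finProdFinEquiv.symm p).1 (finProdFinEquiv.symm p).2 else i p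

/-- Entry `(i,j)` of the partial trace of `ρ` over the blocks in `S`
(the remaining blocks being evaluated at `i`, `j`). -/
def blockPartialTrace {ι : Type*} [Fintype ι] {m k : ℕ} (S : Finset (Fin m))
    (ρ : MatN ι (m * k)) (i j : Fin (m * k) → ι) : ℂ :=
  (((Fintype.card ι : ℂ) ^ (k * (m - S.card)))⁻¹) *
    ∑ c : Fin m → Fin k → ι, ρ (mergeBlocks S c i) (mergeBlocks S c j)

/-- The `m`-fold tensor power `(𝒩^δ_ω)^{⊗ m}` of the depolarising channel
`𝒩^δ_ω(X) = (1-δ) X + δ Tr[X] ω`, acting blockwise on blocks of `k` tensor factors. -/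
def blockDepolarize {ι : Type*} [Fintype ι] (δ : ℝ) {k : ℕ} (ω : MatN ι k) (m : ℕ)
    (ρ : MatN ι (m * k)) : MatN ι (m * k) :=
  fun i j => ∑ S : Finset (Fin m),
    (((1 - δ) ^ (m - S.card) * δ ^ S.card : ℝ) : ℂ) *
      ((∏ b ∈ S, ω (blockOf i b) (blockOf j b)) * blockPartialTrace S ρ i j)

/-- The `m`-fold tensor power of a `k`-copy matrix, as an `mk`-copy matrix. -/
def powBlocks {ι : Type*} {k : ℕ} (ρ : MatN ι k) (m : ℕ) : MatN ι (m * k) :=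
  fun i j => ∏ b : Fin m, ρ (blockOf i b) (blockOf j b)

/-- `Tr_{n+1,…,n+k}[ρ (𝟙^{⊗n} ⊗ F)]`, the filtered reduction of an `(n+k)`-copy matrix. -/
def condReduce {ι : Type*} [Fintype ι] {n k : ℕ} (ρ : MatN ι (n + k)) (F : MatN ι k) :
    MatN ι n :=
  fun i j => ∑ a : Fin k → ι, ∑ b : Fin k → ι,
    ρ (Fin.append i a) (Fin.append j b) * F b a

/-- Partial trace over the `k`-th tensor factor. -/
def traceOutAt {ι : Type*} [Fintype ι] {n : ℕ} (k : Fin (n + 1)) (σ : MatN ι (n + 1)) :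
    MatN ι n :=
  fun i j => ∑ a : ι, σ (k.insertNth a i) (k.insertNth a j)

/-- Insert the single-copy state `τ` at position `k` into an `n`-copy matrix. -/
def insertState {ι : Type*} {n : ℕ} (k : Fin (n + 1)) (τ : MatC ι) (σ : MatN ι n) :
    MatN ι (n + 1) :=
  fun i j => τ (i k) (j k) *
    σ (fun t => i (k.succAbove t)) (fun t => j (k.succAbove t))

/-- Product of a state on `A^n` and a state on `B^n`, viewed as a state on
`(ℋ_A ⊗ ℋ_B)^{⊗ n}` (reordering tensor factors implicitly). -/
def prodStateAB {ιA ιB : Type*} {n : ℕ} (α : Matrix (Fin n → ιA) (Fin n → ιA) ℂ)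
    (β : Matrix (Fin n → ιB) (Fin n → ιB) ℂ) : MatN (ιA × ιB) n :=
  fun i j => α (fun k => (i k).1) (fun k => (j k).1) * β (fun k => (i k).2) (fun k => (j k).2)


/-- The set `𝒮_{A^n:B^n}` of separable states across the cut `A^n : B^n`. -/
def sepSet (ιA ιB : Type*) [Fintype ιA] [Fintype ιB] (n : ℕ) : Set (MatN (ιA × ιB) n) :=
  convexHull ℝ {ρ | ∃ α β, IsState α ∧ IsState β ∧ ρ = prodStateAB α β}

/-- Classical relative entropy of two finitely supported output distributions. -/
def clRelEnt {m : ℕ} (P Q : Fin m → ℝ) : EReal :=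
  ∑ x, (if P x = 0 then (0 : EReal) else if Q x = 0 then (⊤ : EReal)
    else ((P x * Real.log (P x / Q x) : ℝ) : EReal))

/-- Measured relative entropy: supremum over all finite POVMs of the classical
relative entropy of the induced outcome distributions. -/
def measuredRelEnt {κ : Type*} [Fintype κ] [DecidableEq κ] (ρ σ : Matrix κ κ ℂ) : EReal :=
  ⨆ (m : ℕ) (E : Fin m → Matrix κ κ ℂ) (_ : ∀ x, (E x).PosSemidef) (_ : ∑ x, E x = 1),
    clRelEnt (fun x => (ρ * E x).trace.re) (fun x => (σ * E x).trace.re)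


/-- Axiom Q.I: there is a full-support free state `τ ∈ 𝒜₁` such that every `𝒜_{mk}`
is stable under blockwise depolarising towards `τ^{⊗k}`. -/
def AxiomQI {ι : Type*} [Fintype ι] [DecidableEq ι] (A : ∀ n : ℕ, Set (MatN ι n)) : Prop :=
  ∃ τ : MatC ι, tensorPow τ 1 ∈ A 1 ∧
    ∀ m k : ℕ, 1 ≤ m → 1 ≤ k → ∀ ρ ∈ A (m * k),
      suppLE ρ (tensorPow τ (m * k)) ∧
      ∀ δ ∈ Set.Icc (0 : ℝ) 1, blockDepolarize δ (tensorPow τ k) m ρ ∈ A (m * k)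

/-- Axiom Q.II: closedness under tensor powers. -/
def AxiomQII {ι : Type*} (A : ∀ n : ℕ, Set (MatN ι n)) : Prop :=
  ∀ m k : ℕ, 1 ≤ m → 1 ≤ k → ∀ ρ ∈ A k, powBlocks ρ m ∈ A (m * k)

/-- Axiom Q.III: closedness under permutations of the tensor factors. -/
def AxiomQIII {ι : Type*} (A : ∀ n : ℕ, Set (MatN ι n)) : Prop :=
  ∀ n : ℕ, ∀ ρ ∈ A n, ∀ π : Equiv.Perm (Fin n), permCopies π ρ ∈ A n

/-- Axiom Q.IV: filtering by Hermitian operators in a neighbourhood of the identity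
is completely `cone(𝒜)`-preserving. -/
def AxiomQIV {ι : Type*} [Fintype ι] [DecidableEq ι] (A : ∀ n : ℕ, Set (MatN ι n)) : Prop :=
  ∀ k : ℕ, 1 ≤ k →
    ∃ V : Set (MatN ι k), V ∈ nhds (1 : MatN ι k) ∧
      ∀ F ∈ V, F.IsHermitian → ∀ n : ℕ, 1 ≤ n → ∀ ρ ∈ A (n + k),
        ∃ (lam : ℝ) (ω : MatN ι n), 0 ≤ lam ∧ ω ∈ A n ∧ condReduce ρ F = (lam : ℂ) • ω

set_option linter.unusedSectionVars false

section MatrixPrelim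

open scoped Matrix

variable {κ : Type*} [Fintype κ]

/-- The real trace pairing `Re Tr[A B]`, as a real bilinear form. -/
def pair : Matrix κ κ ℂ →ₗ[ℝ] Matrix κ κ ℂ →ₗ[ℝ] ℝ :=
  LinearMap.mk₂ ℝ (fun A B => (A * B).trace.re)
    (by intros; simp [add_mul]) (by intros; simp) (by intros; simp [mul_add]) (by intros; simp)

lemma pair_apply (A B : Matrix κ κ ℂ) : pair A B = (A * B).trace.re := rfl

lemma pair_comm (A B : Matrix κ κ ℂ) : pair A B = pair B A := by
  rw [pair_apply, pair_apply, Matrix.trace_mul_comm]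

lemma exists_conjTranspose_mul_self {A : Matrix κ κ ℂ} (hA : A.PosSemidef) :
    ∃ B : Matrix κ κ ℂ, A = Bᴴ * B := by
  open scoped MatrixOrder Matrix.Norms.L2Operator in
    obtain ⟨B, hB⟩ := CStarAlgebra.nonneg_iff_eq_star_mul_self.mp hA.nonneg
    exact ⟨B, hB⟩

lemma pair_nonneg {A B : Matrix κ κ ℂ} (hA : A.PosSemidef) (hB : B.PosSemidef) :
    0 ≤ pair A B := by
  obtain ⟨C, rfl⟩ := exists_conjTranspose_mul_self hB
  rw [pair_apply, ← mul_assoc, Matrix.trace_mul_comm, ← mul_assoc]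
  exact (Complex.le_def.mp (hA.mul_mul_conjTranspose_same C).trace_nonneg).1

lemma pair_mono_right {A B C : Matrix κ κ ℂ} (hA : A.PosSemidef) (h : (C - B).PosSemidef) :
    pair A B ≤ pair A C := by
  have := pair_nonneg hA h
  rw [map_sub] at this
  linarith

lemma pair_mono_left {A B C : Matrix κ κ ℂ} (hA : A.PosSemidef) (h : (C - B).PosSemidef) :
    pair B A ≤ pair C A := by
  rw [pair_comm B, pair_comm C]
  exact pair_mono_right hA h

lemma posSemidef_real_smul {A : Matrix κ κ ℂ} (hA : A.PosSemidef) {c : ℝ} (hc : 0 ≤ c) :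
    (c • A).PosSemidef := by
  rw [← Complex.coe_smul]
  exact hA.smul (Complex.zero_le_real.mpr hc)

lemma posDef_real_smul {A : Matrix κ κ ℂ} (hA : A.PosDef) {c : ℝ} (hc : 0 < c) :
    (c • A).PosDef := by
  rw [← Complex.coe_smul]
  exact hA.smul (Complex.zero_lt_real.mpr hc)

lemma convex_posSemidef : Convex ℝ {A : Matrix κ κ ℂ | A.PosSemidef} :=
  fun _ hA _ hB _ _ ha hb _ => (posSemidef_real_smul hA ha).add (posSemidef_real_smul hB hb)

lemma isClosed_posSemidef : IsClosed {A : Matrix κ κ ℂ | A.PosSemidef} := by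
  have : {A : Matrix κ κ ℂ | A.PosSemidef} =
      {A | A.IsHermitian} ∩ ⋂ x : κ → ℂ, {A | 0 ≤ star x ⬝ᵥ A *ᵥ x} := by
    ext A
    simp [Matrix.posSemidef_iff_dotProduct_mulVec]
  rw [this]
  refine IsClosed.inter (isClosed_eq (by fun_prop) continuous_id)
    (isClosed_iInter fun x => isClosed_le continuous_const ?_)
  fun_prop

variable [DecidableEq κ]

lemma pair_one_right (A : Matrix κ κ ℂ) : pair A 1 = A.trace.re := by simp [pair_apply]

/-- The matrix `U diag(d) U†`. -/
def uDiag (U : Matrix κ κ ℂ) (d : κ → ℝ) : Matrix κ κ ℂ :=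
  U * Matrix.diagonal (fun i => (d i : ℂ)) * Uᴴ

lemma uDiag_add (U : Matrix κ κ ℂ) (d e : κ → ℝ) :
    uDiag U (d + e) = uDiag U d + uDiag U e := by
  simp only [uDiag, ← add_mul, ← mul_add, Matrix.diagonal_add]
  simp

lemma uDiag_smul (U : Matrix κ κ ℂ) (c : ℝ) (d : κ → ℝ) :
    uDiag U (c • d) = c • uDiag U d := by
  have : (Matrix.diagonal fun i => (((c • d) i : ℝ) : ℂ)) =
      c • Matrix.diagonal (fun i => (d i : ℂ)) := by
    ext i j
    by_cases h : i = j <;> simp [h]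
  rw [uDiag, uDiag, this]
  simp

lemma uDiag_sub (U : Matrix κ κ ℂ) (d e : κ → ℝ) :
    uDiag U (d - e) = uDiag U d - uDiag U e := by
  rw [sub_eq_add_neg, uDiag_add, ← neg_one_smul ℝ e, uDiag_smul, neg_one_smul, sub_eq_add_neg]

lemma uDiag_zero (U : Matrix κ κ ℂ) : uDiag U 0 = 0 := by simp [uDiag]

lemma uDiag_mul {U : Matrix κ κ ℂ} (hU : U ∈ Matrix.unitaryGroup κ ℂ) (d e : κ → ℝ) :
    uDiag U d * uDiag U e = uDiag U (d * e) := by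
  have hU' : Uᴴ * U = 1 := Matrix.mem_unitaryGroup_iff'.mp hU
  have : ∀ X Y : Matrix κ κ ℂ, U * X * Uᴴ * (U * Y * Uᴴ) = U * (X * Y) * Uᴴ := by
    intro X Y
    simp only [mul_assoc]
    rw [← mul_assoc Uᴴ U, hU', one_mul]
  rw [uDiag, uDiag, uDiag, this, Matrix.diagonal_mul_diagonal]
  simp

lemma uDiag_one {U : Matrix κ κ ℂ} (hU : U ∈ Matrix.unitaryGroup κ ℂ) :
    uDiag U 1 = 1 := by
  simpa [uDiag, Matrix.star_eq_conjTranspose] using Matrix.mem_unitaryGroup_iff.mp hU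

lemma uDiag_isHermitian (U : Matrix κ κ ℂ) (d : κ → ℝ) : (uDiag U d).IsHermitian := by
  simp [Matrix.IsHermitian, uDiag, mul_assoc, Matrix.diagonal_conjTranspose, Pi.star_def]

lemma uDiag_posSemidef (U : Matrix κ κ ℂ) {d : κ → ℝ} (hd : ∀ i, 0 ≤ d i) :
    (uDiag U d).PosSemidef := by
  refine Matrix.PosSemidef.mul_mul_conjTranspose_same ?_ U
  exact Matrix.posSemidef_diagonal_iff.mpr fun i => Complex.zero_le_real.mpr (hd i)

lemma uDiag_posSemidef_iff {U : Matrix κ κ ℂ} (hU : U ∈ Matrix.unitaryGroup κ ℂ) {d : κ → ℝ} :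
    (uDiag U d).PosSemidef ↔ ∀ i, 0 ≤ d i := by
  refine ⟨fun h i => ?_, uDiag_posSemidef U⟩
  have h1 := h.mul_mul_conjTranspose_same Uᴴ
  have hU' : Uᴴ * U = 1 := Matrix.mem_unitaryGroup_iff'.mp hU
  have : Uᴴ * uDiag U d * Uᴴᴴ = Matrix.diagonal (fun i => (d i : ℂ)) := by
    rw [uDiag, Matrix.conjTranspose_conjTranspose, mul_assoc, mul_assoc, mul_assoc, hU', mul_one,
      ← mul_assoc, hU', one_mul]
  rw [this, Matrix.posSemidef_diagonal_iff] at h1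
  exact Complex.zero_le_real.mp (h1 i)

lemma uDiag_posDef_iff {U : Matrix κ κ ℂ} (hU : U ∈ Matrix.unitaryGroup κ ℂ) {d : κ → ℝ} :
    (uDiag U d).PosDef ↔ ∀ i, 0 < d i := by
  have hu : IsUnit U := ⟨Unitary.toUnits ⟨U, hU⟩, rfl⟩
  have : (uDiag U d).PosDef ↔ (Matrix.diagonal (fun i => (d i : ℂ))).PosDef := by
    have := Matrix.IsUnit.posDef_star_right_conjugate_iff
      (x := Matrix.diagonal (fun i => (d i : ℂ))) hu
    exact this
  rw [this, Matrix.posDef_diagonal_iff]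
  simp

lemma exists_uDiag {A : Matrix κ κ ℂ} (hA : A.IsHermitian) :
    ∃ U ∈ Matrix.unitaryGroup κ ℂ, A = uDiag U hA.eigenvalues :=
  ⟨hA.eigenvectorUnitary, hA.eigenvectorUnitary.2, hA.spectral_theorem⟩

/-- The weights `⟨i| U† A U |i⟩` of `A` in the basis of columns of `U`. -/
def wts (A U : Matrix κ κ ℂ) (i : κ) : ℝ := ((Uᴴ * A * U) i i).re

lemma pair_uDiag (A U : Matrix κ κ ℂ) (d : κ → ℝ) :
    pair A (uDiag U d) = ∑ i, wts A U i * d i := by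
  rw [pair_apply, uDiag, ← mul_assoc, Matrix.trace_mul_comm, ← mul_assoc, ← mul_assoc]
  simp [Matrix.trace, Matrix.mul_diagonal, wts]

lemma wts_nonneg {A : Matrix κ κ ℂ} (hA : A.PosSemidef) (U : Matrix κ κ ℂ) (i : κ) :
    0 ≤ wts A U i := by
  have := (hA.conjTranspose_mul_mul_same U).diag_nonneg (i := i)
  exact (Complex.le_def.mp this).1

lemma sum_wts (A : Matrix κ κ ℂ) {U : Matrix κ κ ℂ} (hU : U ∈ Matrix.unitaryGroup κ ℂ) :
    ∑ i, wts A U i = A.trace.re := by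
  have := pair_uDiag A U 1
  rw [uDiag_one hU, pair_one_right] at this
  simpa using this.symm

lemma matLog_eq_cfc {A : Matrix κ κ ℂ} (hA : A.IsHermitian) :
    matLog A = cfc Real.log A := by
  rw [matLog, dif_pos hA, hA.cfc_eq]
  rfl

lemma matLog_uDiag {U : Matrix κ κ ℂ} (hU : U ∈ Matrix.unitaryGroup κ ℂ) (d : κ → ℝ) :
    matLog (uDiag U d) = uDiag U (fun i => Real.log (d i)) := by
  have hH := uDiag_isHermitian U d
  rw [matLog_eq_cfc hH]
  obtain ⟨q, hq⟩ : ∃ q : Polynomial ℝ, ∀ x ∈ Set.range d ∪ spectrum ℝ (uDiag U d),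
      q.eval x = Real.log x := by
    have hfin : (Set.range d ∪ spectrum ℝ (uDiag U d)).Finite := by
      refine (Set.finite_range d).union ?_
      rw [hH.spectrum_real_eq_range_eigenvalues]
      exact Set.finite_range _
    refine ⟨Lagrange.interpolate hfin.toFinset id Real.log, fun x hx => ?_⟩
    exact Lagrange.eval_interpolate_at_node (v := id) Real.log Function.injective_id.injOn
      (hfin.mem_toFinset.mpr hx)
  rw [cfc_congr (g := fun x => q.eval x) (fun x hx => (hq x (Or.inr hx)).symm),
    cfc_polynomial q _ hH.isSelfAdjoint]
  have key : ∀ p : Polynomial ℝ, Polynomial.aeval (uDiag U d) p =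
      uDiag U (fun i => p.eval (d i)) := by
    intro p
    induction p using Polynomial.induction_on with
    | C a =>
      have : (fun i : κ => (Polynomial.C a).eval (d i)) = a • (1 : κ → ℝ) := by ext; simp
      rw [this, uDiag_smul, uDiag_one hU, Polynomial.aeval_C, Algebra.algebraMap_eq_smul_one]
    | add p q hp hq =>
      rw [map_add, hp, hq, ← uDiag_add]
      congr 1
      ext
      simp
    | monomial n a h =>
      rw [pow_succ, ← mul_assoc, map_mul, h, Polynomial.aeval_X, uDiag_mul hU]
      congr 1
      ext i
      simp [mul_assoc]
  rw [key]
  congr 1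
  ext i
  exact hq _ (Or.inl ⟨i, rfl⟩)

lemma matLog_isHermitian (A : Matrix κ κ ℂ) : (matLog A).IsHermitian := by
  by_cases hA : A.IsHermitian
  · obtain ⟨U, hU, h⟩ := exists_uDiag hA
    rw [h, matLog_uDiag hU]
    exact uDiag_isHermitian _ _
  · rw [matLog, dif_neg hA]
    exact Matrix.isHermitian_zero

lemma matLog_mono {A B : Matrix κ κ ℂ} (hA : A.PosDef) (h : (B - A).PosSemidef) :
    (matLog B - matLog A).PosSemidef := by
  open scoped MatrixOrder Matrix.Norms.L2Operator in
    have hB : B.PosDef := by simpa using hA.add_posSemidef h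
    rw [matLog_eq_cfc hA.1, matLog_eq_cfc hB.1]
    exact CFC.log_le_log (show A ≤ B from h) (Matrix.isStrictlyPositive_iff_posDef.mpr hA)

lemma matLog_concave {α : Type*} (s : Finset α) (w : α → ℝ) (A : α → Matrix κ κ ℂ)
    (hw : ∀ a ∈ s, 0 ≤ w a) (hw1 : ∑ a ∈ s, w a = 1) (hA : ∀ a ∈ s, (A a).PosDef) :
    (matLog (∑ a ∈ s, w a • A a) - ∑ a ∈ s, w a • matLog (A a)).PosSemidef := by
  open scoped MatrixOrder Matrix.Norms.L2Operator in
    have hc := CFC.concaveOn_log (A := Matrix κ κ ℂ)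
    have hmem : ∀ a ∈ s, A a ∈ {a : Matrix κ κ ℂ | IsStrictlyPositive a} :=
      fun a ha => Matrix.isStrictlyPositive_iff_posDef.mpr (hA a ha)
    have h1 := hc.1.sum_mem hw hw1 hmem
    have h2 := hc.le_map_sum hw hw1 hmem
    have h3 : ∑ a ∈ s, w a • matLog (A a) = ∑ a ∈ s, w a • CFC.log (A a) :=
      Finset.sum_congr rfl fun a ha => by rw [matLog_eq_cfc (hA a ha).1, CFC.log]
    rw [matLog_eq_cfc (Matrix.isStrictlyPositive_iff_posDef.mp h1).1, h3]
    exact h2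

lemma convex_posDef : Convex ℝ {A : Matrix κ κ ℂ | A.PosDef} := by
  open scoped MatrixOrder Matrix.Norms.L2Operator in
    have hc := (CFC.concaveOn_log (A := Matrix κ κ ℂ)).1
    simpa only [Matrix.isStrictlyPositive_iff_posDef] using hc

lemma continuousOn_matLog : ContinuousOn (matLog : Matrix κ κ ℂ → Matrix κ κ ℂ)
    {A | A.PosDef} := by
  open scoped MatrixOrder Matrix.Norms.L2Operator in
    have h1 : ContinuousOn (CFC.log : Matrix κ κ ℂ → Matrix κ κ ℂ) {A | A.PosDef} :=
      (CFC.continuousOn_log (A := Matrix κ κ ℂ)).mono fun A hA =>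
        ⟨Matrix.PosDef.isHermitian hA, Matrix.PosDef.isUnit hA⟩
    have h2 : Set.EqOn matLog (CFC.log : Matrix κ κ ℂ → Matrix κ κ ℂ) {A | A.PosDef} :=
      fun A hA => matLog_eq_cfc (Matrix.PosDef.isHermitian hA)
    exact h1.congr h2

lemma matLog_smul {A : Matrix κ κ ℂ} (hA : A.PosDef) {c : ℝ} (hc : 0 < c) :
    matLog (c • A) = Real.log c • (1 : Matrix κ κ ℂ) + matLog A := by
  obtain ⟨U, hU, h⟩ := exists_uDiag hA.1
  have hpos := (uDiag_posDef_iff hU).mp (h ▸ hA)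
  rw [h, ← uDiag_smul, matLog_uDiag hU, matLog_uDiag hU, ← uDiag_one hU, ← uDiag_smul,
    ← uDiag_add]
  congr 1
  ext i
  simp [Real.log_mul hc.ne' (hpos i).ne']

lemma one_posDef : (1 : Matrix κ κ ℂ).PosDef := Matrix.PosDef.one

lemma smul_one_posSemidef {c : ℝ} (hc : 0 ≤ c) : (c • (1 : Matrix κ κ ℂ)).PosSemidef :=
  posSemidef_real_smul Matrix.PosSemidef.one hc

lemma posDef_add_smul_one {A : Matrix κ κ ℂ} (hA : A.PosSemidef) {ε : ℝ} (hε : 0 < ε) :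
    (A + ε • (1 : Matrix κ κ ℂ)).PosDef := by
  rw [add_comm]
  exact (posDef_real_smul one_posDef hε).add_posSemidef hA

end MatrixPrelim

section RelEnt

open scoped Matrix

variable {κ : Type*} [Fintype κ]

lemma posSemidef_apply_eq_zero {M : Matrix κ κ ℂ} (hM : M.PosSemidef) {i : κ}
    (h : (M i i).re = 0) (j : κ) : M i j = 0 := by
  obtain ⟨B, rfl⟩ := exists_conjTranspose_mul_self hM
  have h1 : ∑ k, Complex.normSq (B k i) = 0 := by
    rw [← h, Matrix.mul_apply, Complex.re_sum]
    refine Finset.sum_congr rfl fun k _ => ?_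
    rw [Matrix.conjTranspose_apply, mul_comm, ← starRingEnd_apply, Complex.mul_conj,
      Complex.ofReal_re]
  rw [Finset.sum_eq_zero_iff_of_nonneg fun k _ => Complex.normSq_nonneg _] at h1
  rw [Matrix.mul_apply]
  refine Finset.sum_eq_zero fun k _ => ?_
  rw [Matrix.conjTranspose_apply, Complex.normSq_eq_zero.mp (h1 k (Finset.mem_univ k))]
  simp

variable [DecidableEq κ]

lemma suppLE_uDiag_iff {σ U : Matrix κ κ ℂ} (hσ : σ.PosSemidef)
    (hU : U ∈ Matrix.unitaryGroup κ ℂ) {w : κ → ℝ} :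
    suppLE σ (uDiag U w) ↔ ∀ i, w i = 0 → wts σ U i = 0 := by
  have hU1 : Uᴴ * U = 1 := Matrix.mem_unitaryGroup_iff'.mp hU
  have hU2 : U * Uᴴ = 1 := Matrix.mem_unitaryGroup_iff.mp hU
  constructor
  · intro h i hi
    obtain ⟨v, hv⟩ := h ⟨U *ᵥ Pi.single i 1, rfl⟩
    rw [Matrix.toLin'_apply, Matrix.toLin'_apply] at hv
    have h1 : (Uᴴ * σ * U) i i = (Uᴴ *ᵥ (σ *ᵥ (U *ᵥ Pi.single i 1))) i := by
      rw [Matrix.mulVec_mulVec, Matrix.mulVec_mulVec, Matrix.mulVec_single_one]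
      rfl
    have h2 : Uᴴ * uDiag U w = Matrix.diagonal (fun i => (w i : ℂ)) * Uᴴ := by
      rw [uDiag, ← mul_assoc, ← mul_assoc, hU1, one_mul]
    rw [wts, h1, ← hv, Matrix.mulVec_mulVec, h2, ← Matrix.mulVec_mulVec,
      Matrix.mulVec_diagonal, hi]
    simp
  · intro h
    have hM := hσ.conjTranspose_mul_mul_same U
    set M := Uᴴ * σ * U with hMdef
    have hD : Matrix.diagonal (fun i => (w i : ℂ)) *
        (Matrix.diagonal (fun i => ((w i)⁻¹ : ℂ)) * M) = M := by
      ext i j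
      rw [Matrix.diagonal_mul, Matrix.diagonal_mul]
      by_cases hi : w i = 0
      · rw [posSemidef_apply_eq_zero hM (h i hi) j]
        simp
      · rw [← mul_assoc, mul_inv_cancel₀ (by exact_mod_cast hi), one_mul]
    have h3 : σ = uDiag U w * (U * (Matrix.diagonal (fun i => ((w i)⁻¹ : ℂ)) * M) * Uᴴ) := by
      have : uDiag U w * (U * (Matrix.diagonal (fun i => ((w i)⁻¹ : ℂ)) * M) * Uᴴ) =
          U * (Matrix.diagonal (fun i => (w i : ℂ)) * (Uᴴ * U) *
            (Matrix.diagonal (fun i => ((w i)⁻¹ : ℂ)) * M)) * Uᴴ := by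
        simp only [uDiag, mul_assoc]
      rw [this, hU1, mul_one, hD, hMdef]
      calc σ = (U * Uᴴ) * σ * (U * Uᴴ) := by rw [hU2]; simp
        _ = _ := by simp only [mul_assoc]
    rw [suppLE]
    conv_lhs => rw [h3]
    rw [Matrix.toLin'_mul]
    exact LinearMap.range_comp_le_range _ _

/-- The regularised relative entropy `Tr σ log σ - Tr σ log (ω + ε)`. -/
def relEntReg (ε : ℝ) (σ ω : Matrix κ κ ℂ) : ℝ :=
  pair σ (matLog σ) - pair σ (matLog (ω + ε • (1 : Matrix κ κ ℂ)))

lemma relEntReg_uDiag {σ U : Matrix κ κ ℂ} (hU : U ∈ Matrix.unitaryGroup κ ℂ) (w : κ → ℝ)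
    (ε : ℝ) : relEntReg ε σ (uDiag U w) =
      pair σ (matLog σ) - ∑ i, wts σ U i * Real.log (w i + ε) := by
  rw [relEntReg, ← uDiag_one hU, ← uDiag_smul, ← uDiag_add, matLog_uDiag hU, pair_uDiag]
  simp

lemma relEnt_uDiag {σ U : Matrix κ κ ℂ} (hσ : σ.PosSemidef)
    (hU : U ∈ Matrix.unitaryGroup κ ℂ) (w : κ → ℝ) :
    relEnt σ (uDiag U w) = if ∀ i, w i = 0 → wts σ U i = 0 then
      ((pair σ (matLog σ) - ∑ i, wts σ U i * Real.log (w i) : ℝ) : EReal) else ⊤ := by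
  rw [relEnt, ← pair_apply, map_sub, matLog_uDiag hU, pair_uDiag]
  simp only [suppLE_uDiag_iff hσ hU]

lemma relEntReg_le_relEnt {σ ω : Matrix κ κ ℂ} (hσ : σ.PosSemidef) (hω : ω.PosSemidef) {ε : ℝ}
    (hε : 0 < ε) : (relEntReg ε σ ω : EReal) ≤ relEnt σ ω := by
  obtain ⟨U, hU, h⟩ := exists_uDiag hω.1
  have hw := hω.eigenvalues_nonneg
  set w := hω.1.eigenvalues
  rw [h, relEntReg_uDiag hU, relEnt_uDiag hσ hU]
  split_ifs with hs
  · refine EReal.coe_le_coe_iff.mpr (sub_le_sub_left (Finset.sum_le_sum fun i _ => ?_) _)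
    rcases (hw i).eq_or_lt with h0 | h0
    · simp [hs i h0.symm]
    · exact mul_le_mul_of_nonneg_left (Real.log_le_log h0 (by linarith)) (wts_nonneg hσ U i)
  · exact le_top

lemma eventually_lt_relEntReg {σ ω : Matrix κ κ ℂ} (hσ : σ.PosSemidef) (hω : ω.PosSemidef)
    {r : ℝ} (hr : (r : EReal) < relEnt σ ω) : ∀ᶠ ε in 𝓝[>] (0 : ℝ), r < relEntReg ε σ ω := by
  obtain ⟨U, hU, h⟩ := exists_uDiag hω.1
  have hw := hω.eigenvalues_nonneg
  set w := hω.1.eigenvalues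
  rw [h, relEnt_uDiag hσ hU] at hr
  simp only [h, relEntReg_uDiag hU]
  have hs0 := wts_nonneg hσ U
  set s := wts σ U
  split_ifs at hr with hs
  · have hr' := EReal.coe_lt_coe_iff.mp hr
    have ht : Tendsto (fun ε : ℝ => pair σ (matLog σ) - ∑ i, s i * Real.log (w i + ε)) (𝓝[>] 0)
        (𝓝 (pair σ (matLog σ) - ∑ i, s i * Real.log (w i))) := by
      refine tendsto_const_nhds.sub (tendsto_finsetSum _ fun i _ => ?_)
      by_cases h0 : w i = 0
      · simp [hs i h0]
      · refine Tendsto.const_mul _ (Tendsto.mono_left ?_ nhdsWithin_le_nhds)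
        have : ContinuousAt (fun ε : ℝ => Real.log (w i + ε)) 0 :=
          ContinuousAt.log (by fun_prop) (by simpa using h0)
        simpa using this.tendsto
    exact ht.eventually (lt_mem_nhds hr')
  · push Not at hs
    obtain ⟨i, hi, hsi⟩ := hs
    have hsi' : 0 < s i := lt_of_le_of_ne (hs0 i) (Ne.symm hsi)
    have ht : Tendsto (fun ε : ℝ => s i * Real.log ε +
        ∑ j ∈ Finset.univ.erase i, s j * |Real.log (w j + 1)|) (𝓝[>] 0) atBot := by
      refine tendsto_atBot_add_const_right _ _ ?_
      exact Real.tendsto_log_nhdsGT_zero.const_mul_atBot hsi'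
    filter_upwards [ht.eventually_lt_atBot (pair σ (matLog σ) - r), self_mem_nhdsWithin,
      nhdsWithin_le_nhds (Iio_mem_nhds (show (0:ℝ) < 1 by norm_num))] with ε h1 h2 h3
    have h2 : 0 < ε := h2
    have h3 : ε < 1 := h3
    have : ∑ j, s j * Real.log (w j + ε) ≤ s i * Real.log ε +
        ∑ j ∈ Finset.univ.erase i, s j * |Real.log (w j + 1)| := by
      rw [← Finset.add_sum_erase _ _ (Finset.mem_univ i), hi, zero_add]
      refine add_le_add_right (Finset.sum_le_sum fun j _ => ?_) _
      refine mul_le_mul_of_nonneg_left ?_ (hs0 j)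
      exact (Real.log_le_log (by linarith [hw j]) (by linarith)).trans (le_abs_self _)
    linarith

/-- If `ω ≥ c ω'` then `D(σ‖ω) ≤ D(σ‖ω') - log c`. -/
lemma relEnt_le_of_smul_le {σ ω ω' : Matrix κ κ ℂ} (hσ : IsState σ) (hω' : ω'.PosSemidef)
    {c : ℝ} (hc : 0 < c) (hc1 : c ≤ 1) (h : (ω - c • ω').PosSemidef) :
    relEnt σ ω ≤ relEnt σ ω' + ((-Real.log c : ℝ) : EReal) := by
  have hω : ω.PosSemidef := by simpa using (posSemidef_real_smul hω' hc.le).add h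
  by_contra hcon
  push Not at hcon
  obtain ⟨r, hr1, hr2⟩ := EReal.lt_iff_exists_real_btwn.mp hcon
  obtain ⟨ε, h1, h2⟩ := ((eventually_lt_relEntReg hσ.1 hω hr2).and self_mem_nhdsWithin).exists
  have h2 : 0 < ε := h2
  have h3 := relEntReg_le_relEnt hσ.1 hω' h2
  have h4 : relEntReg ε σ ω ≤ relEntReg ε σ ω' - Real.log c := by
    have hm : ((ω + ε • (1 : Matrix κ κ ℂ)) - c • (ω' + ε • (1 : Matrix κ κ ℂ))).PosSemidef := by
      have : (ω + ε • (1 : Matrix κ κ ℂ)) - c • (ω' + ε • (1 : Matrix κ κ ℂ)) =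
        (ω - c • ω') + ((1 - c) * ε) • (1 : Matrix κ κ ℂ) := by module
      rw [this]
      exact h.add (posSemidef_real_smul Matrix.PosSemidef.one (by nlinarith))
    have hp := posDef_add_smul_one hω' h2
    have := pair_mono_right hσ.1 (matLog_mono (posDef_real_smul hp hc) hm)
    rw [matLog_smul hp hc, map_add, map_smul, pair_one_right, hσ.2] at this
    simp only [Complex.one_re, smul_eq_mul, mul_one] at this
    unfold relEntReg
    linarith
  have h5 : relEnt σ ω' + ((-Real.log c : ℝ) : EReal) < ((relEntReg ε σ ω : ℝ) : EReal) :=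
    hr1.trans (EReal.coe_lt_coe_iff.mpr h1)
  have h6 : ((relEntReg ε σ ω : ℝ) : EReal) ≤
      ((relEntReg ε σ ω' : ℝ) : EReal) + ((-Real.log c : ℝ) : EReal) := by
    rw [← EReal.coe_add]
    exact EReal.coe_le_coe_iff.mpr (by linarith)
  exact absurd (h5.trans_le (h6.trans (add_le_add_left h3 _))) (lt_irrefl _)

end RelEnt

section Pinching

open scoped Matrix

variable {κ : Type*} [Fintype κ] [DecidableEq κ]

lemma exists_posDef_matLog_eq_sub {A D : Matrix κ κ ℂ} (hA : A.PosDef) (hD : D.PosDef)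
    (hAD : Commute A D) : ∃ H : Matrix κ κ ℂ, H.PosDef ∧ matLog H = matLog A - matLog D ∧
      H * D = A := by
  open scoped MatrixOrder Matrix.Norms.L2Operator in
    have hcomm : Commute (matLog A) (matLog D) := by
      rw [matLog_eq_cfc hA.1, matLog_eq_cfc hD.1]
      exact ((hAD.cfc_real _).symm.cfc_real _).symm
    have hexp : ∀ B : Matrix κ κ ℂ, B.PosDef → NormedSpace.exp (matLog B) = B := by
      intro B hB
      rw [matLog_eq_cfc hB.1]
      exact CFC.exp_log B (Matrix.isStrictlyPositive_iff_posDef.mpr hB)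
    have hK : IsSelfAdjoint (matLog A - matLog D) :=
      (matLog_isHermitian A).sub (matLog_isHermitian D)
    have hpsd : (NormedSpace.exp (matLog A - matLog D)).PosSemidef :=
      Matrix.nonneg_iff_posSemidef.mp hK.exp_nonneg
    have hmul : NormedSpace.exp (matLog A - matLog D) * D = A := by
      nth_rewrite 2 [← hexp D hD]
      rw [← Matrix.exp_add_of_commute _ _ (hcomm.sub_left (Commute.refl _)), sub_add_cancel,
        hexp A hA]
    refine ⟨NormedSpace.exp (matLog A - matLog D), ?_, ?_, hmul⟩
    · rw [hpsd.posDef_iff_isUnit]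
      exact Matrix.isUnit_exp _
    · rw [matLog_eq_cfc hpsd.1]
      exact CFC.log_exp _ hK

lemma pair_matLog_le_add {σ : Matrix κ κ ℂ} (hσ : σ.PosSemidef) {ε : ℝ} (hε : 0 < ε) :
    pair σ (matLog σ) ≤ pair σ (matLog (σ + ε • (1 : Matrix κ κ ℂ))) := by
  obtain ⟨U, hU, h⟩ := exists_uDiag hσ.1
  have hs := hσ.eigenvalues_nonneg
  set s := hσ.1.eigenvalues
  have h1 : ∀ i, wts σ U i = s i := by
    intro i
    have hU' : Uᴴ * U = 1 := Matrix.mem_unitaryGroup_iff'.mp hU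
    have : Uᴴ * uDiag U s * U = Matrix.diagonal (fun i => (s i : ℂ)) := by
      rw [uDiag, mul_assoc, mul_assoc, mul_assoc, hU', mul_one, ← mul_assoc, hU', one_mul]
    rw [wts]
    conv_lhs => rw [h]
    rw [this]
    simp
  have h2 : σ + ε • (1 : Matrix κ κ ℂ) = uDiag U (s + ε • 1) := by
    rw [uDiag_add, uDiag_smul, uDiag_one hU, ← h]
  have h3 : matLog σ = uDiag U (fun i => Real.log (s i)) := by
    conv_lhs => rw [h]
    rw [matLog_uDiag hU]
  rw [h2, h3, matLog_uDiag hU, pair_uDiag, pair_uDiag]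
  refine Finset.sum_le_sum fun i _ => ?_
  rw [h1]
  rcases (hs i).eq_or_lt with h0 | h0
  · simp [← h0]
  · refine mul_le_mul_of_nonneg_left (Real.log_le_log h0 ?_) h0.le
    simp [hε.le]

/-- The pinching inequality for a resolution of the identity. -/
lemma pinching_posSemidef {α : Type*} (V : Finset α) (Q : α → Matrix κ κ ℂ)
    (hQ : ∀ v ∈ V, (Q v).IsHermitian) (hsum : ∑ v ∈ V, Q v = 1) {σ : Matrix κ κ ℂ}
    (hσ : σ.PosSemidef) :
    ((V.card : ℝ) • ∑ v ∈ V, Q v * σ * Q v - σ).PosSemidef := by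
  have key : (2 : ℝ) • ((V.card : ℝ) • ∑ v ∈ V, Q v * σ * Q v - σ) =
      ∑ u ∈ V, ∑ v ∈ V, (Q u - Q v) * σ * (Q u - Q v) := by
    have h1 : ∑ u ∈ V, ∑ v ∈ V, Q u * σ * Q v = σ := by
      simp_rw [← Finset.mul_sum, hsum, mul_one, ← Finset.sum_mul, hsum, one_mul]
    have h2 : ∑ u ∈ V, ∑ v ∈ V, Q v * σ * Q u = σ := by
      rw [Finset.sum_comm]
      exact h1
    have h3 : ∑ u ∈ V, ∑ _v ∈ V, Q u * σ * Q u = (V.card : ℝ) • ∑ v ∈ V, Q v * σ * Q v := by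
      simp [Finset.smul_sum, ← Nat.cast_smul_eq_nsmul ℝ]
    have h4 : ∑ _u ∈ V, ∑ v ∈ V, Q v * σ * Q v = (V.card : ℝ) • ∑ v ∈ V, Q v * σ * Q v := by
      simp [← Nat.cast_smul_eq_nsmul ℝ]
    have h5 : ∀ u v, (Q u - Q v) * σ * (Q u - Q v) =
        Q u * σ * Q u + Q v * σ * Q v - Q u * σ * Q v - Q v * σ * Q u := by
      intro u v; noncomm_ring
    simp_rw [h5, Finset.sum_sub_distrib, Finset.sum_add_distrib, h1, h2, h3, h4]
    module
  have h : ((2 : ℝ)⁻¹ • ∑ u ∈ V, ∑ v ∈ V, (Q u - Q v) * σ * (Q u - Q v)).PosSemidef := by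
    refine posSemidef_real_smul (Matrix.posSemidef_sum _ fun u hu =>
      Matrix.posSemidef_sum _ fun v hv => ?_) (by norm_num)
    have := hσ.mul_mul_conjTranspose_same (Q u - Q v)
    rwa [((hQ u hu).sub (hQ v hv)).eq] at this
  rwa [← key, smul_smul, inv_mul_cancel₀ two_ne_zero, one_smul] at h

/-- A variational lower bound for the relative entropy, up to the logarithm of the number of
distinct eigenvalues of the second argument. -/
lemma exists_posDef_lt_of_lt_relEnt {σ ω : Matrix κ κ ℂ} (hσ : IsState σ) (hω : ω.PosSemidef)
    {N : ℕ} (hN : (Finset.univ.image hω.1.eigenvalues).card ≤ N) {r : ℝ}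
    (hr : (r : EReal) < relEnt σ ω) :
    ∃ H : Matrix κ κ ℂ, H.PosDef ∧ r - Real.log N < pair σ (matLog H) + (1 - pair ω H) := by
  obtain ⟨r', hr1, hr2⟩ := EReal.lt_iff_exists_real_btwn.mp hr
  have hrr : r < r' := EReal.coe_lt_coe_iff.mp hr1
  have hsm : ∀ᶠ ε in 𝓝[>] (0 : ℝ), ε * Fintype.card κ < r' - r := by
    have : Tendsto (fun ε : ℝ => ε * Fintype.card κ) (𝓝[>] 0) (𝓝 0) := by
      refine Tendsto.mono_left ?_ nhdsWithin_le_nhds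
      have : Continuous (fun ε : ℝ => ε * Fintype.card κ) := by fun_prop
      simpa using this.tendsto 0
    exact this.eventually (gt_mem_nhds (by linarith))
  obtain ⟨ε, ⟨h1, h2⟩, hε⟩ :=
    (((eventually_lt_relEntReg hσ.1 hω hr2).and hsm).and self_mem_nhdsWithin).exists
  have hε : 0 < ε := hε
  obtain ⟨U, hU, h⟩ := exists_uDiag hω.1
  have hw := hω.eigenvalues_nonneg
  set w := hω.1.eigenvalues
  set V := Finset.univ.image w with hV
  have hκ : Nonempty κ := by
    by_contra hne
    rw [not_nonempty_iff] at hne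
    have := hσ.2
    simp [Matrix.trace] at this
  have hVpos : 0 < V.card := Finset.card_pos.mpr (Finset.univ_nonempty.image _)
  have hVR : (1 : ℝ) ≤ V.card := by exact_mod_cast hVpos
  let q : ℝ → κ → ℝ := fun v i => if w i = v then 1 else 0
  let Q : ℝ → Matrix κ κ ℂ := fun v => uDiag U (q v)
  have hQ : ∀ v ∈ V, (Q v).IsHermitian := fun v _ => uDiag_isHermitian _ _
  have huDiag_sum : ∀ f : ℝ → κ → ℝ, uDiag U (∑ v ∈ V, f v) = ∑ v ∈ V, uDiag U (f v) := by
    intro f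
    exact map_sum (⟨⟨uDiag U, uDiag_zero U⟩, uDiag_add U⟩ : (κ → ℝ) →+ Matrix κ κ ℂ) f V
  have hsum : ∑ v ∈ V, Q v = 1 := by
    rw [← huDiag_sum, ← uDiag_one hU]
    congr 1
    ext i
    simp [q, hV]
  set D := ω + ε • (1 : Matrix κ κ ℂ) with hDdef
  have hDU : D = uDiag U (w + ε • 1) := by
    rw [uDiag_add, uDiag_smul, uDiag_one hU, ← h]
  have hQQ : ∀ v, Q v * Q v = Q v := by
    intro v
    simp only [Q]
    rw [uDiag_mul hU]
    congr 1
    ext i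
    simp [q]
  have hQD : ∀ v, Q v * D = (v + ε) • Q v := by
    intro v
    simp only [Q]
    rw [hDU, uDiag_mul hU, ← uDiag_smul]
    congr 1
    ext i
    by_cases hi : w i = v <;> simp [q, hi]
  have hDQ : ∀ v, D * Q v = (v + ε) • Q v := by
    intro v
    rw [← hQD v]
    simp only [Q]
    rw [hDU, uDiag_mul hU, uDiag_mul hU, mul_comm]
  set τ := ∑ v ∈ V, Q v * σ * Q v with hτ
  have hτpsd : τ.PosSemidef := Matrix.posSemidef_sum _ fun v hv => by
    have := hσ.1.mul_mul_conjTranspose_same (Q v)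
    rwa [(hQ v hv).eq] at this
  have hτtr : τ.trace = 1 := by
    rw [hτ, Matrix.trace_sum]
    have : ∀ v ∈ V, (Q v * σ * Q v).trace = (σ * Q v).trace := by
      intro v _
      rw [Matrix.trace_mul_comm, ← mul_assoc, hQQ, Matrix.trace_mul_comm]
    rw [Finset.sum_congr rfl this, ← Matrix.trace_sum, ← Finset.mul_sum, hsum, mul_one, hσ.2]
  have hDpd : D.PosDef := posDef_add_smul_one hω hε
  set A := τ + ε • (1 : Matrix κ κ ℂ) with hAdef
  have hApd : A.PosDef := posDef_add_smul_one hτpsd hε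
  have hcomm : Commute A D := by
    have h3 : Commute τ D := by
      rw [hτ]
      refine Commute.sum_left _ _ _ fun v _ => ?_
      rw [Commute, SemiconjBy, mul_assoc, hQD, ← mul_assoc, ← mul_assoc, hDQ]
      simp
    exact h3.add_left ((Commute.one_left D).smul_left ε)
  obtain ⟨H, hH, hlogH, hHD⟩ := exists_posDef_matLog_eq_sub hApd hDpd hcomm
  refine ⟨H, hH, ?_⟩
  have htr : pair ω H ≤ 1 + ε * Fintype.card κ := by
    have h3 : pair ω H ≤ pair D H :=
      pair_mono_left hH.posSemidef (by simpa [hDdef] using smul_one_posSemidef hε.le)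
    have h4 : pair D H = 1 + ε * Fintype.card κ := by
      rw [pair_comm, pair_apply, hHD, hAdef]
      simp [Matrix.trace_add, hτtr]
    linarith
  have hlog : pair σ (matLog (σ + ε • (1 : Matrix κ κ ℂ))) - Real.log V.card ≤
      pair σ (matLog A) := by
    have hp := posDef_add_smul_one hσ.1 hε
    have hm : (A - (V.card : ℝ)⁻¹ • (σ + ε • (1 : Matrix κ κ ℂ))).PosSemidef := by
      have h3 := posSemidef_real_smul (pinching_posSemidef V Q hQ hsum hσ.1)
        (inv_nonneg.mpr (by linarith : (0:ℝ) ≤ V.card))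
      have h4 := smul_one_posSemidef (κ := κ)
        (mul_nonneg hε.le (sub_nonneg.mpr (inv_le_one_of_one_le₀ hVR)))
      convert h3.add h4 using 1
      rw [← hτ, smul_sub, smul_smul, inv_mul_cancel₀ (by linarith), hAdef]
      module
    have hc : (0:ℝ) < (V.card : ℝ)⁻¹ := inv_pos.mpr (by linarith)
    have := pair_mono_right hσ.1 (matLog_mono (posDef_real_smul hp hc) hm)
    rw [matLog_smul hp hc, map_add, map_smul, pair_one_right, hσ.2, Real.log_inv] at this
    simp only [Complex.one_re, smul_eq_mul, mul_one] at this
    linarith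
  have hNlog : Real.log V.card ≤ Real.log N :=
    Real.log_le_log (by linarith) (by exact_mod_cast hN)
  have h5 := pair_matLog_le_add hσ.1 hε
  rw [relEntReg, ← hDdef] at h1
  rw [hlogH, map_sub]
  linarith

end Pinching

section WeakConverse

open scoped Matrix

variable {κ : Type*} [Fintype κ]

lemma classical_tail_bound (s w : κ → ℝ) (c : κ → κ → ℝ) (hs : ∀ i, 0 ≤ s i)
    (hw : ∀ j, 0 ≤ w j) (hc : ∀ i j, 0 ≤ c i j) (hc1 : ∀ i, ∑ j, c i j = 1)
    (hc2 : ∀ j, ∑ i, c i j = 1) (hs1 : ∑ i, s i = 1) (hw1 : ∑ j, w j ≤ 1)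
    (hsupp : ∀ i j, w j = 0 → s i * c i j = 0) {t : ℝ} (ht : 0 < t) :
    1 - ((∑ i, s i * Real.log (s i) - ∑ j, (∑ i, s i * c i j) * Real.log (w j)) + 1) / t ≤
      ∑ i, ∑ j, if s i ≤ Real.exp t * w j then s i * c i j else 0 := by
  have hterm : ∀ i j, t * (s i * c i j - if s i ≤ Real.exp t * w j then s i * c i j else 0) -
      w j * c i j ≤ s i * c i j * (Real.log (s i) - Real.log (w j)) := by
    intro i j
    have hq : 0 ≤ w j * c i j := mul_nonneg (hw j) (hc i j)
    by_cases hP : s i * c i j = 0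
    · simp [hP, hq]
    have hsi : 0 < s i := lt_of_le_of_ne (hs i) (fun h => hP (by simp [← h]))
    have hci : 0 < c i j := lt_of_le_of_ne (hc i j) (fun h => hP (by simp [← h]))
    have hwj : 0 < w j := lt_of_le_of_ne (hw j) (fun h => hP (hsupp i j h.symm))
    have hpos : 0 < s i * c i j := mul_pos hsi hci
    split_ifs with hg
    · have h1 := Real.log_le_sub_one_of_pos (div_pos hwj hsi)
      rw [Real.log_div hwj.ne' hsi.ne'] at h1
      have h2 := mul_le_mul_of_nonneg_left h1 hpos.le
      have h3 : s i * c i j * (w j / s i - 1) = w j * c i j - s i * c i j := by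
        field_simp
      rw [h3] at h2
      linarith
    · push Not at hg
      have h1 : t ≤ Real.log (s i) - Real.log (w j) := by
        have := Real.log_le_log (by positivity) hg.le
        rw [Real.log_mul (Real.exp_pos t).ne' hwj.ne', Real.log_exp] at this
        linarith
      nlinarith [mul_le_mul_of_nonneg_left h1 hpos.le]
  have hsum := Finset.sum_le_sum fun i (_ : i ∈ Finset.univ) =>
    Finset.sum_le_sum fun j (_ : j ∈ Finset.univ) => hterm i j
  simp only [Finset.sum_sub_distrib, ← Finset.mul_sum, mul_sub, hc1, mul_one, hs1] at hsum
  have h1 : ∑ i, ∑ j, w j * c i j = ∑ j, w j := by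
    rw [Finset.sum_comm]
    simp [← Finset.mul_sum, hc2]
  have h2 : ∑ i, ∑ j, s i * c i j * Real.log (s i) = ∑ i, s i * Real.log (s i) := by
    refine Finset.sum_congr rfl fun i _ => ?_
    rw [← Finset.sum_mul, ← Finset.mul_sum, hc1, mul_one]
  have h3 : ∑ i, ∑ j, s i * c i j * Real.log (w j) =
      ∑ j, (∑ i, s i * c i j) * Real.log (w j) := by
    rw [Finset.sum_comm]
    simp [Finset.sum_mul]
  rw [h1, h2, h3] at hsum
  rw [sub_le_iff_le_add, ← sub_le_iff_le_add', le_div_iff₀ ht]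
  linarith

lemma mul_conjTranspose_apply_self_re (X : Matrix κ κ ℂ) (i : κ) :
    ((X * Xᴴ) i i).re = ∑ j, Complex.normSq (X i j) := by
  rw [Matrix.mul_apply, Complex.re_sum]
  refine Finset.sum_congr rfl fun j _ => ?_
  rw [Matrix.conjTranspose_apply, ← starRingEnd_apply, Complex.mul_conj, Complex.ofReal_re]

lemma conjTranspose_mul_apply_self_re (X : Matrix κ κ ℂ) (i : κ) :
    ((Xᴴ * X) i i).re = ∑ j, Complex.normSq (X j i) := by
  have := mul_conjTranspose_apply_self_re Xᴴ i
  rw [Matrix.conjTranspose_conjTranspose] at this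
  rw [this]
  simp [Matrix.conjTranspose_apply, Complex.normSq_conj]

variable [DecidableEq κ]

lemma wts_uDiag (U V : Matrix κ κ ℂ) (s : κ → ℝ) (j : κ) :
    wts (uDiag U s) V j = ∑ i, s i * Complex.normSq ((Uᴴ * V) i j) := by
  have : Vᴴ * uDiag U s * V =
      (Uᴴ * V)ᴴ * (Matrix.diagonal (fun i => (s i : ℂ)) * (Uᴴ * V)) := by
    simp [uDiag, mul_assoc]
  rw [wts, this, Matrix.mul_apply, Complex.re_sum]
  refine Finset.sum_congr rfl fun i _ => ?_
  rw [Matrix.diagonal_mul, Matrix.conjTranspose_apply, ← starRingEnd_apply, mul_left_comm,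
    ← Complex.normSq_eq_conj_mul_self, ← Complex.ofReal_mul, Complex.ofReal_re]

lemma wts_uDiag_self {U : Matrix κ κ ℂ} (hU : U ∈ Matrix.unitaryGroup κ ℂ) (s : κ → ℝ) (i : κ) :
    wts (uDiag U s) U i = s i := by
  rw [wts_uDiag, show Uᴴ * U = 1 from Matrix.mem_unitaryGroup_iff'.mp hU]
  simp [Matrix.one_apply, apply_ite Complex.normSq]

lemma effect_sub_sq_posSemidef {E : Matrix κ κ ℂ} (hE : E.PosSemidef)
    (hE1 : (1 - E).PosSemidef) : (E - E * E).PosSemidef := by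
  obtain ⟨W, hW, h⟩ := exists_uDiag hE.1
  set e := hE.1.eigenvalues
  rw [h, ← uDiag_one hW, ← uDiag_sub, uDiag_posSemidef_iff hW] at hE1
  have h0 := hE.eigenvalues_nonneg
  rw [h, uDiag_mul hW, ← uDiag_sub]
  refine uDiag_posSemidef _ fun i => ?_
  have h1 := hE1 i
  have h2 : 0 ≤ e i := h0 i
  simp only [Pi.sub_apply, Pi.one_apply, Pi.mul_apply] at h1 ⊢
  nlinarith

/-- A one-shot weak converse for hypothesis testing in terms of the relative entropy. -/
lemma weak_converse {σ ω E : Matrix κ κ ℂ} (hσ : IsState σ) (hω : ω.PosSemidef)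
    (hω1 : ω.trace.re ≤ 1) (hE : E.PosSemidef) (hE1 : (1 - E).PosSemidef) {ε β D t : ℝ}
    (hε : pair σ (1 - E) ≤ ε) (hβ : pair ω E ≤ β) (hD : relEnt σ ω ≤ D) (ht : 0 < t) :
    1 - (D + 1) / t ≤ 2 * (ε + Real.exp t * β) := by
  obtain ⟨U, hU, hσU⟩ := exists_uDiag hσ.1.1
  have hs := hσ.1.eigenvalues_nonneg
  set s := hσ.1.1.eigenvalues
  obtain ⟨V, hV, hωV⟩ := exists_uDiag hω.1
  have hw := hω.eigenvalues_nonneg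
  set w := hω.1.eigenvalues
  have hU1 : Uᴴ * U = 1 := Matrix.mem_unitaryGroup_iff'.mp hU
  have hU2 : U * Uᴴ = 1 := Matrix.mem_unitaryGroup_iff.mp hU
  have hV1 : Vᴴ * V = 1 := Matrix.mem_unitaryGroup_iff'.mp hV
  have hV2 : V * Vᴴ = 1 := Matrix.mem_unitaryGroup_iff.mp hV
  set c : κ → κ → ℝ := fun i j => Complex.normSq ((Uᴴ * V) i j) with hcdef
  have hc : ∀ i j, 0 ≤ c i j := fun i j => Complex.normSq_nonneg _
  have hc1 : ∀ i, ∑ j, c i j = 1 := by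
    intro i
    rw [hcdef, ← mul_conjTranspose_apply_self_re, Matrix.conjTranspose_mul,
      Matrix.conjTranspose_conjTranspose, mul_assoc, ← mul_assoc V, hV2, one_mul, hU1]
    simp
  have hc2 : ∀ j, ∑ i, c i j = 1 := by
    intro j
    rw [hcdef, ← conjTranspose_mul_apply_self_re, Matrix.conjTranspose_mul,
      Matrix.conjTranspose_conjTranspose, mul_assoc, ← mul_assoc U, hU2, one_mul, hV1]
    simp
  have hs1 : ∑ i, s i = 1 := by
    have := sum_wts σ hU
    rw [hσ.2, Complex.one_re] at this
    rw [← this]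
    refine Finset.sum_congr rfl fun i _ => ?_
    conv_rhs => rw [hσU]
    rw [wts_uDiag_self hU]
  have hw1 : ∑ i, w i ≤ 1 := by
    have := sum_wts ω hV
    rw [← this] at hω1
    convert hω1 using 2 with i
    conv_rhs => rw [hωV]
    rw [wts_uDiag_self hV]
  have hwts : ∀ j, wts σ V j = ∑ i, s i * c i j := by
    intro j
    conv_lhs => rw [hσU]
    rw [wts_uDiag]
  have hlogσ : pair σ (matLog σ) = ∑ i, s i * Real.log (s i) := by
    have : matLog σ = uDiag U (fun i => Real.log (s i)) := by
      conv_lhs => rw [hσU]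
      rw [matLog_uDiag hU]
    rw [this, pair_uDiag]
    refine Finset.sum_congr rfl fun i _ => ?_
    conv_lhs => rw [hσU]
    rw [wts_uDiag_self hU]
  rw [hωV, relEnt_uDiag hσ.1 hV] at hD
  split_ifs at hD with hsupp
  swap
  · exact absurd (top_le_iff.mp hD) (EReal.coe_ne_top D)
  rw [EReal.coe_le_coe_iff, hlogσ] at hD
  simp only [hwts] at hD hsupp
  have hcl := classical_tail_bound s w c hs hw hc hc1 hc2 hs1 hw1 (fun i j hj => by
    have := hsupp j hj
    rw [Finset.sum_eq_zero_iff_of_nonneg fun i _ => mul_nonneg (hs i) (hc i j)] at this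
    exact this i (Finset.mem_univ i)) ht
  have hmono : 1 - (D + 1) / t ≤ 1 - ((∑ i, s i * Real.log (s i) -
      ∑ j, (∑ i, s i * c i j) * Real.log (w j)) + 1) / t := by
    gcongr
  refine hmono.trans (hcl.trans ?_)
  set F := 1 - E with hF
  have hF1 : (1 - F).PosSemidef := by simpa [hF] using hE
  have ha : ∑ i, ∑ j, s i * Complex.normSq ((Uᴴ * F * V) i j) ≤ ε := by
    have h1 : ∀ i, ∑ j, s i * Complex.normSq ((Uᴴ * F * V) i j) = wts (F * F) U i * s i := by
      intro i
      rw [← Finset.mul_sum, ← mul_conjTranspose_apply_self_re, mul_comm, wts]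
      congr 3
      simp only [Matrix.conjTranspose_mul, Matrix.conjTranspose_conjTranspose, hE1.1.eq]
      rw [show Uᴴ * F * V * (Vᴴ * (F * U)) = Uᴴ * F * (V * Vᴴ) * (F * U) by
        simp only [mul_assoc], hV2]
      simp only [mul_assoc, one_mul]
    rw [Finset.sum_congr rfl fun i _ => h1 i, ← pair_uDiag, ← hσU, pair_comm]
    exact (pair_mono_right hσ.1 (effect_sub_sq_posSemidef hE1 hF1)).trans hε
  have hb : ∑ i, ∑ j, w j * Complex.normSq ((Uᴴ * E * V) i j) ≤ β := by
    have h1 : ∀ j, ∑ i, w j * Complex.normSq ((Uᴴ * E * V) i j) = wts (E * E) V j * w j := by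
      intro i
      rw [← Finset.mul_sum, ← conjTranspose_mul_apply_self_re, mul_comm, wts]
      congr 3
      simp only [Matrix.conjTranspose_mul, Matrix.conjTranspose_conjTranspose, hE.1.eq]
      rw [show Vᴴ * (E * U) * (Uᴴ * E * V) = Vᴴ * E * (U * Uᴴ) * (E * V) by
        simp only [mul_assoc], hU2]
      simp only [mul_assoc, one_mul]
    rw [Finset.sum_comm, Finset.sum_congr rfl fun i _ => h1 i, ← pair_uDiag, ← hωV, pair_comm]
    exact (pair_mono_right hω (effect_sub_sq_posSemidef hE hE1)).trans hβ
  have hterm : ∀ i j, (if s i ≤ Real.exp t * w j then s i * c i j else 0) ≤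
      2 * (s i * Complex.normSq ((Uᴴ * F * V) i j)) +
      2 * Real.exp t * (w j * Complex.normSq ((Uᴴ * E * V) i j)) := by
    intro i j
    have hab : (Uᴴ * V) i j = (Uᴴ * F * V) i j + (Uᴴ * E * V) i j := by
      rw [← Matrix.add_apply, ← add_mul, ← mul_add, hF, sub_add_cancel, mul_one]
    have hcle : c i j ≤ 2 * (Complex.normSq ((Uᴴ * F * V) i j) +
        Complex.normSq ((Uᴴ * E * V) i j)) := by
      simp only [hcdef, hab, Complex.normSq_apply, Complex.add_re, Complex.add_im]
      nlinarith [sq_nonneg (((Uᴴ * F * V) i j).re - ((Uᴴ * E * V) i j).re),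
        sq_nonneg (((Uᴴ * F * V) i j).im - ((Uᴴ * E * V) i j).im)]
    have hA := Complex.normSq_nonneg ((Uᴴ * F * V) i j)
    have hB := Complex.normSq_nonneg ((Uᴴ * E * V) i j)
    have hsi : 0 ≤ s i := hs i
    have hwj : 0 ≤ w j := hw j
    split_ifs with hg
    · have h1 := mul_le_mul_of_nonneg_left hcle hsi
      have h2 := mul_le_mul_of_nonneg_right hg hB
      linarith
    · have := Real.exp_pos t
      positivity
  refine (Finset.sum_le_sum fun i _ => Finset.sum_le_sum fun j _ => hterm i j).trans ?_
  simp only [Finset.sum_add_distrib, ← Finset.mul_sum] at ha hb ⊢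
  have := mul_le_mul_of_nonneg_left hb (Real.exp_pos t).le
  linarith

end WeakConverse

section TensorAlgebra

open scoped Matrix Kronecker

lemma trace_re_mul_eq {κ : Type*} [Fintype κ] {A B : Matrix κ κ ℂ} (hA : A.IsHermitian)
    (hB : B.IsHermitian) : (A * B).trace = ((pair A B : ℝ) : ℂ) := by
  have h : star (A * B).trace = (A * B).trace := by
    rw [← Matrix.trace_conjTranspose, Matrix.conjTranspose_mul, hA.eq, hB.eq,
      Matrix.trace_mul_comm]
  exact (Complex.conj_eq_iff_re.mp h).symm

lemma posSemidef_of_forall_pair {κ : Type*} [Fintype κ] {A : Matrix κ κ ℂ} (hA : A.IsHermitian)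
    (h : ∀ B : Matrix κ κ ℂ, B.PosSemidef → 0 ≤ pair A B) : A.PosSemidef := by
  refine Matrix.posSemidef_iff_dotProduct_mulVec.mpr ⟨hA, fun x => ?_⟩
  have h1 := h _ (Matrix.posSemidef_vecMulVec_self_star x)
  rw [pair_apply, Matrix.mul_vecMulVec, Matrix.trace_vecMulVec, dotProduct_comm] at h1
  have h2 := hA.im_star_dotProduct_mulVec_self x
  exact Complex.le_def.mpr ⟨h1, h2.symm⟩

lemma IsState.smul_one_trace {κ : Type*} [Fintype κ] {A : Matrix κ κ ℂ} (hA : A.PosSemidef) :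
    A.trace = ((A.trace.re : ℝ) : ℂ) :=
  (Complex.conj_eq_iff_re.mp
    (by rw [starRingEnd_apply, ← Matrix.trace_conjTranspose, hA.1.eq])).symm

/-- A positive semidefinite matrix is a nonnegative multiple of a state, once there is a state. -/
lemma exists_state_smul {κ : Type*} [Fintype κ] {A : Matrix κ κ ℂ} (hA : A.PosSemidef)
    (hne : ∃ ρ : Matrix κ κ ℂ, IsState ρ) : ∃ ρ : Matrix κ κ ℂ, IsState ρ ∧
      A = A.trace.re • ρ := by
  by_cases h0 : A.trace.re = 0
  · obtain ⟨ρ, hρ⟩ := hne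
    refine ⟨ρ, hρ, ?_⟩
    rw [h0, zero_smul]
    have h1 : A.trace = 0 := by rw [IsState.smul_one_trace hA, h0, Complex.ofReal_zero]
    exact hA.trace_eq_zero_iff.mp h1
  · have hpos : 0 ≤ A.trace.re := (Complex.le_def.mp hA.trace_nonneg).1
    refine ⟨A.trace.re⁻¹ • A, ⟨posSemidef_real_smul hA (inv_nonneg.mpr hpos), ?_⟩, ?_⟩
    · rw [Matrix.trace_smul]
      nth_rewrite 2 [IsState.smul_one_trace hA]
      rw [Complex.real_smul, ← Complex.ofReal_mul, inv_mul_cancel₀ h0, Complex.ofReal_one]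
    · rw [smul_smul, mul_inv_cancel₀ h0, one_smul]

lemma trace_submatrix_equiv {κ κ' : Type*} [Fintype κ] [Fintype κ'] (A : Matrix κ κ ℂ)
    (e : κ' ≃ κ) : (A.submatrix e e).trace = A.trace := by
  simp only [Matrix.trace, Matrix.diag_apply, Matrix.submatrix_apply]
  exact e.sum_comp fun i => A i i

section TensorMul

variable {ι : Type*} {n m : ℕ}

lemma append_eq_append_iff {i j : Fin n → ι} {a b : Fin m → ι} :
    Fin.append i a = Fin.append j b ↔ i = j ∧ a = b := by
  have := (Fin.appendEquiv (α := ι) n m).injective.eq_iff (a := (i, a)) (b := (j, b))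
  rw [Prod.mk.injEq] at this
  exact this

lemma tensorMul_append (X : MatN ι n) (Y : MatN ι m) (i j : Fin n → ι) (a b : Fin m → ι) :
    tensorMul X Y (Fin.append i a) (Fin.append j b) = X i j * Y a b := by
  simp [tensorMul]

lemma tensorMul_eq_submatrix (X : MatN ι n) (Y : MatN ι m) : tensorMul X Y =
    (X ⊗ₖ Y).submatrix (Fin.appendEquiv n m).symm (Fin.appendEquiv n m).symm := rfl

lemma tensorMul_conjTranspose (X : MatN ι n) (Y : MatN ι m) :
    (tensorMul X Y)ᴴ = tensorMul Xᴴ Yᴴ := by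
  ext i j
  simp [tensorMul, Matrix.conjTranspose_apply]

variable [Fintype ι]

lemma tensorMul_posSemidef {X : MatN ι n} {Y : MatN ι m} (hX : X.PosSemidef)
    (hY : Y.PosSemidef) : (tensorMul X Y).PosSemidef := by
  rw [tensorMul_eq_submatrix]
  exact (hX.kronecker hY).submatrix _

variable [DecidableEq ι]

lemma tensorMul_mul (X X' : MatN ι n) (Y Y' : MatN ι m) :
    tensorMul X Y * tensorMul X' Y' = tensorMul (X * X') (Y * Y') := by
  simp only [tensorMul_eq_submatrix]
  rw [Matrix.submatrix_mul_equiv, Matrix.mul_kronecker_mul]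

lemma tensorMul_one : tensorMul (1 : MatN ι n) (1 : MatN ι m) = 1 := by
  rw [tensorMul_eq_submatrix, Matrix.one_kronecker_one, Matrix.submatrix_one_equiv]

lemma tensorMul_trace (X : MatN ι n) (Y : MatN ι m) :
    (tensorMul X Y).trace = X.trace * Y.trace := by
  rw [← Matrix.trace_kronecker, tensorMul_eq_submatrix]
  exact trace_submatrix_equiv _ _

lemma pair_tensorMul {X X' : MatN ι n} {Y Y' : MatN ι m} (hX : X.IsHermitian)
    (hX' : X'.IsHermitian) (hY : Y.IsHermitian) (hY' : Y'.IsHermitian) :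
    pair (tensorMul X Y) (tensorMul X' Y') = pair X X' * pair Y Y' := by
  rw [pair_apply, tensorMul_mul, tensorMul_trace, trace_re_mul_eq hX hX', trace_re_mul_eq hY hY',
    ← Complex.ofReal_mul, Complex.ofReal_re]

lemma tensorMul_mem_unitaryGroup {U : MatN ι n} {V : MatN ι m}
    (hU : U ∈ Matrix.unitaryGroup _ ℂ) (hV : V ∈ Matrix.unitaryGroup _ ℂ) :
    tensorMul U V ∈ Matrix.unitaryGroup (Fin (n + m) → ι) ℂ := by
  rw [Matrix.mem_unitaryGroup_iff, Matrix.star_eq_conjTranspose, tensorMul_conjTranspose,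
    tensorMul_mul]
  rw [Matrix.mem_unitaryGroup_iff, Matrix.star_eq_conjTranspose] at hU hV
  rw [hU, hV, tensorMul_one]

lemma uDiag_tensorMul (U : MatN ι n) (V : MatN ι m) (y : (Fin n → ι) → ℝ)
    (h : (Fin m → ι) → ℝ) :
    uDiag (tensorMul U V) (fun i => y (fun t => i (Fin.castAdd m t)) *
      h (fun t => i (Fin.natAdd n t))) = tensorMul (uDiag U y) (uDiag V h) := by
  have : (Matrix.diagonal fun i : Fin (n + m) → ι => (((y (fun t => i (Fin.castAdd m t)) *
      h (fun t => i (Fin.natAdd n t)) : ℝ)) : ℂ)) =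
      tensorMul (Matrix.diagonal fun i => (y i : ℂ)) (Matrix.diagonal fun i => (h i : ℂ)) := by
    ext i j
    obtain ⟨⟨i, a⟩, rfl⟩ := (Fin.appendEquiv n m).surjective i
    obtain ⟨⟨j, b⟩, rfl⟩ := (Fin.appendEquiv n m).surjective j
    simp only [Fin.appendEquiv, Equiv.coe_fn_mk, tensorMul_append, Matrix.diagonal_apply,
      Fin.append_left, Fin.append_right, append_eq_append_iff]
    by_cases h1 : i = j <;> by_cases h2 : a = b <;> simp [h1, h2]
  rw [uDiag, uDiag, uDiag, this, tensorMul_conjTranspose, tensorMul_mul, tensorMul_mul]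

lemma sum_append {M : Type*} [AddCommMonoid M] (f : (Fin (n + m) → ι) → M) :
    ∑ x, f x = ∑ i, ∑ a, f (Fin.append i a) := by
  rw [← (Fin.appendEquiv n m).sum_comp, Fintype.sum_prod_type]
  rfl

lemma trace_condReduce_mul (ρ : MatN ι (n + m)) (F : MatN ι m) (Z : MatN ι n) :
    (condReduce ρ F * Z).trace = (ρ * tensorMul Z F).trace := by
  simp only [Matrix.trace, Matrix.diag_apply, Matrix.mul_apply, condReduce, sum_append,
    tensorMul_append, Finset.sum_mul]
  refine Finset.sum_congr rfl fun i _ => ?_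
  rw [Finset.sum_comm]
  refine Finset.sum_congr rfl fun a _ => Finset.sum_congr rfl fun j _ =>
    Finset.sum_congr rfl fun b _ => by ring

lemma pair_condReduce (ρ : MatN ι (n + m)) (F : MatN ι m) (Z : MatN ι n) :
    pair (condReduce ρ F) Z = pair ρ (tensorMul Z F) := by
  rw [pair_apply, trace_condReduce_mul, pair_apply]

lemma condReduce_posSemidef {ρ : MatN ι (n + m)} {F : MatN ι m} (hρ : ρ.PosSemidef)
    (hF : F.PosSemidef) : (condReduce ρ F).PosSemidef := by
  refine posSemidef_of_forall_pair ?_ fun Z hZ => ?_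
  · ext i j
    rw [Matrix.conjTranspose_apply, condReduce, star_sum]
    simp only [star_sum, star_mul']
    rw [Finset.sum_comm]
    refine Finset.sum_congr rfl fun a _ => Finset.sum_congr rfl fun b _ => ?_
    rw [← hρ.1.apply (Fin.append i a), ← hF.1.apply b a]
  · rw [pair_condReduce]
    exact pair_nonneg hρ (tensorMul_posSemidef hZ hF)

/-- The reduced matrix on the last `m` copies. -/
def restLast (ρ : MatN ι (n + m)) : MatN ι m :=
  fun a b => ∑ i : Fin n → ι, ρ (Fin.append i a) (Fin.append i b)

lemma restLast_posSemidef {ρ : MatN ι (n + m)} (hρ : ρ.PosSemidef) :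
    (restLast ρ).PosSemidef := by
  have : restLast ρ = ∑ i : Fin n → ι, ρ.submatrix (Fin.append i) (Fin.append i) := by
    ext a b
    simp [restLast, Matrix.sum_apply]
  rw [this]
  exact Matrix.posSemidef_sum _ fun i _ => hρ.submatrix _

lemma trace_restLast_mul (ρ : MatN ι (n + m)) (F : MatN ι m) :
    (restLast ρ * F).trace = (ρ * tensorMul 1 F).trace := by
  simp only [Matrix.trace, Matrix.diag_apply, Matrix.mul_apply, restLast, sum_append,
    tensorMul_append, Finset.sum_mul, Matrix.one_apply]
  have h : ∀ (i : Fin n → ι) (a : Fin m → ι),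
      ∑ j : Fin n → ι, ∑ b : Fin m → ι, ρ (Fin.append i a) (Fin.append j b) *
        ((if j = i then 1 else 0) * F b a) =
      ∑ b : Fin m → ι, ρ (Fin.append i a) (Fin.append i b) * F b a := by
    intro i a
    rw [Finset.sum_comm]
    simp
  simp only [h]
  symm
  rw [Finset.sum_comm]
  exact Finset.sum_congr rfl fun a _ => Finset.sum_comm

lemma restLast_trace (ρ : MatN ι (n + m)) : (restLast ρ).trace = ρ.trace := by
  have := trace_restLast_mul ρ 1
  rwa [tensorMul_one, mul_one, mul_one] at this

end TensorMul

section ProdState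

variable {ιA ιB : Type*} {n m : ℕ}

lemma prodStateAB_eq_submatrix (α : MatN ιA n) (β : MatN ιB n) : prodStateAB α β =
    (α ⊗ₖ β).submatrix (Equiv.arrowProdEquivProdArrow _ (fun _ => ιA) (fun _ => ιB))
      (Equiv.arrowProdEquivProdArrow _ (fun _ => ιA) (fun _ => ιB)) := rfl

lemma prodStateAB_conjTranspose (α : MatN ιA n) (β : MatN ιB n) :
    (prodStateAB α β)ᴴ = prodStateAB αᴴ βᴴ := by
  ext i j
  simp [prodStateAB, Matrix.conjTranspose_apply]

variable [Fintype ιA] [Fintype ιB]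

lemma prodStateAB_posSemidef {α : MatN ιA n} {β : MatN ιB n} (hα : α.PosSemidef)
    (hβ : β.PosSemidef) : (prodStateAB α β).PosSemidef := by
  rw [prodStateAB_eq_submatrix]
  exact (hα.kronecker hβ).submatrix _

lemma prodStateAB_trace (α : MatN ιA n) (β : MatN ιB n) :
    (prodStateAB α β).trace = α.trace * β.trace := by
  rw [← Matrix.trace_kronecker, prodStateAB_eq_submatrix]
  exact trace_submatrix_equiv _ _

lemma IsState.prodStateAB {α : MatN ιA n} {β : MatN ιB n} (hα : IsState α) (hβ : IsState β) :
    IsState (prodStateAB α β) :=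
  ⟨prodStateAB_posSemidef hα.1 hβ.1, by rw [prodStateAB_trace, hα.2, hβ.2, one_mul]⟩

lemma prodStateAB_smul_smul (a b : ℝ) (α : MatN ιA n) (β : MatN ιB n) :
    prodStateAB (a • α) (b • β) = (a * b) • prodStateAB α β := by
  ext i j
  simp [prodStateAB]
  ring

variable [DecidableEq ιA] [DecidableEq ιB]

lemma prodStateAB_one : prodStateAB (1 : MatN ιA n) (1 : MatN ιB n) = 1 := by
  rw [prodStateAB_eq_submatrix, Matrix.one_kronecker_one, Matrix.submatrix_one_equiv]

lemma sum_prod_fun {M : Type*} [AddCommMonoid M] (f : (Fin n → ιA × ιB) → M) :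
    ∑ x, f x = ∑ a : Fin n → ιA, ∑ b : Fin n → ιB, f (fun t => (a t, b t)) := by
  rw [← (Equiv.arrowProdEquivProdArrow _ (fun _ => ιA) (fun _ => ιB)).symm.sum_comp,
    Fintype.sum_prod_type]
  rfl

lemma fst_append {ιA ιB : Type*} (x : Fin n → ιA × ιB) (y : Fin m → ιA × ιB) :
    (fun t => (Fin.append x y t).1) = Fin.append (fun t => (x t).1) (fun t => (y t).1) := by
  ext t
  refine Fin.addCases (fun i => ?_) (fun i => ?_) t <;> simp

lemma snd_append {ιA ιB : Type*} (x : Fin n → ιA × ιB) (y : Fin m → ιA × ιB) :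
    (fun t => (Fin.append x y t).2) = Fin.append (fun t => (x t).2) (fun t => (y t).2) := by
  ext t
  refine Fin.addCases (fun i => ?_) (fun i => ?_) t <;> simp

lemma condReduce_prodStateAB (α : MatN ιA (n + m)) (β : MatN ιB (n + m)) (P : MatN ιA m)
    (Q : MatN ιB m) : condReduce (prodStateAB α β) (prodStateAB P Q) =
      prodStateAB (condReduce α P) (condReduce β Q) := by
  ext i j
  simp only [condReduce, prodStateAB, fst_append, snd_append, sum_prod_fun, Finset.sum_mul_sum]
  refine Finset.sum_congr rfl fun a _ => Finset.sum_congr rfl fun a' _ =>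
    Finset.sum_congr rfl fun b _ => Finset.sum_congr rfl fun b' _ => by ring

lemma restLast_prodStateAB (α : MatN ιA (n + m)) (β : MatN ιB (n + m)) :
    restLast (prodStateAB α β) = prodStateAB (restLast α) (restLast β) := by
  ext i j
  simp only [restLast, prodStateAB, fst_append, snd_append, sum_prod_fun, Finset.sum_mul_sum]

end ProdState

end TensorAlgebra

section SepCone

open scoped Matrix

variable {ιA ιB : Type*} [Fintype ιA] [Fintype ιB] {n k : ℕ}

lemma pair_le_of_mem_sepSet {X : MatN (ιA × ιB) n} {c : ℝ}
    (h : ∀ α β, IsState α → IsState β → pair (prodStateAB α β) X ≤ c)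
    {σ : MatN (ιA × ιB) n} (hσ : σ ∈ sepSet ιA ιB n) : pair σ X ≤ c := by
  have hconv : Convex ℝ {σ : MatN (ιA × ιB) n | pair σ X ≤ c} :=
    convex_halfSpace_le (IsLinearMap.mk (by simp) (by simp)) c
  refine convexHull_min ?_ hconv hσ
  rintro _ ⟨α, β, hα, hβ, rfl⟩
  exact h α β hα hβ

lemma convex_isState {κ : Type*} [Fintype κ] : Convex ℝ {ρ : Matrix κ κ ℂ | IsState ρ} := by
  intro ρ hρ σ hσ a b ha hb hab
  refine ⟨convex_posSemidef hρ.1 hσ.1 ha hb hab, ?_⟩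
  rw [Matrix.trace_add, Matrix.trace_smul, Matrix.trace_smul, hρ.2, hσ.2, ← add_smul, hab,
    one_smul]

lemma isState_of_mem_sepSet {σ : MatN (ιA × ιB) n} (hσ : σ ∈ sepSet ιA ιB n) : IsState σ := by
  refine convexHull_min ?_ convex_isState hσ
  rintro _ ⟨α, β, hα, hβ, rfl⟩
  exact hα.prodStateAB hβ

/-- The cone of separable operators. -/
def sepCone (ιA ιB : Type*) [Fintype ιA] [Fintype ιB] (k : ℕ) :
    AddSubmonoid (MatN (ιA × ιB) k) :=
  AddSubmonoid.closure {X | ∃ P Q, P.PosSemidef ∧ Q.PosSemidef ∧ X = prodStateAB P Q}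

lemma prodStateAB_mem_sepCone {P : MatN ιA k} {Q : MatN ιB k} (hP : P.PosSemidef)
    (hQ : Q.PosSemidef) : prodStateAB P Q ∈ sepCone ιA ιB k :=
  AddSubmonoid.subset_closure ⟨P, Q, hP, hQ, rfl⟩

lemma smul_mem_sepCone {c : ℝ} (hc : 0 ≤ c) {X : MatN (ιA × ιB) k}
    (hX : X ∈ sepCone ιA ιB k) : c • X ∈ sepCone ιA ιB k := by
  induction hX using AddSubmonoid.closure_induction with
  | mem X h =>
    obtain ⟨P, Q, hP, hQ, rfl⟩ := h
    have := prodStateAB_smul_smul c 1 P Q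
    rw [one_smul, mul_one] at this
    rw [← this]
    exact prodStateAB_mem_sepCone (posSemidef_real_smul hP hc) hQ
  | zero =>
    rw [smul_zero]
    exact zero_mem _
  | add X Y _ _ hX hY =>
    rw [smul_add]
    exact add_mem hX hY

variable [DecidableEq ιA] [DecidableEq ιB]

lemma one_mem_sepCone : (1 : MatN (ιA × ιB) k) ∈ sepCone ιA ιB k := by
  rw [← prodStateAB_one]
  exact prodStateAB_mem_sepCone Matrix.PosSemidef.one Matrix.PosSemidef.one

lemma exists_abs_le_smul_one {κ : Type*} [Fintype κ] [DecidableEq κ] {P : Matrix κ κ ℂ}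
    (hP : P.IsHermitian) : ∃ p : ℝ, 0 ≤ p ∧ (p • (1 : Matrix κ κ ℂ) + P).PosSemidef ∧
      (p • (1 : Matrix κ κ ℂ) - P).PosSemidef := by
  obtain ⟨U, hU, h⟩ := exists_uDiag hP
  set d := hP.eigenvalues
  have hd : ∀ i, |d i| ≤ ∑ j, |d j| := fun i =>
    Finset.single_le_sum (f := fun j => |d j|) (fun j _ => abs_nonneg _) (Finset.mem_univ i)
  refine ⟨∑ i, |d i|, Finset.sum_nonneg fun i _ => abs_nonneg _, ?_, ?_⟩
  · rw [h, ← uDiag_one hU, ← uDiag_smul, ← uDiag_add]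
    refine uDiag_posSemidef _ fun i => ?_
    have := neg_abs_le (d i)
    simp only [Pi.add_apply, Pi.smul_apply, Pi.one_apply, smul_eq_mul, mul_one]
    linarith [hd i]
  · rw [h, ← uDiag_one hU, ← uDiag_smul, ← uDiag_sub]
    refine uDiag_posSemidef _ fun i => ?_
    have := le_abs_self (d i)
    simp only [Pi.sub_apply, Pi.smul_apply, Pi.one_apply, smul_eq_mul, mul_one]
    linarith [hd i]

lemma exists_smul_one_add_prodStateAB_mem {P : MatN ιA k} {Q : MatN ιB k} (hP : P.IsHermitian)
    (hQ : Q.IsHermitian) :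
    ∃ c : ℝ, 0 ≤ c ∧ c • (1 : MatN (ιA × ιB) k) + prodStateAB P Q ∈ sepCone ιA ιB k := by
  obtain ⟨p, hp, hp1, hp2⟩ := exists_abs_le_smul_one hP
  obtain ⟨q, hq, hq1, hq2⟩ := exists_abs_le_smul_one hQ
  refine ⟨p * q, mul_nonneg hp hq, ?_⟩
  have : (p * q) • (1 : MatN (ιA × ιB) k) + prodStateAB P Q =
      (2⁻¹ : ℝ) • (prodStateAB (p • 1 + P) (q • 1 + Q) + prodStateAB (p • 1 - P) (q • 1 - Q)) := by
    rw [← prodStateAB_one, ← prodStateAB_smul_smul]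
    ext i j
    simp [prodStateAB]
    ring
  rw [this]
  exact smul_mem_sepCone (by norm_num)
    (add_mem (prodStateAB_mem_sepCone hp1 hq1) (prodStateAB_mem_sepCone hp2 hq2))

lemma exists_smul_one_add_sum_mem {α : Type*} (s : Finset α) (X : α → MatN (ιA × ιB) k)
    (h : ∀ a ∈ s, ∃ c : ℝ, 0 ≤ c ∧ c • (1 : MatN (ιA × ιB) k) + X a ∈ sepCone ιA ιB k) :
    ∃ c : ℝ, 0 ≤ c ∧ c • (1 : MatN (ιA × ιB) k) + ∑ a ∈ s, X a ∈ sepCone ιA ιB k := by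
  choose! c hc0 hc using h
  refine ⟨∑ a ∈ s, c a, Finset.sum_nonneg hc0, ?_⟩
  rw [Finset.sum_smul, ← Finset.sum_add_distrib]
  exact sum_mem hc

/-- The identity is an interior point of the cone of separable operators. -/
lemma exists_smul_one_add_mem_sepCone {L : MatN (ιA × ιB) k} (hL : L.IsHermitian) :
    ∃ c : ℝ, 0 ≤ c ∧ c • (1 : MatN (ιA × ιB) k) + L ∈ sepCone ιA ιB k := by
  have hsingle : ∀ (z : ℂ) (X : MatN ιA k) (Y : MatN ιB k), ∃ c : ℝ, 0 ≤ c ∧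
      c • (1 : MatN (ιA × ιB) k) + (prodStateAB (z • X) Y + (prodStateAB (z • X) Y)ᴴ) ∈
        sepCone ιA ιB k := by
    intro z X Y
    set X' := z • X
    obtain ⟨c, hc, hc'⟩ := exists_smul_one_add_prodStateAB_mem
      (P := X' + X'ᴴ) (Q := (2⁻¹ : ℂ) • (Y + Yᴴ))
      (by simp [Matrix.IsHermitian, add_comm]) (by simp [Matrix.IsHermitian, add_comm])
    obtain ⟨e, he, he'⟩ := exists_smul_one_add_prodStateAB_mem
      (P := Complex.I • (X' - X'ᴴ)) (Q := (-2⁻¹ : ℂ) • Complex.I • (Y - Yᴴ))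
      (by simp [Matrix.IsHermitian, Matrix.conjTranspose_smul, ← smul_neg])
      (by simp [Matrix.IsHermitian, Matrix.conjTranspose_smul, ← smul_neg])
    refine ⟨c + e, add_nonneg hc he, ?_⟩
    convert add_mem hc' he' using 1
    have : prodStateAB X' Y + (prodStateAB X' Y)ᴴ =
        prodStateAB (X' + X'ᴴ) ((2⁻¹ : ℂ) • (Y + Yᴴ)) +
        prodStateAB (Complex.I • (X' - X'ᴴ)) ((-2⁻¹ : ℂ) • Complex.I • (Y - Yᴴ)) := by
      rw [prodStateAB_conjTranspose]
      ext i j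
      simp only [prodStateAB, Matrix.add_apply, Matrix.smul_apply, Matrix.sub_apply, smul_eq_mul]
      linear_combination (2⁻¹ : ℂ) * (-X' (fun k => (i k).1) (fun k => (j k).1) +
        X'ᴴ (fun k => (i k).1) (fun k => (j k).1)) *
        (-Y (fun k => (i k).2) (fun k => (j k).2) + Yᴴ (fun k => (i k).2) (fun k => (j k).2)) *
        Complex.I_sq
    rw [this]
    module
  have hdec : L = ∑ a, ∑ b, (prodStateAB
        ((L a b / 2) • (Matrix.single (fun t => (a t).1) (fun t => (b t).1) 1 : MatN ιA k))
        (Matrix.single (fun t => (a t).2) (fun t => (b t).2) 1 : MatN ιB k) +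
      (prodStateAB
        ((L a b / 2) • (Matrix.single (fun t => (a t).1) (fun t => (b t).1) 1 : MatN ιA k))
        (Matrix.single (fun t => (a t).2) (fun t => (b t).2) 1 : MatN ιB k))ᴴ) := by
    have h1 : ∀ a b : Fin k → ιA × ιB, prodStateAB
        ((L a b / 2) • (Matrix.single (fun t => (a t).1) (fun t => (b t).1) 1 : MatN ιA k))
        (Matrix.single (fun t => (a t).2) (fun t => (b t).2) 1 : MatN ιB k) =
        (2⁻¹ : ℝ) • Matrix.single a b (L a b) := by
      intro a b
      ext i j
      have hab : ∀ x y : Fin k → ιA × ιB, x = y ↔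
          (fun t => (x t).1) = (fun t => (y t).1) ∧ (fun t => (x t).2) = (fun t => (y t).2) := by
        intro x y
        simp only [funext_iff, Prod.ext_iff]
        exact forall_and
      simp only [prodStateAB, Matrix.smul_apply, Matrix.single_apply, hab a i, hab b j]
      by_cases h1 : (fun t => (a t).1) = (fun t => (i t).1) <;>
      by_cases h2 : (fun t => (a t).2) = (fun t => (i t).2) <;>
      by_cases h3 : (fun t => (b t).1) = (fun t => (j t).1) <;>
      by_cases h4 : (fun t => (b t).2) = (fun t => (j t).2) <;>
      simp [h1, h2, h3, h4]
      ring
    simp only [h1, Finset.sum_add_distrib, ← Matrix.conjTranspose_sum, ← Finset.smul_sum]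
    rw [← Matrix.matrix_eq_sum_single, Matrix.conjTranspose_smul, hL.eq, ← add_smul]
    simp
    norm_num
  rw [hdec]
  exact exists_smul_one_add_sum_mem _ _ fun a _ => exists_smul_one_add_sum_mem _ _ fun b _ =>
    hsingle _ _ _

lemma restLast_isState {ι : Type*} [Fintype ι] [DecidableEq ι] {ρ : MatN ι (n + k)}
    (hρ : IsState ρ) : IsState (restLast ρ) :=
  ⟨restLast_posSemidef hρ.1, by rw [restLast_trace, hρ.2]⟩

lemma condReduce_one_isState {ι : Type*} [Fintype ι] [DecidableEq ι] {ρ : MatN ι (n + k)}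
    (hρ : IsState ρ) : IsState (condReduce ρ 1) := by
  refine ⟨condReduce_posSemidef hρ.1 Matrix.PosSemidef.one, ?_⟩
  have := trace_condReduce_mul ρ 1 1
  rwa [tensorMul_one, mul_one, mul_one, hρ.2] at this

/-- Filtering a separable state by a separable operator yields an unnormalised separable state. -/
lemma pair_tensorMul_sepCone_le {F : MatN (ιA × ιB) k} (hF : F ∈ sepCone ιA ιB k)
    {Z : MatN (ιA × ιB) n} {z : ℝ} (hZ : ∀ σ ∈ sepSet ιA ιB n, pair σ Z ≤ z)
    {α : MatN ιA (n + k)} {β : MatN ιB (n + k)} (hα : IsState α) (hβ : IsState β) :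
    pair (prodStateAB α β) (tensorMul Z F) ≤ z * pair (prodStateAB α β) (tensorMul 1 F) := by
  simp only [← pair_condReduce]
  have hlin : ∀ X Y : MatN (ιA × ιB) k, condReduce (prodStateAB α β) (X + Y) =
      condReduce (prodStateAB α β) X + condReduce (prodStateAB α β) Y := by
    intro X Y
    ext i j
    simp [condReduce, mul_add, Finset.sum_add_distrib]
  induction hF using AddSubmonoid.closure_induction with
  | mem X h =>
    obtain ⟨P, Q, hP, hQ, rfl⟩ := h
    rw [condReduce_prodStateAB]
    obtain ⟨α', hα', h1⟩ := exists_state_smul (condReduce_posSemidef hα.1 hP)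
      ⟨_, condReduce_one_isState hα⟩
    obtain ⟨β', hβ', h2⟩ := exists_state_smul (condReduce_posSemidef hβ.1 hQ)
      ⟨_, condReduce_one_isState hβ⟩
    have ha : 0 ≤ (condReduce α P).trace.re :=
      (Complex.le_def.mp (condReduce_posSemidef hα.1 hP).trace_nonneg).1
    have hb : 0 ≤ (condReduce β Q).trace.re :=
      (Complex.le_def.mp (condReduce_posSemidef hβ.1 hQ).trace_nonneg).1
    rw [h1, h2, prodStateAB_smul_smul, map_smul, LinearMap.smul_apply, LinearMap.smul_apply,
      pair_one_right, (hα'.prodStateAB hβ').2, Complex.one_re, smul_eq_mul, smul_eq_mul,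
      mul_one, mul_comm z]
    exact mul_le_mul_of_nonneg_left
      (hZ _ (subset_convexHull ℝ _ ⟨α', β', hα', hβ', rfl⟩)) (mul_nonneg ha hb)
  | zero =>
    have : condReduce (prodStateAB α β) (0 : MatN (ιA × ιB) k) = 0 := by
      ext i j
      simp [condReduce]
    simp [this]
  | add X Y _ _ hX hY =>
    rw [hlin, map_add, LinearMap.add_apply, LinearMap.add_apply, mul_add]
    exact add_le_add hX hY

lemma pair_tensorMul_one (ρ : MatN (ιA × ιB) (n + k)) (F : MatN (ιA × ιB) k) :
    pair ρ (tensorMul 1 F) = pair (restLast ρ) F := by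
  rw [pair_apply, pair_apply, trace_restLast_mul]

end SepCone

section TensorProdFam

open scoped Matrix

variable {ι : Type*} [Fintype ι] {n m : ℕ}

lemma tensorProdFam_mul (f g : Fin n → MatC ι) :
    tensorProdFam f * tensorProdFam g = tensorProdFam (fun p => f p * g p) := by
  ext i j
  simp only [tensorProdFam, Matrix.mul_apply, ← Finset.prod_mul_distrib]
  rw [Finset.prod_univ_sum, Fintype.piFinset_univ]

lemma tensorProdFam_conjTranspose (f : Fin n → MatC ι) :
    (tensorProdFam f)ᴴ = tensorProdFam (fun p => (f p)ᴴ) := by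
  ext i j
  simp [tensorProdFam, Matrix.conjTranspose_apply]

lemma tensorProdFam_trace (f : Fin n → MatC ι) :
    (tensorProdFam f).trace = ∏ p, (f p).trace := by
  simp only [tensorProdFam, Matrix.trace, Matrix.diag]
  rw [Finset.prod_univ_sum, Fintype.piFinset_univ]

lemma tensorProdFam_posSemidef {f : Fin n → MatC ι} (hf : ∀ p, (f p).PosSemidef) :
    (tensorProdFam f).PosSemidef := by
  choose B hB using fun p => exists_conjTranspose_mul_self (hf p)
  have : tensorProdFam f = (tensorProdFam B)ᴴ * tensorProdFam B := by
    rw [tensorProdFam_conjTranspose, tensorProdFam_mul, funext hB]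
  rw [this]
  exact Matrix.posSemidef_conjTranspose_mul_self _

lemma IsState.tensorProdFam {f : Fin n → MatC ι} (hf : ∀ p, IsState (f p)) :
    IsState (tensorProdFam f) :=
  ⟨tensorProdFam_posSemidef fun p => (hf p).1, by
    rw [tensorProdFam_trace, Finset.prod_eq_one fun p _ => (hf p).2]⟩

lemma tensorProdFam_add (f : Fin (n + m) → MatC ι) : tensorProdFam f =
    tensorMul (tensorProdFam fun p => f (Fin.castAdd m p))
      (tensorProdFam fun p => f (Fin.natAdd n p)) := by
  ext i j
  simp [tensorProdFam, tensorMul, Fin.prod_univ_add]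

lemma isState_of_mem_avSet {G : Set (MatC ι)} (hG : ∀ ρ ∈ G, IsState ρ) {ω : MatN ι n}
    (hω : ω ∈ avSet G n) : IsState ω := by
  obtain ⟨f, hf, rfl⟩ := hω
  exact IsState.tensorProdFam fun p => hG _ (hf p)

lemma tensorMul_sub_right (X : MatN ι n) (Y Y' : MatN ι m) :
    tensorMul X (Y - Y') = tensorMul X Y - tensorMul X Y' := by
  ext i j
  simp [tensorMul, mul_sub]

end TensorProdFam

section Direct

open scoped Matrix

lemma typeII_le {κ : Type*} [Fintype κ] [DecidableEq κ] {A B : Set (Matrix κ κ ℂ)} {ε β : ℝ}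
    (hB : ∀ σ ∈ B, σ.PosSemidef) {E : Matrix κ κ ℂ} (hE : E.PosSemidef)
    (hE1 : (1 - E).PosSemidef) (hA : ∀ ρ ∈ A, pair ρ (1 - E) ≤ ε)
    (hβ : ∀ σ ∈ B, pair σ E ≤ β) (hβ0 : 0 ≤ β) : typeII A B ε ≤ β := by
  refine le_trans (b := sSup {x : ℝ | ∃ σ ∈ B, x = (σ * E).trace.re})
    (csInf_le ⟨0, ?_⟩ ⟨E, hE, hE1, hA, rfl⟩) (Real.sSup_le ?_ hβ0)
  · rintro b ⟨E', hE', -, -, rfl⟩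
    refine Real.sSup_nonneg ?_
    rintro x ⟨σ, hσ, rfl⟩
    exact pair_nonneg (hB σ hσ) hE'
  · rintro x ⟨σ, hσ, rfl⟩
    exact hβ σ hσ

lemma le_negLog {x t : ℝ} (h : x ≤ Real.exp (-t)) : (t : EReal) ≤ negLog x := by
  unfold negLog
  split_ifs with hx
  · exact le_top
  · rw [EReal.coe_le_coe_iff, le_neg, ← Real.log_exp (-t)]
    exact Real.log_le_log (not_le.1 hx) h

lemma one_sub_min_exp_le {s : ℝ} (hs : 0 ≤ s) (t : ℝ) :
    1 - min 1 (Real.exp t) ≤ Real.exp (-(s * t)) := by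
  rcases le_total 0 t with ht | ht
  · rw [min_eq_left (Real.one_le_exp ht), sub_self]
    exact (Real.exp_pos _).le
  · have h1 : 1 ≤ Real.exp (-(s * t)) := Real.one_le_exp (by nlinarith)
    have h2 : 0 ≤ min 1 (Real.exp t) := le_min zero_le_one (Real.exp_pos _).le
    linarith

/-- A Neyman-Pearson type test built from a single observable. -/
lemma typeII_le_of_spectrum {κ : Type*} [Fintype κ] [DecidableEq κ] {A B : Set (Matrix κ κ ℂ)}
    (hA : ∀ σ ∈ A, σ.PosSemidef) (hB : ∀ ω ∈ B, ω.PosSemidef) {s z ε : ℝ} (hs : 0 ≤ s)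
    {U : Matrix κ κ ℂ} (hU : U ∈ Matrix.unitaryGroup κ ℂ) {y : κ → ℝ}
    (hy1 : ∀ ω ∈ B, pair ω (uDiag U (fun i => Real.exp (y i))) ≤ 1)
    (hy2 : ∀ σ ∈ A, pair σ (uDiag U (fun i => Real.exp (-(s * y i)))) ≤ z) (t : ℝ)
    (hε : Real.exp (s * t) * z ≤ ε) : typeII A B ε ≤ Real.exp (-t) := by
  have hE1 : 1 - uDiag U (fun i => min 1 (Real.exp (y i - t))) =
      uDiag U (fun i => 1 - min 1 (Real.exp (y i - t))) := by
    rw [← uDiag_one hU]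
    exact (uDiag_sub U 1 _).symm
  refine typeII_le hB (E := uDiag U (fun i => min 1 (Real.exp (y i - t))))
    (uDiag_posSemidef U fun i => le_min zero_le_one (Real.exp_pos _).le) ?_ ?_ ?_
    (Real.exp_pos _).le
  · rw [hE1]
    exact uDiag_posSemidef U fun i => sub_nonneg.2 (min_le_left _ _)
  · intro σ hσ
    rw [hE1]
    have h1 : pair σ (uDiag U fun i => 1 - min 1 (Real.exp (y i - t))) ≤
        Real.exp (s * t) * pair σ (uDiag U fun i => Real.exp (-(s * y i))) := by
      rw [pair_uDiag, pair_uDiag, Finset.mul_sum]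
      refine Finset.sum_le_sum fun i _ => ?_
      rw [mul_left_comm]
      refine mul_le_mul_of_nonneg_left ?_ (wts_nonneg (hA σ hσ) U i)
      refine (one_sub_min_exp_le hs _).trans (le_of_eq ?_)
      rw [← Real.exp_add]
      congr 1
      ring
    exact (h1.trans (mul_le_mul_of_nonneg_left (hy2 σ hσ) (Real.exp_pos _).le)).trans hε
  · intro ω hω
    have h1 : pair ω (uDiag U fun i => min 1 (Real.exp (y i - t))) ≤
        Real.exp (-t) * pair ω (uDiag U fun i => Real.exp (y i)) := by
      rw [pair_uDiag, pair_uDiag, Finset.mul_sum]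
      refine Finset.sum_le_sum fun i _ => ?_
      rw [mul_left_comm]
      refine mul_le_mul_of_nonneg_left ((min_le_right _ _).trans (le_of_eq ?_))
        (wts_nonneg (hB ω hω) U i)
      rw [← Real.exp_add]
      congr 1
      ring
    refine h1.trans ?_
    have := mul_le_mul_of_nonneg_left (hy1 ω hω) (Real.exp_pos (-t)).le
    linarith

variable {ιA ιB : Type*} [Fintype ιA] [Fintype ιB] [DecidableEq ιA] [DecidableEq ιB]

/-- Sufficiently small negative powers of a positive definite operator are dominated by a separable
operator which is affine in its logarithm. -/
lemma exists_filter {k : ℕ} {H : MatN (ιA × ιB) k} (hH : H.PosDef) :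
    ∃ V ∈ Matrix.unitaryGroup (Fin k → ιA × ιB) ℂ, ∃ l : (Fin k → ιA × ιB) → ℝ,
      H = uDiag V (fun i => Real.exp (l i)) ∧ ∃ C : ℝ, 0 ≤ C ∧ ∀ᶠ s in 𝓝[>] (0 : ℝ),
        (1 + s ^ 2 * C) • (1 : MatN (ιA × ιB) k) - s • matLog H ∈ sepCone ιA ιB k ∧
        ((1 + s ^ 2 * C) • (1 : MatN (ιA × ιB) k) - s • matLog H -
          uDiag V (fun i => Real.exp (-(s * l i)))).PosSemidef := by
  obtain ⟨V, hV, hHV⟩ := exists_uDiag hH.isHermitian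
  have hpos : ∀ i, 0 < hH.isHermitian.eigenvalues i := hH.eigenvalues_pos
  set h := hH.isHermitian.eigenvalues
  set l : (Fin k → ιA × ιB) → ℝ := fun i => Real.log (h i)
  have hexp : (fun i => Real.exp (l i)) = h := funext fun i => Real.exp_log (hpos i)
  have hlog : matLog H = uDiag V l := by rw [hHV, matLog_uDiag hV]
  refine ⟨V, hV, l, by rw [hexp]; exact hHV, ∑ i, l i ^ 2,
    Finset.sum_nonneg fun i _ => sq_nonneg _, ?_⟩
  set C := ∑ i, l i ^ 2
  have hC : ∀ i, l i ^ 2 ≤ C := fun i =>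
    Finset.single_le_sum (f := fun i => l i ^ 2) (fun i _ => sq_nonneg _) (Finset.mem_univ i)
  have hC0 : 0 ≤ C := Finset.sum_nonneg fun i _ => sq_nonneg _
  obtain ⟨c, hc, hcL⟩ := exists_smul_one_add_mem_sepCone (matLog_isHermitian H).neg
  have e1 : ∀ᶠ s in 𝓝[>] (0 : ℝ), s * c < 1 := by
    have : Tendsto (fun s : ℝ => s * c) (𝓝[>] 0) (𝓝 (0 * c)) :=
      ((continuous_id.mul continuous_const).tendsto 0).mono_left nhdsWithin_le_nhds
    rw [zero_mul] at this
    exact this.eventually (gt_mem_nhds zero_lt_one)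
  have e2 : ∀ᶠ s in 𝓝[>] (0 : ℝ), s ^ 2 * C < 1 := by
    have : Tendsto (fun s : ℝ => s ^ 2 * C) (𝓝[>] 0) (𝓝 (0 ^ 2 * C)) :=
      (((continuous_id.pow 2).mul continuous_const).tendsto 0).mono_left nhdsWithin_le_nhds
    rw [zero_pow two_ne_zero, zero_mul] at this
    exact this.eventually (gt_mem_nhds zero_lt_one)
  filter_upwards [e1, e2, self_mem_nhdsWithin] with s h1 h2 hs
  have hs : 0 < s := hs
  constructor
  · have : (1 + s ^ 2 * C) • (1 : MatN (ιA × ιB) k) - s • matLog H =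
        s • (c • (1 : MatN (ιA × ιB) k) + -matLog H) +
          (1 + s ^ 2 * C - s * c) • (1 : MatN (ιA × ιB) k) := by module
    rw [this]
    refine add_mem (smul_mem_sepCone hs.le hcL) (smul_mem_sepCone ?_ one_mem_sepCone)
    have : 0 ≤ s ^ 2 * C := by positivity
    linarith
  · rw [hlog, ← uDiag_one hV, ← uDiag_smul, ← uDiag_smul, ← uDiag_sub, ← uDiag_sub]
    refine uDiag_posSemidef V fun i => ?_
    simp only [Pi.sub_apply, Pi.smul_apply, Pi.one_apply, smul_eq_mul]
    have hsl : (s * l i) ^ 2 ≤ s ^ 2 * C := by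
      rw [mul_pow]
      exact mul_le_mul_of_nonneg_left (hC i) (sq_nonneg s)
    have habs : |-(s * l i)| ≤ 1 := by
      rw [abs_le_one_iff_mul_self_le_one]
      nlinarith
    have := (abs_le.1 (Real.abs_exp_sub_one_sub_id_le habs)).2
    nlinarith

/-- Iterated filtering: good tests for `k` copies yield good tests for `j + m * k` copies. -/
lemma exists_test_spectrum {k : ℕ} {G : Set (MatC (ιA × ιB))} (hG : ∀ ρ ∈ G, IsState ρ)
    {H V F : MatN (ιA × ιB) k} {l : (Fin k → ιA × ιB) → ℝ} {s a : ℝ}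
    (hV : V ∈ Matrix.unitaryGroup (Fin k → ιA × ιB) ℂ)
    (hHV : H = uDiag V (fun i => Real.exp (l i)))
    (hω : ∀ ω ∈ avSet G k, pair ω H ≤ 1) (hF : F ∈ sepCone ιA ιB k)
    (hFV : (F - uDiag V (fun i => Real.exp (-(s * l i)))).PosSemidef)
    (ha : ∀ σ ∈ sepSet ιA ιB k, pair σ F ≤ a) (ha0 : 0 ≤ a) (j m : ℕ) :
    ∃ U ∈ Matrix.unitaryGroup (Fin (j + m * k) → ιA × ιB) ℂ,
      ∃ y : (Fin (j + m * k) → ιA × ιB) → ℝ,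
        (∀ ω ∈ avSet G (j + m * k), pair ω (uDiag U (fun i => Real.exp (y i))) ≤ 1) ∧
        ∀ σ ∈ sepSet ιA ιB (j + m * k), pair σ (uDiag U (fun i => Real.exp (-(s * y i)))) ≤ a ^ m := by
  induction m with
  | zero =>
    rw [zero_mul, add_zero]
    refine ⟨1, one_mem _, 0, fun ω hω => ?_, fun σ hσ => ?_⟩
    · have : uDiag (1 : MatN (ιA × ιB) j) (fun i => Real.exp ((0 : (Fin j → ιA × ιB) → ℝ) i)) = 1 := by
        simpa [Pi.one_def] using uDiag_one (one_mem (Matrix.unitaryGroup (Fin j → ιA × ιB) ℂ))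
      rw [this, pair_one_right, (isState_of_mem_avSet hG hω).2, Complex.one_re]
    · have : uDiag (1 : MatN (ιA × ιB) j)
          (fun i => Real.exp (-(s * (0 : (Fin j → ιA × ιB) → ℝ) i))) = 1 := by
        simpa [Pi.one_def] using uDiag_one (one_mem (Matrix.unitaryGroup (Fin j → ιA × ιB) ℂ))
      rw [this, pair_one_right, (isState_of_mem_sepSet hσ).2, Complex.one_re, pow_zero]
  | succ m ih =>
    have hjm : j + (m + 1) * k = j + m * k + k := by ring
    rw [hjm]
    generalize j + m * k = n at ih
    obtain ⟨U, hU, y, hy1, hy2⟩ := ih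
    refine ⟨tensorMul U V, tensorMul_mem_unitaryGroup hU hV,
      fun i => y (fun t => i (Fin.castAdd k t)) + l (fun t => i (Fin.natAdd n t)), ?_, ?_⟩
    · simp only [Real.exp_add]
      rw [uDiag_tensorMul U V (fun i => Real.exp (y i)) (fun i => Real.exp (l i)), ← hHV]
      rintro _ ⟨f, hf, rfl⟩
      have h1 := IsState.tensorProdFam fun p => hG _ (hf (Fin.castAdd k p))
      have h2 := IsState.tensorProdFam fun p => hG _ (hf (Fin.natAdd n p))
      have hH : H.PosSemidef := hHV ▸ uDiag_posSemidef V fun i => (Real.exp_pos _).le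
      rw [tensorProdFam_add, pair_tensorMul h1.1.1 (uDiag_isHermitian _ _) h2.1.1 hH.1]
      exact mul_le_one₀ (hy1 _ ⟨_, fun p => hf _, rfl⟩) (pair_nonneg h2.1 hH)
        (hω _ ⟨_, fun p => hf _, rfl⟩)
    · simp only [mul_add, neg_add, Real.exp_add]
      rw [uDiag_tensorMul U V (fun i => Real.exp (-(s * y i))) (fun i => Real.exp (-(s * l i)))]
      intro σ hσ
      refine pair_le_of_mem_sepSet (fun α β hα hβ => ?_) hσ
      have h1 : pair (prodStateAB α β) (tensorMul (uDiag U fun i => Real.exp (-(s * y i)))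
          (uDiag V fun i => Real.exp (-(s * l i)))) ≤
          pair (prodStateAB α β) (tensorMul (uDiag U fun i => Real.exp (-(s * y i))) F) := by
        refine pair_mono_right (hα.prodStateAB hβ).1 ?_
        rw [← tensorMul_sub_right]
        exact tensorMul_posSemidef (uDiag_posSemidef U fun i => (Real.exp_pos _).le) hFV
      refine h1.trans ((pair_tensorMul_sepCone_le hF hy2 hα hβ).trans ?_)
      rw [pair_tensorMul_one, restLast_prodStateAB, pow_succ]
      exact mul_le_mul_of_nonneg_left (ha _ (subset_convexHull ℝ _
        ⟨_, _, restLast_isState hα, restLast_isState hβ, rfl⟩)) (pow_nonneg ha0 m)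

lemma typeII_le_exp {k : ℕ} {G : Set (MatC (ιA × ιB))} (hG : ∀ ρ ∈ G, IsState ρ)
    {H : MatN (ιA × ιB) k} (hH : H.PosDef) {r θ : ℝ} (hθ : θ < r)
    (hr : ∀ σ ∈ sepSet ιA ιB k, r ≤ pair σ (matLog H))
    (hω : ∀ ω ∈ avSet G k, pair ω H ≤ 1) :
    ∃ b < (1 : ℝ), 0 ≤ b ∧ ∀ j m : ℕ, ∀ ε : ℝ, b ^ m ≤ ε →
      typeII (sepSet ιA ιB (j + m * k)) (avSet G (j + m * k)) ε ≤ Real.exp (-(m * θ)) := by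
  obtain ⟨V, hV, l, hHV, C, hC, hev⟩ := exists_filter hH
  have e1 : ∀ᶠ s in 𝓝[>] (0 : ℝ), s * C < r - θ := by
    have : Tendsto (fun s : ℝ => s * C) (𝓝[>] 0) (𝓝 (0 * C)) :=
      ((continuous_id.mul continuous_const).tendsto 0).mono_left nhdsWithin_le_nhds
    rw [zero_mul] at this
    exact this.eventually (gt_mem_nhds (sub_pos.2 hθ))
  obtain ⟨s, ⟨hF, hFV⟩, hs1, hs⟩ := (hev.and (e1.and self_mem_nhdsWithin)).exists
  have hs : 0 < s := hs
  set a := Real.exp (s ^ 2 * C - s * r)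
  have ha : ∀ σ ∈ sepSet ιA ιB k, pair σ ((1 + s ^ 2 * C) • (1 : MatN (ιA × ιB) k) -
      s • matLog H) ≤ a := by
    intro σ hσ
    rw [map_sub, map_smul, map_smul, pair_one_right, (isState_of_mem_sepSet hσ).2,
      Complex.one_re, smul_eq_mul, smul_eq_mul, mul_one]
    have h1 := mul_le_mul_of_nonneg_left (hr σ hσ) hs.le
    have h2 := Real.add_one_le_exp (s ^ 2 * C - s * r)
    linarith
  refine ⟨a * Real.exp (s * θ), ?_, by positivity, fun j m ε hε => ?_⟩
  · rw [← Real.exp_add, Real.exp_lt_one_iff]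
    nlinarith
  obtain ⟨U, hU, y, hy1, hy2⟩ :=
    exists_test_spectrum hG hV hHV hω hF hFV ha (Real.exp_pos _).le j m
  refine typeII_le_of_spectrum (fun σ hσ => (isState_of_mem_sepSet hσ).1)
    (fun ω hω => (isState_of_mem_avSet hG hω).1) hs.le hU hy1 hy2 (m * θ) ?_
  refine le_of_eq_of_le ?_ hε
  rw [mul_pow, ← Real.exp_nat_mul (s * θ), mul_comm, mul_left_comm]

theorem le_steinExponent_of_posDef {k : ℕ} (hk : 0 < k) {G : Set (MatC (ιA × ιB))}
    (hG : ∀ ρ ∈ G, IsState ρ) {H : MatN (ιA × ιB) k} (hH : H.PosDef) {r : ℝ}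
    (hr : ∀ σ ∈ sepSet ιA ιB k, r ≤ pair σ (matLog H))
    (hω : ∀ ω ∈ avSet G k, pair ω H ≤ 1) :
    ((r / k : ℝ) : EReal) ≤ steinExponent (sepSet ιA ιB) (avSet G) := by
  refine le_iInf₂ fun ε hε => le_of_forall_lt fun c hc => ?_
  obtain ⟨q, hcq, hqr⟩ := EReal.lt_iff_exists_real_btwn.1 hc
  refine hcq.trans_le ?_
  have hk' : (0 : ℝ) < k := by exact_mod_cast hk
  have hqr' : q * k < r := (lt_div_iff₀ hk').1 (EReal.coe_lt_coe_iff.1 hqr)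
  obtain ⟨θ, hqθ, hθr⟩ := exists_between hqr'
  obtain ⟨b, hb1, hb0, hb⟩ := typeII_le_exp hG hH hθr hr hω
  have t1 : ∀ᶠ m : ℕ in atTop, b ^ m ≤ ε :=
    ((tendsto_pow_atTop_nhds_zero_of_lt_one hb0 hb1).eventually (gt_mem_nhds hε.1)).mono
      fun _ h => h.le
  have t2 : ∀ᶠ m : ℕ in atTop, |q| * k / (θ - q * k) ≤ m := by
    filter_upwards [eventually_ge_atTop ⌈|q| * k / (θ - q * k)⌉₊] with m hm
    exact Nat.ceil_le.1 hm
  have tdiv : Tendsto (fun n : ℕ => n / k) atTop atTop := Nat.tendsto_div_const_atTop hk.ne'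
  refine le_liminf_of_le (by isBoundedDefault) ?_
  filter_upwards [tdiv.eventually (t1.and t2), eventually_gt_atTop 0] with n ⟨h1, h2⟩ hn
  have hn' : n % k + n / k * k = n := Nat.mod_add_div' n k
  have h3 := hb (n % k) (n / k) ε h1
  rw [hn'] at h3
  have h4 := le_negLog h3
  have hcn : (0 : EReal) ≤ cFrac n := by
    unfold cFrac
    exact_mod_cast inv_nonneg.2 (Nat.cast_nonneg n)
  refine le_trans ?_ (mul_le_mul_of_nonneg_left h4 hcn)
  unfold cFrac
  rw [← EReal.coe_mul, EReal.coe_le_coe_iff, inv_mul_eq_div, le_div_iff₀ (by exact_mod_cast hn)]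
  set m := n / k
  have hmod : ((n % k : ℕ) : ℝ) ≤ k := by exact_mod_cast (Nat.mod_lt n hk).le
  have hnr : (n : ℝ) = (n % k : ℕ) + m * k := by exact_mod_cast hn'.symm
  have h5 : |q| * k ≤ m * (θ - q * k) := (div_le_iff₀ (sub_pos.2 hqθ)).1 h2
  have h6 : q * (n % k : ℕ) ≤ |q| * k :=
    (mul_le_mul_of_nonneg_right (le_abs_self q) (Nat.cast_nonneg _)).trans
      (mul_le_mul_of_nonneg_left hmod (abs_nonneg q))
  rw [hnr]
  nlinarith

end Direct

section TypeBound

open scoped Matrix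

lemma factorial_mul_exp_le (m : ℕ) :
    (m.factorial : ℝ) * Real.exp m ≤ Real.exp 1 * (m + 1) * (m : ℝ) ^ m := by
  have hpos : ∀ m : ℕ, ((m + 1).factorial : ℝ) * Real.exp (m + 1) ≤
      Real.exp 1 * (m + 1) * ((m : ℝ) + 1) ^ (m + 1) := by
    intro m
    induction m with
    | zero => simp
    | succ m ih =>
      have h1 : ((m : ℝ) + 1) ^ (m + 2) * Real.exp 1 ≤ ((m : ℝ) + 2) ^ (m + 2) := by
        have h2 : ((m : ℝ) + 1) / (m + 2) ≤ Real.exp (-(1 / (m + 2))) := by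
          refine le_trans (le_of_eq ?_) (Real.add_one_le_exp _)
          field_simp
          ring
        have h3 := pow_le_pow_left₀ (by positivity) h2 (m + 2)
        rw [← Real.exp_nat_mul, div_pow, div_le_iff₀ (by positivity)] at h3
        have h4 : ((m + 2 : ℕ) : ℝ) * -(1 / (m + 2)) = -1 := by
          push_cast
          field_simp
        rw [h4, Real.exp_neg, inv_mul_eq_div, le_div_iff₀ (Real.exp_pos 1)] at h3
        exact h3
      have h5 : Real.exp ((m + 1 : ℕ) + 1 : ℝ) = Real.exp (m + 1) * Real.exp 1 := by
        rw [← Real.exp_add]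
        push_cast
        rfl
      rw [h5, Nat.factorial_succ]
      push_cast
      calc ((m : ℝ) + 1 + 1) * ((m + 1).factorial : ℝ) * (Real.exp (m + 1) * Real.exp 1)
          = ((m + 1).factorial * Real.exp (m + 1)) * (((m : ℝ) + 1 + 1) * Real.exp 1) := by ring
        _ ≤ (Real.exp 1 * (m + 1) * ((m : ℝ) + 1) ^ (m + 1)) * (((m : ℝ) + 1 + 1) * Real.exp 1) :=
            mul_le_mul_of_nonneg_right ih (by positivity)
        _ = Real.exp 1 * (m + 1 + 1) * (((m : ℝ) + 1) ^ (m + 2) * Real.exp 1) := by ring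
        _ ≤ Real.exp 1 * (m + 1 + 1) * ((m : ℝ) + 2) ^ (m + 2) :=
            mul_le_mul_of_nonneg_left h1 (by positivity)
        _ = Real.exp 1 * (m + 1 + 1) * ((m : ℝ) + 1 + 1) ^ (m + 1 + 1) := by
            rw [add_assoc, add_assoc]
            norm_num
  cases m with
  | zero => simp
  | succ m =>
    have := hpos m
    push_cast
    refine this.trans (mul_le_mul_of_nonneg_right ?_ (by positivity))
    nlinarith [Real.exp_pos 1]

/-- A symmetric nonnegative function on words is bounded by its averages over i.i.d. words, up to a
polynomial factor. -/
lemma symmetric_le_of_iid_le {α : Type*} [Fintype α] [DecidableEq α] {n : ℕ} (hn : 0 < n)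
    {φ : (Fin n → α) → ℝ} (hφ : ∀ g, 0 ≤ φ g)
    (hsymm : ∀ (g : Fin n → α) (π : Equiv.Perm (Fin n)), φ (g ∘ π) = φ g) {C : ℝ}
    (hC : ∀ q : α → ℝ, (∀ a, 0 ≤ q a) → ∑ a, q a = 1 → ∑ h, (∏ p, q (h p)) * φ h ≤ C)
    (g : Fin n → α) : φ g ≤ (Real.exp 1 * (n + 1)) ^ Fintype.card α * C := by
  have hn' : (0 : ℝ) < n := by exact_mod_cast hn
  set N : α → ℕ := fun a => Fintype.card {p // g p = a}
  have hNsum : ∑ a, N a = n := by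
    have := Fintype.card_congr (Equiv.sigmaFiberEquiv g)
    rw [Fintype.card_sigma, Fintype.card_fin] at this
    exact this
  have hprodN : ∀ f : α → ℝ, ∏ p, f (g p) = ∏ a, f a ^ N a := by
    intro f
    rw [← Finset.prod_fiberwise_of_maps_to (t := Finset.univ) (g := g) (fun _ _ => Finset.mem_univ _)]
    refine Finset.prod_congr rfl fun a _ => ?_
    rw [Finset.prod_congr rfl (g := fun _ => f a)
      (fun p hp => by rw [(Finset.mem_filter.1 hp).2]), Finset.prod_const]
    congr 1
    exact (Fintype.card_subtype _).symm
  set q : α → ℝ := fun a => N a / n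
  have hq0 : ∀ a, 0 ≤ q a := fun a => by positivity
  have hq1 : ∑ a, q a = 1 := by
    rw [← Finset.sum_div, ← Nat.cast_sum, hNsum, div_self hn'.ne']
  set ψ : (Fin n → α) → ℝ := fun h => (∏ p, q (h p)) * φ h
  have hψ : ∀ h, 0 ≤ ψ h := fun h => mul_nonneg (Finset.prod_nonneg fun p _ => hq0 _) (hφ h)
  have hC0 : 0 ≤ C := (Finset.sum_nonneg fun h _ => hψ h).trans (hC q hq0 hq1)
  have hfib : ∀ h : Fin n → α,
      ((Finset.univ.filter fun π : Equiv.Perm (Fin n) => g ∘ π = h).card : ℝ) ≤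
        ∏ a, ((N a).factorial : ℝ) := by
    intro h
    by_cases hh : ∃ π₀ : Equiv.Perm (Fin n), g ∘ π₀ = h
    · obtain ⟨π₀, rfl⟩ := hh
      have hst := DomMulAct.stabilizer_card g
      rw [← Nat.cast_prod]
      refine Nat.cast_le.2 ?_
      rw [← hst, Fintype.card_subtype]
      refine Finset.card_le_card_of_injOn (fun π => π * π₀⁻¹) ?_ ?_
      · intro π hπ
        have hπ : g ∘ π = g ∘ π₀ := by simpa using hπ
        simp only [Finset.coe_filter, Finset.mem_univ, true_and, Set.mem_ofPred_eq]
        rw [Equiv.Perm.coe_mul, ← Function.comp_assoc, hπ, Function.comp_assoc,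
          ← Equiv.Perm.coe_mul, mul_inv_cancel, Equiv.Perm.coe_one, Function.comp_id]
      · intro π _ π' _ h
        exact mul_right_cancel h
    · rw [Finset.filter_false_of_mem (fun π _ hπ => hh ⟨π, hπ⟩)]
      simp only [Finset.card_empty, Nat.cast_zero]
      positivity
  have hmain : (n.factorial : ℝ) * ψ g ≤ (∏ a, ((N a).factorial : ℝ)) * C := by
    have h1 : ∀ π : Equiv.Perm (Fin n), ψ (g ∘ π) = ψ g := by
      intro π
      simp only [ψ, hsymm, Function.comp_apply]
      rw [Equiv.prod_comp π (fun p => q (g p))]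
    have h2 : (n.factorial : ℝ) * ψ g = ∑ π : Equiv.Perm (Fin n), ψ (g ∘ π) := by
      simp only [h1, Finset.sum_const, Finset.card_univ, Fintype.card_perm, Fintype.card_fin,
        nsmul_eq_mul]
    rw [h2, ← Finset.sum_fiberwise_of_maps_to (t := Finset.univ)
      (g := fun π : Equiv.Perm (Fin n) => g ∘ π) (fun _ _ => Finset.mem_univ _)]
    calc _ ≤ ∑ h, (∏ a, ((N a).factorial : ℝ)) * ψ h := by
          refine Finset.sum_le_sum fun h _ => ?_
          rw [Finset.sum_congr rfl (g := fun _ => ψ h)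
            (fun π hπ => by rw [(Finset.mem_filter.1 hπ).2]), Finset.sum_const, nsmul_eq_mul]
          exact mul_le_mul_of_nonneg_right (hfib h) (hψ h)
      _ ≤ _ := by
          rw [← Finset.mul_sum]
          exact mul_le_mul_of_nonneg_left (hC q hq0 hq1) (by positivity)
  set B : ℝ := ∏ a, (N a : ℝ) ^ N a
  have hB : 0 < B := by
    refine Finset.prod_pos fun a _ => ?_
    rcases Nat.eq_zero_or_pos (N a) with h0 | h0
    · simp [h0]
    · positivity
  have hψg : ψ g * (n : ℝ) ^ n = B * φ g := by
    have : ∏ p, q (g p) = B / (n : ℝ) ^ n := by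
      rw [hprodN, ← hNsum, ← Finset.prod_pow_eq_pow_sum, ← Finset.prod_div_distrib, hNsum]
      exact Finset.prod_congr rfl fun a _ => by rw [div_pow]
    simp only [ψ, this]
    field_simp
  have hexp : (n : ℝ) ^ n ≤ Real.exp n * n.factorial := by
    have := Real.pow_div_factorial_le_exp (n : ℝ) hn'.le n
    rwa [div_le_iff₀ (by positivity)] at this
  have hfac : (∏ a, ((N a).factorial : ℝ)) * Real.exp n ≤
      (Real.exp 1 * (n + 1)) ^ Fintype.card α * B := by
    have h1 : Real.exp n = ∏ a, Real.exp (N a) := by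
      rw [← Real.exp_sum, ← Nat.cast_sum, hNsum]
    rw [h1, ← Finset.prod_mul_distrib, ← Finset.card_univ, ← Finset.prod_const,
      ← Finset.prod_mul_distrib]
    refine Finset.prod_le_prod (fun a _ => by positivity) fun a _ => ?_
    refine (factorial_mul_exp_le (N a)).trans ?_
    have h2 : (N a : ℝ) ≤ n := by
      have := Finset.single_le_sum (f := N) (fun _ _ => Nat.zero_le _) (Finset.mem_univ a)
      rw [hNsum] at this
      exact_mod_cast this
    gcongr
  have hfin : B * φ g ≤ B * ((Real.exp 1 * (n + 1)) ^ Fintype.card α * C) := by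
    rw [← hψg]
    calc ψ g * (n : ℝ) ^ n ≤ ψ g * (Real.exp n * n.factorial) :=
          mul_le_mul_of_nonneg_left hexp (hψ g)
      _ = Real.exp n * (n.factorial * ψ g) := by ring
      _ ≤ Real.exp n * ((∏ a, ((N a).factorial : ℝ)) * C) :=
          mul_le_mul_of_nonneg_left hmain (Real.exp_pos _).le
      _ = ((∏ a, ((N a).factorial : ℝ)) * Real.exp n) * C := by ring
      _ ≤ ((Real.exp 1 * (n + 1)) ^ Fintype.card α * B) * C :=
          mul_le_mul_of_nonneg_right hfac hC0
      _ = _ := by ring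
  exact le_of_mul_le_mul_left hfin hB

variable {ι : Type*} {n : ℕ}

lemma tensorProdFam_sum {α : Type*} (T : Finset α) (E : Fin n → α → MatC ι) :
    tensorProdFam (fun p => ∑ a ∈ T, E p a) =
      ∑ g ∈ Fintype.piFinset (fun _ : Fin n => T), tensorProdFam (fun p => E p (g p)) := by
  ext i j
  simp only [tensorProdFam, Matrix.sum_apply]
  rw [Finset.prod_univ_sum]

lemma tensorProdFam_smul (c : Fin n → ℝ) (f : Fin n → MatC ι) :
    tensorProdFam (fun p => c p • f p) = (∏ p, c p) • tensorProdFam f := by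
  ext i j
  simp [tensorProdFam, Finset.prod_mul_distrib]

lemma tensorProdFam_const (ρ : MatC ι) : tensorProdFam (fun _ : Fin n => ρ) = tensorPow ρ n := rfl

variable [Fintype ι]

lemma pair_tensorProdFam_sum {α : Type*} (T : Finset α) (c : Fin n → α → ℝ) (e : α → MatC ι)
    (H : MatN ι n) : pair (tensorProdFam (fun p => ∑ a ∈ T, c p a • e a)) H =
      ∑ g ∈ Fintype.piFinset (fun _ : Fin n => T),
        (∏ p, c p (g p)) * pair (tensorProdFam (fun p => e (g p))) H := by
  rw [tensorProdFam_sum, map_sum, LinearMap.sum_apply]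
  refine Finset.sum_congr rfl fun g _ => ?_
  rw [tensorProdFam_smul (fun p => c p (g p)) (fun p => e (g p)), map_smul, LinearMap.smul_apply,
    smul_eq_mul]

lemma pair_tensorProdFam_sum_le {α : Type*} (T : Finset α) (c : Fin n → α → ℝ) (e : α → MatC ι)
    (H : MatN ι n) {M : ℝ} (hc : ∀ p, ∀ a ∈ T, 0 ≤ c p a)
    (hM : ∀ g : Fin n → α, (∀ p, g p ∈ T) → pair (tensorProdFam (fun p => e (g p))) H ≤ M) :
    pair (tensorProdFam (fun p => ∑ a ∈ T, c p a • e a)) H ≤ (∏ p, ∑ a ∈ T, c p a) * M := by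
  rw [pair_tensorProdFam_sum, Finset.prod_univ_sum, Finset.sum_mul]
  refine Finset.sum_le_sum fun g hg => ?_
  rw [Fintype.mem_piFinset] at hg
  exact mul_le_mul_of_nonneg_left (hM g hg) (Finset.prod_nonneg fun p _ => hc p _ (hg p))

lemma tensorProdFam_mono {A B : Fin n → MatC ι} (hA : ∀ p, (A p).PosSemidef)
    (hAB : ∀ p, (B p - A p).PosSemidef) : (tensorProdFam B - tensorProdFam A).PosSemidef := by
  set E : Fin n → Bool → MatC ι := fun p x => if x then A p else B p - A p
  have hE : ∀ p x, (E p x).PosSemidef := by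
    rintro p (_ | _)
    · exact hAB p
    · exact hA p
  have hB : B = fun p => ∑ x ∈ Finset.univ, E p x := by
    funext p
    simp [E]
  rw [hB, tensorProdFam_sum, Fintype.piFinset_univ,
    ← Finset.add_sum_erase _ _ (Finset.mem_univ (fun _ : Fin n => true))]
  have : tensorProdFam (fun p => E p true) = tensorProdFam A := rfl
  rw [this, add_sub_cancel_left]
  exact Matrix.posSemidef_sum _ fun g _ => tensorProdFam_posSemidef fun p => hE p _

lemma trace_submatrix_mul_submatrix {κ : Type*} [Fintype κ] (A B : Matrix κ κ ℂ) (e : κ ≃ κ) :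
    (A.submatrix e e * B).trace = (A * B.submatrix e.symm e.symm).trace := by
  have : A.submatrix e e * B = (A * B.submatrix e.symm e.symm).submatrix e e := by
    rw [← Matrix.submatrix_mul_equiv _ _ e e e, Matrix.submatrix_submatrix]
    simp
  rw [this, trace_submatrix_equiv]

lemma permCopies_eq_submatrix (π : Equiv.Perm (Fin n)) (ρ : MatN ι n) :
    permCopies π ρ = ρ.submatrix (Equiv.arrowCongr π.symm (Equiv.refl ι))
      (Equiv.arrowCongr π.symm (Equiv.refl ι)) := by
  rfl

lemma pair_permCopies (π : Equiv.Perm (Fin n)) (ρ H : MatN ι n) :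
    pair (permCopies π ρ) H = pair ρ (permCopies π.symm H) := by
  rw [pair_apply, pair_apply, permCopies_eq_submatrix, permCopies_eq_submatrix,
    trace_submatrix_mul_submatrix]
  rfl

lemma permCopies_tensorProdFam (π : Equiv.Perm (Fin n)) (f : Fin n → MatC ι) :
    permCopies π (tensorProdFam f) = tensorProdFam (f ∘ π.symm) := by
  ext i j
  simp only [permCopies, tensorProdFam, Function.comp_apply]
  rw [← Equiv.prod_comp π.symm]
  simp

lemma sum_dite_mem {V M : Type*} [AddCommMonoid M] {b : Set V} [Fintype b] {T : Finset V}
    (hb : b ⊆ T) (F : b → M) :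
    ∑ τ ∈ T, (if h : τ ∈ b then F ⟨τ, h⟩ else 0) = ∑ τ : b, F τ := by
  have h1 : b.toFinset ⊆ T := fun τ hτ => hb (Set.mem_toFinset.1 hτ)
  rw [← Finset.sum_subset h1 (fun τ _ hτ => dif_neg fun h => hτ (Set.mem_toFinset.2 h)),
    ← Finset.sum_coe_sort]
  refine Fintype.sum_equiv (Equiv.subtypeEquivRight fun x => Set.mem_toFinset) _ _ ?_
  rintro ⟨τ, hτ⟩
  exact dif_pos (Set.mem_toFinset.1 hτ)

/-- A compact set of positive operators is dominated, up to a factor close to one, by the cone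
generated by finitely many of its elements. -/
lemma exists_finset_dominating {G : Set (MatC ι)} (hG : IsCompact G)
    (hpos : ∀ ρ ∈ G, ρ.PosSemidef) {δ : ℝ} (hδ : 0 < δ) :
    ∃ T : Finset (MatC ι), ↑T ⊆ G ∧ ∀ ρ ∈ G, T.Nonempty ∧ ∃ c : MatC ι → ℝ, (∀ τ ∈ T, 0 ≤ c τ) ∧
      ∑ τ ∈ T, c τ ≤ 1 + δ ∧ (∑ τ ∈ T, c τ • τ - ρ).PosSemidef := by
  obtain ⟨b, hbG, hspan, hli⟩ := exists_linearIndependent ℝ G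
  have hfin : b.Finite := hli.setFinite
  set b' : Finset (MatC ι) := hfin.toFinset
  set B := Module.Basis.span hli
  have hext : ∀ τ : b, ∃ φ : MatC ι →ₗ[ℝ] ℝ, ∀ x (hx : x ∈ Submodule.span ℝ (Set.range ((↑) : b → MatC ι))),
      φ x = B.coord τ ⟨x, hx⟩ := by
    intro τ
    obtain ⟨φ, hφ⟩ := LinearMap.exists_extend (B.coord τ)
    exact ⟨φ, fun x hx => LinearMap.congr_fun hφ ⟨x, hx⟩⟩
  choose φ hφ using hext
  have hφc : ∀ τ, Continuous (φ τ) := fun τ => LinearMap.continuous_of_finiteDimensional _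
  have : Fintype b := hfin.fintype
  have hrep : ∀ x ∈ Submodule.span ℝ G, x = ∑ τ : b, φ τ x • (τ : MatC ι) := by
    intro x hx
    have hx' : x ∈ Submodule.span ℝ (Set.range ((↑) : b → MatC ι)) := by
      rwa [Subtype.range_coe, hspan]
    have := congrArg (Submodule.subtype _) (B.sum_repr ⟨x, hx'⟩)
    rw [map_sum] at this
    refine Eq.trans this.symm (Finset.sum_congr rfl fun τ _ => ?_)
    rw [map_smul, hφ τ x hx', Module.Basis.coord_apply, Submodule.subtype_apply,
      Module.Basis.span_apply]
  set η : ℝ := δ / (Fintype.card b + 1)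
  have hη : 0 < η := by positivity
  obtain ⟨t, ht⟩ := hG.elim_finite_subcover (fun e : G => {ρ | ∀ τ : b, |φ τ (ρ - e)| < η})
    (fun e => by
      simp only [Set.ofPred_forall]
      exact isOpen_iInter_of_finite fun τ => isOpen_lt
        (((hφc τ).comp (continuous_id.sub continuous_const)).abs) continuous_const)
    (fun ρ hρ => Set.mem_iUnion.2 ⟨⟨ρ, hρ⟩, fun τ => by simpa using hη⟩)
  refine ⟨t.map (Function.Embedding.subtype _) ∪ b', ?_, fun ρ hρ => ?_⟩
  · intro τ hτ
    rw [Finset.coe_union] at hτ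
    rcases hτ with h | h
    · obtain ⟨e, -, rfl⟩ := Finset.mem_map.1 h
      exact e.2
    · exact hbG (hfin.mem_toFinset.1 h)
  · obtain ⟨e, he, hρe⟩ := Set.mem_iUnion₂.1 (ht hρ)
    have hρe : ∀ τ : b, |φ τ (ρ - e)| < η := hρe
    set T := t.map (Function.Embedding.subtype _) ∪ b'
    have heT : (e : MatC ι) ∈ T := Finset.mem_union_left _ (Finset.mem_map.2 ⟨e, he, rfl⟩)
    set c₂ : MatC ι → ℝ := fun τ => if h : τ ∈ b then |φ ⟨τ, h⟩ (ρ - e)| else 0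
    have hbT : b ⊆ T := fun τ hτ => Finset.mem_union_right _ (hfin.mem_toFinset.2 hτ)
    refine ⟨⟨e, heT⟩, fun τ => (if τ = e then 1 else 0) + c₂ τ, fun τ _ => ?_, ?_, ?_⟩
    · refine add_nonneg (by split_ifs <;> norm_num) ?_
      simp only [c₂]
      split_ifs
      · exact abs_nonneg _
      · exact le_rfl
    · rw [Finset.sum_add_distrib, Finset.sum_ite_eq' T, if_pos heT]
      have h2 := sum_dite_mem hbT (fun τ : b => |φ τ (ρ - e)|)
      rw [h2]
      have h3 : ∑ τ : b, |φ τ (ρ - e)| ≤ ∑ _τ : b, η := Finset.sum_le_sum fun τ _ => (hρe τ).le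
      rw [Finset.sum_const, Finset.card_univ, nsmul_eq_mul] at h3
      have h4 : (Fintype.card b : ℝ) * η ≤ δ := by
        rw [← mul_div_assoc, div_le_iff₀ (by positivity)]
        nlinarith
      linarith
    · have hx : ρ - e ∈ Submodule.span ℝ G :=
        Submodule.sub_mem _ (Submodule.subset_span hρ) (Submodule.subset_span e.2)
      have h2 := sum_dite_mem hbT (fun τ : b => |φ τ (ρ - e)| • (τ : MatC ι))
      have h2' : ∑ τ ∈ T, c₂ τ • τ = ∑ τ : b, |φ τ (ρ - e)| • (τ : MatC ι) := by
        rw [← h2]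
        refine Finset.sum_congr rfl fun τ _ => ?_
        simp only [c₂]
        split_ifs
        · rfl
        · exact zero_smul ℝ τ
      have h3 : ∑ τ ∈ T, ((if τ = (e : MatC ι) then (1 : ℝ) else 0) + c₂ τ) • τ - ρ =
          ∑ τ : b, (|φ τ (ρ - e)| - φ τ (ρ - e)) • (τ : MatC ι) := by
        simp only [add_smul, Finset.sum_add_distrib, sub_smul, Finset.sum_sub_distrib]
        rw [h2', ← hrep _ hx]
        simp only [ite_smul, one_smul, zero_smul]
        rw [Finset.sum_ite_eq' T, if_pos heT]
        abel
      rw [h3]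
      exact Matrix.posSemidef_sum _ fun τ _ =>
        posSemidef_real_smul (hpos _ (hbG τ.2)) (sub_nonneg.2 (le_abs_self _))

/-- For permutation invariant observables, arbitrarily varying sources are dominated by i.i.d. ones
up to a subexponential factor. -/
theorem exists_av_le_iid {G : Set (MatC ι)} (hG : IsCompact G) (hconv : Convex ℝ G)
    (hpos : ∀ ρ ∈ G, ρ.PosSemidef) {δ : ℝ} (hδ : 0 < δ) :
    ∃ N : ℕ, ∀ n : ℕ, 0 < n → ∀ H : MatN ι n, H.PosSemidef →
      (∀ π : Equiv.Perm (Fin n), permCopies π H = H) → ∀ C : ℝ,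
      (∀ ρ ∈ G, pair (tensorPow ρ n) H ≤ C) → ∀ ω ∈ avSet G n,
        pair ω H ≤ (1 + δ) ^ n * ((Real.exp 1 * (n + 1)) ^ N * C) := by
  obtain ⟨T, hTG, hT⟩ := exists_finset_dominating hG hpos hδ
  refine ⟨Fintype.card T, ?_⟩
  rintro n hn H hH hsymm C hC _ ⟨f, hf, rfl⟩
  obtain ⟨τ, hτ⟩ := (hT (f ⟨0, hn⟩) (hf _)).1
  choose c hc0 hc1 hc2 using fun p => (hT (f p) (hf p)).2
  have hbound : ∀ g : Fin n → T, pair (tensorProdFam (fun p => (g p : MatC ι))) H ≤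
      (Real.exp 1 * (n + 1)) ^ Fintype.card T * C := by
    refine symmetric_le_of_iid_le hn (φ := fun g : Fin n → T =>
      pair (tensorProdFam (fun p => (g p : MatC ι))) H) (fun g => ?_) (fun g π => ?_) (fun q hq0 hq1 => ?_)
    · exact pair_nonneg (tensorProdFam_posSemidef fun p => hpos _ (hTG (g p).2)) hH
    · have := pair_permCopies π.symm (tensorProdFam (fun p => (g p : MatC ι))) H
      rw [hsymm, permCopies_tensorProdFam] at this
      exact this
    · have := pair_tensorProdFam_sum (n := n) Finset.univ (fun _ => q) (fun a : T => (a : MatC ι)) H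
      rw [Fintype.piFinset_univ] at this
      rw [← this, tensorProdFam_const]
      exact hC _ (hconv.sum_mem (fun a _ => hq0 a) hq1 fun a _ => hTG a.2)
  have h1 := pair_mono_left hH (tensorProdFam_mono (fun p => hpos _ (hf p)) hc2)
  have hM0 : 0 ≤ (Real.exp 1 * (n + 1)) ^ Fintype.card T * C := by
    exact (pair_nonneg (tensorProdFam_posSemidef fun p => hpos _ (hTG hτ)) hH).trans
      (hbound fun _ => ⟨τ, hτ⟩)
  refine h1.trans ((pair_tensorProdFam_sum_le T c (fun τ => τ) H hc0
    (M := (Real.exp 1 * (n + 1)) ^ Fintype.card T * C) fun g hg => hbound fun p => ⟨g p, hg p⟩).trans ?_)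
  refine mul_le_mul_of_nonneg_right ?_ hM0
  calc ∏ p, ∑ τ ∈ T, c p τ ≤ ∏ _p : Fin n, (1 + δ) :=
        Finset.prod_le_prod (fun p _ => Finset.sum_nonneg (hc0 p)) fun p _ => hc1 p
    _ = (1 + δ) ^ n := by simp

end TypeBound

section Compactness

open scoped Matrix

theorem isCompact_convexHull_of_isCompact {E : Type*} [AddCommGroup E] [Module ℝ E]
    [TopologicalSpace E] [ContinuousAdd E] [ContinuousSMul ℝ E] [FiniteDimensional ℝ E]
    {s : Set E} (hs : IsCompact s) : IsCompact (convexHull ℝ s) := by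
  rcases s.eq_empty_or_nonempty with rfl | ⟨x₀, hx₀⟩
  · simp
  set D := Module.finrank ℝ E + 1
  have hK : IsCompact (stdSimplex ℝ (Fin D) ×ˢ (Set.univ.pi fun _ : Fin D => s)) :=
    (isCompact_stdSimplex ℝ (Fin D)).prod (isCompact_univ_pi fun _ => hs)
  have hF : Continuous fun p : (Fin D → ℝ) × (Fin D → E) => ∑ i, p.1 i • p.2 i :=
    continuous_finsetSum _ fun i _ =>
      ((continuous_apply i).comp continuous_fst).smul ((continuous_apply i).comp continuous_snd)
  have himg : convexHull ℝ s = (fun p : (Fin D → ℝ) × (Fin D → E) => ∑ i, p.1 i • p.2 i) ''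
      (stdSimplex ℝ (Fin D) ×ˢ (Set.univ.pi fun _ : Fin D => s)) := by
    apply Set.Subset.antisymm
    · intro x hx
      obtain ⟨α, _, z, w, hz, hai, hw, hw1, rfl⟩ := eq_pos_convex_span_of_mem_convexHull hx
      have hcard : Fintype.card α ≤ Fintype.card (Fin D) := by
        rw [Fintype.card_fin]
        exact hai.card_le_finrank_succ.trans
          (Nat.succ_le_succ (Submodule.finrank_le _))
      obtain ⟨e⟩ := Function.Embedding.nonempty_of_card_le hcard
      have hwe : ∀ i, Function.extend e w 0 (e i) = w i := fun i => e.injective.extend_apply _ _ i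
      have hze : ∀ i, Function.extend e z (fun _ => x₀) (e i) = z i :=
        fun i => e.injective.extend_apply _ _ i
      have hwo : ∀ j, j ∉ Set.range e → Function.extend e w 0 j = 0 := fun j hj =>
        Function.extend_apply' _ _ _ hj
      have hzo : ∀ j, j ∉ Set.range e → Function.extend e z (fun _ => x₀) j = x₀ := fun j hj =>
        Function.extend_apply' _ _ _ hj
      refine ⟨(Function.extend e w 0, Function.extend e z fun _ => x₀), ⟨⟨fun j => ?_, ?_⟩,
        fun j _ => ?_⟩, ?_⟩
      · by_cases hj : j ∈ Set.range e
        · obtain ⟨i, rfl⟩ := hj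
          simp only [hwe]
          exact (hw i).le
        · simp only [hwo j hj]
          exact le_rfl
      · rw [← hw1]
        exact (Fintype.sum_of_injective e e.injective _ _ hwo fun i => (hwe i).symm).symm
      · by_cases hj : j ∈ Set.range e
        · obtain ⟨i, rfl⟩ := hj
          simp only [hze]
          exact hz ⟨i, rfl⟩
        · simp only [hzo j hj]
          exact hx₀
      · refine (Fintype.sum_of_injective e e.injective _ _ (fun j hj => ?_) fun i => ?_).symm
        · simp only [hwo j hj, zero_smul]
        · simp only [hwe, hze]
    · rintro _ ⟨⟨w, z⟩, ⟨hw, hz⟩, rfl⟩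
      exact (convex_convexHull ℝ s).sum_mem (fun i _ => hw.1 i) hw.2
        fun i _ => subset_convexHull ℝ s (hz i trivial)
  rw [himg]
  exact hK.image hF

variable {κ : Type*} [Fintype κ]

lemma IsState.norm_apply_le_one {ρ : Matrix κ κ ℂ} (hρ : IsState ρ) (i j : κ) :
    ‖ρ i j‖ ≤ 1 := by
  obtain ⟨B, hB⟩ := exists_conjTranspose_mul_self hρ.1
  have hentry : ∀ i j, ρ i j = ∑ k, star (B k i) * B k j := by
    intro i j
    rw [hB, Matrix.mul_apply]
    rfl
  have hdiag : ∀ i, (ρ i i).re = ∑ k, ‖B k i‖ ^ 2 := by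
    intro i
    rw [hentry, Complex.re_sum]
    refine Finset.sum_congr rfl fun k _ => ?_
    rw [Complex.star_def, ← Complex.normSq_eq_conj_mul_self, Complex.ofReal_re,
      Complex.normSq_eq_norm_sq]
  have hle : ∀ i, (ρ i i).re ≤ 1 := by
    intro i
    have h1 : ∑ i, (ρ i i).re = 1 := by
      have := congrArg Complex.re hρ.2
      rw [Matrix.trace, Complex.re_sum, Complex.one_re] at this
      exact this
    rw [← h1]
    refine Finset.single_le_sum (f := fun i => (ρ i i).re) (fun i _ => ?_) (Finset.mem_univ i)
    change 0 ≤ (ρ i i).re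
    rw [hdiag]
    exact Finset.sum_nonneg fun _ _ => sq_nonneg _
  calc ‖ρ i j‖ ≤ ∑ k, ‖B k i‖ * ‖B k j‖ := by
        rw [hentry]
        refine (norm_sum_le _ _).trans (Finset.sum_le_sum fun k _ => ?_)
        rw [norm_mul, norm_star]
    _ ≤ ∑ k, (‖B k i‖ ^ 2 + ‖B k j‖ ^ 2) / 2 := Finset.sum_le_sum fun k _ => by
        nlinarith [sq_nonneg (‖B k i‖ - ‖B k j‖)]
    _ = ((ρ i i).re + (ρ j j).re) / 2 := by
        rw [hdiag, hdiag, ← Finset.sum_add_distrib, Finset.sum_div]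
    _ ≤ 1 := by linarith [hle i, hle j]

lemma isCompact_isState : IsCompact {ρ : Matrix κ κ ℂ | IsState ρ} := by
  have hK : IsCompact (Set.univ.pi fun _ : κ => Set.univ.pi fun _ : κ =>
      Metric.closedBall (0 : ℂ) 1) :=
    isCompact_univ_pi fun _ => isCompact_univ_pi fun _ => isCompact_closedBall 0 1
  refine IsCompact.of_isClosed_subset hK ?_ ?_
  · have h1 : IsClosed {ρ : Matrix κ κ ℂ | ρ.trace = 1} :=
      isClosed_eq (Continuous.matrix_trace continuous_id) continuous_const
    exact isClosed_posSemidef.inter h1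
  · intro ρ hρ i _ j _
    rw [mem_closedBall_zero_iff]
    exact IsState.norm_apply_le_one hρ i j

lemma exists_isState [Nonempty κ] : ∃ ρ : Matrix κ κ ℂ, IsState ρ := by
  classical
  obtain ⟨i⟩ := ‹Nonempty κ›
  refine ⟨Matrix.diagonal (Pi.single i 1), Matrix.PosSemidef.diagonal ?_, ?_⟩
  · intro j
    by_cases h : j = i
    · subst h; simp
    · simp [h]
  · simp [Matrix.trace_diagonal]

variable {ι : Type*} {n : ℕ}

lemma continuous_tensorPow : Continuous fun ρ : MatC ι => tensorPow ρ n := by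
  refine continuous_matrix fun i j => continuous_finsetProd _ fun k _ => ?_
  exact Continuous.matrix_elem continuous_id _ _

lemma isCompact_iidSet {G : Set (MatC ι)} (hG : IsCompact G) : IsCompact (iidSet G n) := by
  have : iidSet G n = (fun ρ => tensorPow ρ n) '' G := by
    ext ω
    simp only [iidSet, Set.mem_ofPred_eq, Set.mem_image]
    exact ⟨fun ⟨σ, h, e⟩ => ⟨σ, h, e.symm⟩, fun ⟨σ, h, e⟩ => ⟨σ, h, e.symm⟩⟩
  rw [this]
  exact hG.image continuous_tensorPow

lemma iidSet_subset_avSet (G : Set (MatC ι)) : iidSet G n ⊆ avSet G n := by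
  rintro _ ⟨σ, hσ, rfl⟩
  exact ⟨fun _ => σ, fun _ => hσ, rfl⟩

variable {ιA ιB : Type*} [Fintype ιA] [Fintype ιB]

lemma isCompact_sepSet : IsCompact (sepSet ιA ιB n) := by
  have hc : Continuous fun p : Matrix (Fin n → ιA) (Fin n → ιA) ℂ ×
      Matrix (Fin n → ιB) (Fin n → ιB) ℂ => prodStateAB p.1 p.2 :=
    continuous_matrix fun i j => (continuous_fst.matrix_elem _ _).mul
      (continuous_snd.matrix_elem _ _)
  have h1 := (((isCompact_isState (κ := Fin n → ιA)).prod
    (isCompact_isState (κ := Fin n → ιB))).image hc)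
  refine isCompact_convexHull_of_isCompact (h1.of_isClosed_subset ?_ ?_ : IsCompact _)
  · convert h1.isClosed using 1
    ext ρ
    constructor
    · rintro ⟨α, β, hα, hβ, rfl⟩
      exact ⟨(α, β), ⟨hα, hβ⟩, rfl⟩
    · rintro ⟨⟨α, β⟩, ⟨hα, hβ⟩, rfl⟩
      exact ⟨α, β, hα, hβ, rfl⟩
  · rintro _ ⟨α, β, hα, hβ, rfl⟩
    exact ⟨(α, β), ⟨hα, hβ⟩, rfl⟩

lemma sepSet_nonempty [Nonempty ιA] [Nonempty ιB] : (sepSet ιA ιB n).Nonempty := by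
  obtain ⟨α, hα⟩ := exists_isState (κ := Fin n → ιA)
  obtain ⟨β, hβ⟩ := exists_isState (κ := Fin n → ιB)
  exact ⟨_, subset_convexHull ℝ _ ⟨α, β, hα, hβ, rfl⟩⟩

lemma permCopies_posSemidef [Fintype ι] (π : Equiv.Perm (Fin n)) {ρ : MatN ι n}
    (hρ : ρ.PosSemidef) : (permCopies π ρ).PosSemidef := by
  rw [permCopies_eq_submatrix]
  exact hρ.submatrix _

lemma permCopies_isState [Fintype ι] (π : Equiv.Perm (Fin n)) {ρ : MatN ι n} (hρ : IsState ρ) :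
    IsState (permCopies π ρ) :=
  ⟨permCopies_posSemidef π hρ.1, by rw [permCopies_eq_submatrix, trace_submatrix_equiv, hρ.2]⟩

lemma permCopies_mem_sepSet (π : Equiv.Perm (Fin n)) {σ : MatN (ιA × ιB) n}
    (hσ : σ ∈ sepSet ιA ιB n) : permCopies π σ ∈ sepSet ιA ιB n := by
  have hlin : IsLinearMap ℝ (permCopies π : MatN (ιA × ιB) n → MatN (ιA × ιB) n) :=
    ⟨fun _ _ => rfl, fun _ _ => rfl⟩
  have hconv : Convex ℝ (permCopies π ⁻¹' sepSet ιA ιB n) :=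
    (convex_convexHull ℝ _).is_linear_preimage hlin
  refine convexHull_min ?_ hconv hσ
  rintro _ ⟨α, β, hα, hβ, rfl⟩
  exact subset_convexHull ℝ _
    ⟨permCopies π α, permCopies π β, permCopies_isState π hα, permCopies_isState π hβ, rfl⟩

lemma convexHull_iidSet_induction {G : Set (MatC ι)} {P : MatN ι n → Prop}
    (hP : Convex ℝ {ω | P ω}) (h : ∀ ρ ∈ G, P (tensorPow ρ n)) {ω : MatN ι n}
    (hω : ω ∈ convexHull ℝ (iidSet G n)) : P ω := by
  refine convexHull_min ?_ hP hω
  rintro _ ⟨ρ, hρ, rfl⟩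
  exact h ρ hρ

lemma isState_of_mem_convexHull_iidSet [Fintype ι] {G : Set (MatC ι)} (hG : ∀ ρ ∈ G, IsState ρ)
    {ω : MatN ι n} (hω : ω ∈ convexHull ℝ (iidSet G n)) : IsState ω :=
  convexHull_iidSet_induction convex_isState
    (fun ρ hρ => IsState.tensorProdFam fun _ => hG ρ hρ) hω

end Compactness

section Types

open scoped Matrix

variable {ι : Type*} [Fintype ι] [DecidableEq ι] {n : ℕ}

/-- The algebra of permutation invariant operators. -/
def permInv (ι : Type*) [Fintype ι] [DecidableEq ι] (n : ℕ) : Subalgebra ℝ (MatN ι n) where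
  carrier := {A | ∀ π : Equiv.Perm (Fin n), permCopies π A = A}
  mul_mem' := by
    intro A B hA hB π
    have : permCopies π (A * B) = permCopies π A * permCopies π B := by
      simp only [permCopies_eq_submatrix]
      exact (Matrix.submatrix_mul_equiv A B _ (Equiv.arrowCongr π.symm (Equiv.refl ι)) _).symm
    rw [this, hA, hB]
  add_mem' := by
    intro A B hA hB π
    have : permCopies π (A + B) = permCopies π A + permCopies π B := rfl
    rw [this, hA, hB]
  algebraMap_mem' := by
    intro r π
    rw [Algebra.algebraMap_eq_smul_one]
    have : permCopies π (r • (1 : MatN ι n)) = r • permCopies π (1 : MatN ι n) := rfl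
    rw [this, permCopies_eq_submatrix, Matrix.submatrix_one_equiv]

lemma tensorPow_mem_permInv (ρ : MatC ι) : tensorPow ρ n ∈ permInv ι n := by
  intro π
  rw [← tensorProdFam_const, permCopies_tensorProdFam]
  rfl

lemma mem_permInv_of_mem_convexHull_iidSet {G : Set (MatC ι)} {ω : MatN ι n}
    (hω : ω ∈ convexHull ℝ (iidSet G n)) : ω ∈ permInv ι n := by
  have hc : Convex ℝ {A : MatN ι n | A ∈ permInv ι n} :=
    (Subalgebra.toSubmodule (permInv ι n)).convex
  exact convexHull_iidSet_induction hc (fun ρ _ => tensorPow_mem_permInv ρ) hω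

lemma exists_perm_comp_eq {α : Type*} [DecidableEq α] {g g' : Fin n → α}
    (h : ∀ a, Fintype.card {p // g p = a} = Fintype.card {p // g' p = a}) :
    ∃ π : Equiv.Perm (Fin n), g ∘ π = g' := by
  let e := fun a => Fintype.equivOfCardEq (h a)
  refine ⟨((Equiv.sigmaFiberEquiv g').symm.trans
    (Equiv.sigmaCongrRight fun a => (e a).symm)).trans (Equiv.sigmaFiberEquiv g), ?_⟩
  funext p
  exact ((e (g' p)).symm ⟨p, rfl⟩).2

lemma finrank_permInv_le : Module.finrank ℝ (permInv ι n) ≤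
    2 * (n + 1) ^ (Fintype.card ι * Fintype.card ι) := by
  set t : (Fin n → ι) → (Fin n → ι) → (ι × ι → Fin (n + 1)) := fun i j a =>
    ⟨Fintype.card {p // (i p, j p) = a}, Nat.lt_succ_of_le
      ((Fintype.card_subtype_le _).trans (Fintype.card_fin n).le)⟩
  set L : ((ι × ι → Fin (n + 1)) → ℂ) →ₗ[ℝ] MatN ι n :=
    { toFun := fun c i j => c (t i j)
      map_add' := fun _ _ => rfl
      map_smul' := fun _ _ => rfl }
  have hle : Subalgebra.toSubmodule (permInv ι n) ≤ LinearMap.range L := by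
    intro A hA
    have hA : ∀ π : Equiv.Perm (Fin n), permCopies π A = A := hA
    refine ⟨fun a => if h : ∃ p : (Fin n → ι) × (Fin n → ι), t p.1 p.2 = a then
      A h.choose.1 h.choose.2 else 0, ?_⟩
    ext i j
    have h : ∃ p : (Fin n → ι) × (Fin n → ι), t p.1 p.2 = t i j := ⟨(i, j), rfl⟩
    change (if h : ∃ p : (Fin n → ι) × (Fin n → ι), t p.1 p.2 = t i j then
      A h.choose.1 h.choose.2 else 0) = A i j
    rw [dif_pos h]
    have hs := h.choose_spec
    generalize h.choose = p at hs
    obtain ⟨π, hπ⟩ := exists_perm_comp_eq (g := fun q => (p.1 q, p.2 q)) (g' := fun q => (i q, j q))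
      (fun a => congrArg Fin.val (congrFun hs a))
    have h1 : p.1 ∘ π = i := funext fun q => congrArg Prod.fst (congrFun hπ q)
    have h2 : p.2 ∘ π = j := funext fun q => congrArg Prod.snd (congrFun hπ q)
    rw [← h1, ← h2]
    exact (congrFun (congrFun (hA π) p.1) p.2).symm
  calc Module.finrank ℝ (permInv ι n) ≤ Module.finrank ℝ (LinearMap.range L) :=
        Submodule.finrank_mono hle
    _ ≤ Module.finrank ℝ ((ι × ι → Fin (n + 1)) → ℂ) := LinearMap.finrank_range_le L
    _ = 2 * (n + 1) ^ (Fintype.card ι * Fintype.card ι) := by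
        rw [Module.finrank_pi_fintype]
        simp [Complex.finrank_real_complex, mul_comm]

lemma card_eigenvalues_le {A : MatN ι n} (hA : A.IsHermitian) (hp : A ∈ permInv ι n) :
    (Finset.univ.image hA.eigenvalues).card ≤
      2 * (n + 1) ^ (Fintype.card ι * Fintype.card ι) := by
  set p := minpoly ℝ (⟨A, hp⟩ : permInv ι n)
  have hp0 : p ≠ 0 := minpoly.ne_zero (Algebra.IsIntegral.isIntegral _)
  have hpA : Polynomial.aeval A p = 0 := by
    have := congrArg (permInv ι n).val (minpoly.aeval ℝ (⟨A, hp⟩ : permInv ι n))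
    rwa [← Polynomial.aeval_algHom_apply, map_zero] at this
  have hsub : Finset.univ.image hA.eigenvalues ⊆ p.roots.toFinset := by
    intro x hx
    obtain ⟨i, -, rfl⟩ := Finset.mem_image.1 hx
    rw [Multiset.mem_toFinset, Polynomial.mem_roots hp0, Polynomial.IsRoot.def]
    have h1 := spectrum.subset_polynomial_aeval A p ⟨_, hA.eigenvalues_mem_spectrum_real i, rfl⟩
    rw [hpA] at h1
    have : Nonempty (Fin n → ι) := ⟨i⟩
    rw [spectrum.zero_eq] at h1
    exact h1
  calc _ ≤ p.roots.toFinset.card := Finset.card_le_card hsub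
    _ ≤ p.natDegree := (Multiset.toFinset_card_le _).trans (Polynomial.card_roots' p)
    _ ≤ Module.finrank ℝ (permInv ι n) := minpoly.natDegree_le _
    _ ≤ _ := finrank_permInv_le

end Types

section Minimax

open scoped Matrix

theorem exists_forall_le_of_forall_exists_lt {E F : Type*}
    [TopologicalSpace E] [AddCommGroup E] [Module ℝ E] [IsTopologicalAddGroup E]
    [ContinuousSMul ℝ E] [TopologicalSpace F] [AddCommGroup F] [Module ℝ F]
    [IsTopologicalAddGroup F] [ContinuousSMul ℝ F] {X : Set E} {Y : Set F} {f : E → F → ℝ}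
    (hX : X.Nonempty) (hXc : IsCompact X) (hXconv : Convex ℝ X) (hYconv : Convex ℝ Y)
    (hfy : ∀ y ∈ Y, ContinuousOn (fun x => f x y) X) (hfy' : ∀ y ∈ Y, ConvexOn ℝ X fun x => f x y)
    (hfx : ∀ x ∈ X, ContinuousOn (f x) Y) (hfx' : ∀ x ∈ X, ConcaveOn ℝ Y (f x))
    {r r' : ℝ} (h : ∀ x ∈ X, ∃ y ∈ Y, r ≤ f x y) (hr : r' < r) :
    ∃ y ∈ Y, ∀ x ∈ X, r' ≤ f x y := by
  have hcoe : Monotone ((↑) : ℝ → EReal) := EReal.coe_strictMono.monotone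
  have key := Sion.minimax' (f := fun x y => (f x y : EReal)) hX hXconv hXc
    (fun y hy => (continuous_coe_real_ereal.comp_continuousOn (hfy y hy)).lowerSemicontinuousOn)
    (fun y hy => (hfy' y hy).quasiconvexOn.monotone_comp (g := Real.toEReal) hcoe) hYconv
    (fun x hx => (continuous_coe_real_ereal.comp_continuousOn (hfx x hx)).upperSemicontinuousOn)
    (fun x hx => (hfx' x hx).quasiconcaveOn.monotone_comp (g := Real.toEReal) hcoe)
  have h1 : (r : EReal) ≤ ⨅ x ∈ X, ⨆ y ∈ Y, (f x y : EReal) :=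
    le_iInf₂ fun x hx => by
      obtain ⟨y, hy, hxy⟩ := h x hx
      exact (EReal.coe_le_coe_iff.2 hxy).trans (le_iSup₂ (f := fun y _ => (f x y : EReal)) y hy)
  rw [key] at h1
  have h2 := (EReal.coe_lt_coe_iff.2 hr).trans_le h1
  obtain ⟨y, hy⟩ := lt_iSup_iff.1 h2
  obtain ⟨hyY, hy⟩ := lt_iSup_iff.1 hy
  refine ⟨y, hyY, fun x hx => ?_⟩
  exact EReal.coe_le_coe_iff.1 (hy.le.trans (iInf₂_le (f := fun x _ => (f x y : EReal)) x hx))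

variable {κ : Type*} [Fintype κ] [DecidableEq κ]

lemma continuous_pair_left (A : Matrix κ κ ℂ) : Continuous fun B => pair B A :=
  ((LinearMap.flip pair) A).continuous_of_finiteDimensional

lemma continuous_pair_right (A : Matrix κ κ ℂ) : Continuous fun B => pair A B :=
  (pair A).continuous_of_finiteDimensional

lemma concaveOn_pair_matLog {A : Matrix κ κ ℂ} (hA : A.PosSemidef) :
    ConcaveOn ℝ {H : Matrix κ κ ℂ | H.PosDef} fun H => pair A (matLog H) := by
  refine ⟨convex_posDef, fun H₁ h₁ H₂ h₂ a b ha hb hab => ?_⟩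
  have h := matLog_concave Finset.univ ![a, b] ![H₁, H₂]
    (by intro i _; fin_cases i <;> simpa) (by simpa using hab)
    (by intro i _; fin_cases i <;> simpa)
  simp only [Fin.sum_univ_two, Matrix.cons_val_zero, Matrix.cons_val_one] at h
  have := pair_mono_right hA h
  simpa using this

/-- A uniform version over compact convex sets of the variational lower bound on the relative
entropy. -/
theorem exists_posDef_of_forall_exists {S Ω : Set (Matrix κ κ ℂ)} (hS : S.Nonempty)
    (hSc : IsCompact S) (hSconv : Convex ℝ S) (hSpos : ∀ σ ∈ S, IsState σ) (hΩ : Ω.Nonempty)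
    (hΩc : IsCompact Ω) (hΩconv : Convex ℝ Ω)
    {r r' : ℝ} (h : ∀ σ ∈ S, ∀ ω ∈ Ω, ∃ H : Matrix κ κ ℂ, H.PosDef ∧
      r ≤ pair σ (matLog H) + (1 - pair ω H)) (hr : r' < r) :
    ∃ H : Matrix κ κ ℂ, H.PosDef ∧ (∀ σ ∈ S, r' ≤ pair σ (matLog H)) ∧
      ∀ ω ∈ Ω, pair ω H ≤ 1 := by
  obtain ⟨H, hH, hHr⟩ := exists_forall_le_of_forall_exists_lt
    (X := S ×ˢ Ω) (Y := {H : Matrix κ κ ℂ | H.PosDef})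
    (f := fun p H => pair p.1 (matLog H) + (1 - pair p.2 H)) (hS.prod hΩ) (hSc.prod hΩc)
    (hSconv.prod hΩconv) convex_posDef
    (fun H _ => (((continuous_pair_left _).comp continuous_fst).add
      (continuous_const.sub ((continuous_pair_left _).comp continuous_snd))).continuousOn)
    (fun H _ => ⟨hSconv.prod hΩconv, fun p _ q _ a b _ _ hab => by
      simp only [Prod.fst_add, Prod.smul_fst, Prod.snd_add, Prod.smul_snd, map_add, map_smul,
        LinearMap.add_apply, LinearMap.smul_apply, smul_eq_mul]
      linarith⟩)
    (fun p _ => ((continuous_pair_right p.1).comp_continuousOn continuousOn_matLog).add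
      (continuous_const.sub (continuous_pair_right p.2)).continuousOn)
    (fun p hp => (concaveOn_pair_matLog (hSpos _ hp.1).1).add ⟨convex_posDef,
      fun H₁ _ H₂ _ a b _ _ hab => by
        simp only [map_add, map_smul, smul_eq_mul]
        linarith⟩)
    (fun p hp => h p.1 hp.1 p.2 hp.2) hr
  obtain ⟨σ₀, hσ₀, hmin⟩ := hSc.exists_isMinOn hS
    (continuous_pair_left (matLog H)).continuousOn
  obtain ⟨ω₀, hω₀, hmax⟩ := hΩc.exists_isMaxOn hΩ (continuous_pair_left H).continuousOn
  set M := pair ω₀ H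
  have hexp := Real.exp_pos (-(M - 1))
  have h0 := hHr (σ₀, ω₀) ⟨hσ₀, hω₀⟩
  refine ⟨Real.exp (-(M - 1)) • H, posDef_real_smul hH hexp, fun σ hσ => ?_, fun ω hω => ?_⟩
  · have h1 : pair σ (1 : Matrix κ κ ℂ) = 1 := by
      rw [pair_one_right, (hSpos σ hσ).2, Complex.one_re]
    have h2 : pair σ₀ (matLog H) ≤ pair σ (matLog H) := hmin hσ
    rw [matLog_smul hH hexp, Real.log_exp, map_add, map_smul, h1, smul_eq_mul]
    linarith
  · have h1 : pair ω H ≤ M := hmax hω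
    have h2 := Real.add_one_le_exp (M - 1)
    rw [map_smul, smul_eq_mul, Real.exp_neg, inv_mul_le_iff₀ (Real.exp_pos _)]
    linarith

section Twirl

variable {ι : Type*} [Fintype ι] [DecidableEq ι] {n : ℕ}

lemma submatrix_uDiag (e : κ ≃ κ) (U : Matrix κ κ ℂ) (d : κ → ℝ) :
    (uDiag U d).submatrix e e = uDiag (U.submatrix e id) d := rfl

lemma matLog_submatrix (e : κ ≃ κ) {A : Matrix κ κ ℂ} (hA : A.IsHermitian) :
    matLog (A.submatrix e e) = (matLog A).submatrix e e := by
  obtain ⟨U, hU, h⟩ := exists_uDiag hA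
  have hU' : U.submatrix e id ∈ Matrix.unitaryGroup κ ℂ := by
    rw [Matrix.mem_unitaryGroup_iff] at hU ⊢
    have : U.submatrix e id * star (U.submatrix e id) = (U * star U).submatrix e e := rfl
    rw [this, hU, Matrix.submatrix_one_equiv]
  rw [h, submatrix_uDiag, matLog_uDiag hU', matLog_uDiag hU, submatrix_uDiag]

lemma matLog_permCopies (π : Equiv.Perm (Fin n)) {A : MatN ι n} (hA : A.IsHermitian) :
    matLog (permCopies π A) = permCopies π (matLog A) := by
  simp only [permCopies_eq_submatrix]
  exact matLog_submatrix _ hA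

lemma permCopies_posDef (π : Equiv.Perm (Fin n)) {A : MatN ι n} (hA : A.PosDef) :
    (permCopies π A).PosDef := by
  rw [permCopies_eq_submatrix]
  exact hA.submatrix (Equiv.injective _)

/-- Averaging over permutations of the tensor factors makes the operator in a variational bound
permutation invariant. -/
theorem exists_posDef_permCopies_eq {S Ω : Set (MatN ι n)} (hSpos : ∀ σ ∈ S, IsState σ)
    (hS : ∀ σ ∈ S, ∀ π, permCopies π σ ∈ S) (hΩ : ∀ ω ∈ Ω, ∀ π, permCopies π ω ∈ Ω)
    {H : MatN ι n} (hH : H.PosDef) {r : ℝ} (hr : ∀ σ ∈ S, r ≤ pair σ (matLog H))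
    (h1 : ∀ ω ∈ Ω, pair ω H ≤ 1) :
    ∃ H : MatN ι n, H.PosDef ∧ (∀ σ ∈ S, r ≤ pair σ (matLog H)) ∧ (∀ ω ∈ Ω, pair ω H ≤ 1) ∧
      ∀ π, permCopies π H = H := by
  set c : ℝ := (Fintype.card (Equiv.Perm (Fin n)) : ℝ)⁻¹
  have hcard : (0 : ℝ) < Fintype.card (Equiv.Perm (Fin n)) := by exact_mod_cast Fintype.card_pos
  have hc : 0 < c := inv_pos.2 hcard
  have hsum : ∑ _π : Equiv.Perm (Fin n), c = 1 := by
    rw [Finset.sum_const, nsmul_eq_mul, Finset.card_univ]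
    exact mul_inv_cancel₀ hcard.ne'
  refine ⟨∑ π : Equiv.Perm (Fin n), c • permCopies π H, ?_, fun σ hσ => ?_, fun ω hω => ?_,
    fun π => ?_⟩
  · exact convex_posDef.sum_mem (fun _ _ => hc.le) hsum fun π _ => permCopies_posDef π hH
  · have h2 := pair_mono_right (hSpos σ hσ).1 (matLog_concave Finset.univ (fun _ => c)
      (fun π => permCopies π H) (fun _ _ => hc.le) hsum fun π _ => permCopies_posDef π hH)
    refine le_trans ?_ h2
    calc r = ∑ _π : Equiv.Perm (Fin n), c * r := by rw [← Finset.sum_mul, hsum, one_mul]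
      _ ≤ ∑ π, c * pair σ (matLog (permCopies π H)) := by
          refine Finset.sum_le_sum fun π _ => mul_le_mul_of_nonneg_left ?_ hc.le
          rw [matLog_permCopies π hH.1]
          have := hr _ (hS σ hσ π.symm)
          rwa [pair_permCopies, Equiv.symm_symm] at this
      _ = pair σ (∑ π, c • matLog (permCopies π H)) := by simp
  · calc pair ω (∑ π : Equiv.Perm (Fin n), c • permCopies π H)
          = ∑ π, c * pair ω (permCopies π H) := by simp
      _ ≤ ∑ _π : Equiv.Perm (Fin n), c * 1 := by
          refine Finset.sum_le_sum fun π _ => mul_le_mul_of_nonneg_left ?_ hc.le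
          have := h1 _ (hΩ ω hω π.symm)
          rwa [pair_permCopies, Equiv.symm_symm] at this
      _ = 1 := by simpa using hsum
  · have : permCopies π (∑ τ : Equiv.Perm (Fin n), c • permCopies τ H) =
        ∑ τ : Equiv.Perm (Fin n), c • permCopies (π * τ) H := by
      ext i j
      simp only [permCopies, Matrix.sum_apply, Matrix.smul_apply]
      rfl
    rw [this]
    exact Fintype.sum_equiv (Equiv.mulLeft π) _ _ fun τ => rfl

end Twirl

end Minimax

section LowerBound

open scoped Matrix

variable {ιA ιB : Type*} [Fintype ιA] [Fintype ιB] [DecidableEq ιA] [DecidableEq ιB]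

theorem exists_le_steinExponent_avSet [Nonempty ιA] [Nonempty ιB] {G : Set (MatC (ιA × ιB))}
    (hG : IsCompact G) (hconv : Convex ℝ G) (hne : G.Nonempty) (hstate : ∀ ρ ∈ G, IsState ρ)
    {δ : ℝ} (hδ : 0 < δ) : ∃ N D : ℕ, ∀ k : ℕ, 0 < k → ∀ r : ℝ,
      (r : EReal) < ⨅ σ ∈ sepSet ιA ιB k, ⨅ ω ∈ convexHull ℝ (iidSet G k), relEnt σ ω →
      (((r - Real.log (2 * (k + 1) ^ D) - 1 - k * Real.log (1 + δ) -
        N * (Real.log (k + 1) + 1)) / k : ℝ) : EReal) ≤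
          steinExponent (sepSet ιA ιB) (avSet G) := by
  obtain ⟨N, hN⟩ := exists_av_le_iid hG hconv (fun ρ hρ => (hstate ρ hρ).1) hδ
  refine ⟨N, Fintype.card (ιA × ιB) * Fintype.card (ιA × ιB), fun k hk r hr => ?_⟩
  set D := Fintype.card (ιA × ιB) * Fintype.card (ιA × ιB)
  have hΩne : (convexHull ℝ (iidSet G k)).Nonempty := by
    obtain ⟨ρ, hρ⟩ := hne
    exact ⟨_, subset_convexHull ℝ _ ⟨ρ, hρ, rfl⟩⟩
  have hpoint : ∀ σ ∈ sepSet ιA ιB k, ∀ ω ∈ convexHull ℝ (iidSet G k),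
      ∃ H : MatN (ιA × ιB) k, H.PosDef ∧ r - Real.log (2 * (k + 1) ^ D) ≤
        pair σ (matLog H) + (1 - pair ω H) := by
    intro σ hσ ω hω
    have hω' := isState_of_mem_convexHull_iidSet hstate hω
    obtain ⟨H, hH, hlt⟩ := exists_posDef_lt_of_lt_relEnt (isState_of_mem_sepSet hσ) hω'.1
      (card_eigenvalues_le hω'.1.1 (mem_permInv_of_mem_convexHull_iidSet hω))
      (hr.trans_le (iInf₂_le_of_le σ hσ (iInf₂_le ω hω)))
    push_cast at hlt
    exact ⟨H, hH, hlt.le⟩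
  obtain ⟨H₀, hH₀, h0r, h01⟩ := exists_posDef_of_forall_exists
    (r' := r - Real.log (2 * (k + 1) ^ D) - 1) sepSet_nonempty isCompact_sepSet
    (convex_convexHull ℝ _) (fun σ hσ => isState_of_mem_sepSet hσ) hΩne
    (isCompact_convexHull_of_isCompact (isCompact_iidSet hG)) (convex_convexHull ℝ _) hpoint
    (by linarith)
  obtain ⟨H, hH, hHr, hH1, hperm⟩ := exists_posDef_permCopies_eq
    (fun σ hσ => isState_of_mem_sepSet hσ) (fun σ hσ π => permCopies_mem_sepSet π hσ)
    (fun ω hω π => by rwa [mem_permInv_of_mem_convexHull_iidSet hω π]) hH₀ h0r h01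
  have hav := hN k hk H hH.posSemidef hperm 1
    fun ρ hρ => hH1 _ (subset_convexHull ℝ _ ⟨ρ, hρ, rfl⟩)
  set c : ℝ := k * Real.log (1 + δ) + N * (Real.log (k + 1) + 1)
  have hk1 : (0 : ℝ) < k + 1 := by positivity
  have hc : Real.exp c = (1 + δ) ^ k * ((Real.exp 1 * (k + 1)) ^ N * 1) := by
    rw [Real.exp_add, Real.exp_nat_mul, Real.exp_nat_mul, Real.exp_log (by linarith),
      Real.exp_add, Real.exp_log hk1]
    ring
  have hec := Real.exp_pos (-c)
  refine le_steinExponent_of_posDef hk hstate (posDef_real_smul hH hec) (fun σ hσ => ?_)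
    fun ω hω => ?_
  · have h1 : pair σ (1 : MatN (ιA × ιB) k) = 1 := by
      rw [pair_one_right, (isState_of_mem_sepSet hσ).2, Complex.one_re]
    have h2 := hHr σ hσ
    rw [matLog_smul hH hec, Real.log_exp, map_add, map_smul, h1, smul_eq_mul]
    linarith
  · rw [map_smul, smul_eq_mul, Real.exp_neg, inv_mul_le_iff₀ (Real.exp_pos _), hc, mul_one]
    exact hav ω hω

lemma tendsto_log_polynomial_div (N D : ℕ) :
    Tendsto (fun k : ℕ => (Real.log (2 * (k + 1) ^ D) + 1 + N * (Real.log (k + 1) + 1)) / (k : ℝ))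
      atTop (𝓝 0) := by
  have h1 : Tendsto (fun k : ℕ => Real.log ((k : ℝ) + 1) / k) atTop (𝓝 0) := by
    have h := (Real.isLittleO_log_id_atTop.tendsto_div_nhds_zero).comp
      (tendsto_atTop_add_const_right atTop 1 (tendsto_natCast_atTop_atTop (R := ℝ)))
    have h2 : Tendsto (fun k : ℕ => ((k : ℝ) + 1) / k) atTop (𝓝 1) := by
      have := (tendsto_inv_atTop_nhds_zero_nat (𝕜 := ℝ)).const_add 1
      rw [add_zero] at this
      refine this.congr' ?_
      filter_upwards [eventually_gt_atTop 0] with k hk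
      have : (k : ℝ) ≠ 0 := by positivity
      field_simp
    have h3 := h.mul h2
    rw [zero_mul] at h3
    refine h3.congr fun k => ?_
    have : ((k : ℝ) + 1) ≠ 0 := by positivity
    simp only [Function.comp, id]
    field_simp
  have h2 := tendsto_inv_atTop_nhds_zero_nat (𝕜 := ℝ)
  have h3 := (h2.const_mul (Real.log 2 + 1 + N)).add (h1.const_mul ((D : ℝ) + N))
  rw [mul_zero, mul_zero, add_zero] at h3
  refine h3.congr fun k => ?_
  have : ((k : ℝ) + 1) ≠ 0 := by positivity
  rw [Real.log_mul two_ne_zero (pow_ne_zero _ this), Real.log_pow]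
  ring

lemma cFrac_mul_coe (n : ℕ) (x : ℝ) : cFrac n * (x : EReal) = ((x / n : ℝ) : EReal) := by
  rw [cFrac, ← EReal.coe_mul, div_eq_inv_mul]

lemma cFrac_mul_bot {n : ℕ} (hn : 0 < n) : cFrac n * ⊥ = ⊥ :=
  EReal.coe_mul_bot_of_pos (inv_pos.2 (Nat.cast_pos.2 hn))

lemma coe_lt_cFrac_mul {n : ℕ} (hn : 0 < n) {x : ℝ} {b : EReal} (h : (x : EReal) < cFrac n * b) :
    ((x * n : ℝ) : EReal) < b := by
  induction b with
  | bot => simp [cFrac_mul_bot hn] at h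
  | top => exact EReal.coe_lt_top _
  | coe b =>
    rw [cFrac_mul_coe, EReal.coe_lt_coe_iff] at h
    exact EReal.coe_lt_coe_iff.2 ((lt_div_iff₀ (Nat.cast_pos.2 hn)).1 h)

theorem limsup_le_steinExponent_avSet [Nonempty ιA] [Nonempty ιB] {G : Set (MatC (ιA × ιB))}
    (hG : IsCompact G) (hconv : Convex ℝ G) (hne : G.Nonempty) (hstate : ∀ ρ ∈ G, IsState ρ) :
    limsup (fun k => cFrac k *
      ⨅ σ ∈ sepSet ιA ιB k, ⨅ ω ∈ convexHull ℝ (iidSet G k), relEnt σ ω) atTop ≤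
        steinExponent (sepSet ιA ιB) (avSet G) := by
  refine EReal.ge_of_forall_gt_iff_ge.1 fun z hz => ?_
  obtain ⟨x, hzx, hx⟩ := EReal.lt_iff_exists_real_btwn.1 hz
  have hδ : 0 < (x - z) / 2 := by
    have := EReal.coe_lt_coe_iff.1 hzx
    linarith
  obtain ⟨N, D, hND⟩ := exists_le_steinExponent_avSet hG hconv hne hstate hδ
  obtain ⟨k, hxk, hk, herr⟩ := ((frequently_lt_of_lt_limsup (by isBoundedDefault) hx).and_eventually
    ((eventually_gt_atTop 0).and
      ((tendsto_log_polynomial_div N D).eventually (gt_mem_nhds hδ)))).exists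
  refine le_trans ?_ (hND k hk _ (coe_lt_cFrac_mul hk hxk))
  have hk' : (0 : ℝ) < k := Nat.cast_pos.2 hk
  have hlog := Real.log_le_sub_one_of_pos (show 0 < 1 + (x - z) / 2 by linarith)
  rw [EReal.coe_le_coe_iff, le_div_iff₀ hk']
  rw [div_lt_iff₀ hk'] at herr
  have := mul_le_mul_of_nonneg_left hlog hk'.le
  linarith

end LowerBound

section Comparison

open scoped Matrix

variable {κ : Type*} [Fintype κ] [DecidableEq κ]

lemma typeII_set_nonempty (A B : Set (Matrix κ κ ℂ)) {ε : ℝ} (hε : 0 ≤ ε) :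
    {b : ℝ | ∃ E : Matrix κ κ ℂ, E.PosSemidef ∧ (1 - E).PosSemidef ∧
      (∀ ρ ∈ A, (ρ * (1 - E)).trace.re ≤ ε) ∧
      b = sSup {x : ℝ | ∃ σ ∈ B, x = (σ * E).trace.re}}.Nonempty :=
  ⟨_, 1, Matrix.PosSemidef.one, by simp [Matrix.PosSemidef.zero], by simpa using fun _ _ => hε, rfl⟩

lemma pair_le_sSup {B : Set (Matrix κ κ ℂ)} (hB : ∀ σ ∈ B, IsState σ) {E : Matrix κ κ ℂ}
    (hE1 : (1 - E).PosSemidef) {σ : Matrix κ κ ℂ} (hσ : σ ∈ B) :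
    pair σ E ≤ sSup {x : ℝ | ∃ σ ∈ B, x = (σ * E).trace.re} := by
  refine le_csSup ⟨1, ?_⟩ ⟨σ, hσ, rfl⟩
  rintro _ ⟨τ, hτ, rfl⟩
  refine (pair_mono_right (hB τ hτ).1 hE1).trans ?_
  rw [pair_one_right, (hB τ hτ).2, Complex.one_re]

lemma exists_test_of_typeII_lt {A B : Set (Matrix κ κ ℂ)} (hB : ∀ σ ∈ B, IsState σ) {ε x : ℝ}
    (hε : 0 ≤ ε) (h : typeII A B ε < x) : ∃ E : Matrix κ κ ℂ, E.PosSemidef ∧ (1 - E).PosSemidef ∧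
      (∀ ρ ∈ A, pair ρ (1 - E) ≤ ε) ∧ ∀ σ ∈ B, pair σ E ≤ x := by
  obtain ⟨_, ⟨E, hE, hE1, hA, rfl⟩, hlt⟩ := exists_lt_of_csInf_lt (typeII_set_nonempty A B hε) h
  exact ⟨E, hE, hE1, hA, fun σ hσ => (pair_le_sSup hB hE1 hσ).trans hlt.le⟩

lemma typeII_mono {A B B' : Set (Matrix κ κ ℂ)} (hB : ∀ σ ∈ B, IsState σ)
    (hB' : ∀ σ ∈ B', IsState σ)
    (h : ∀ E : Matrix κ κ ℂ, E.PosSemidef → ∀ c, (∀ σ ∈ B', pair σ E ≤ c) → ∀ σ ∈ B, pair σ E ≤ c)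
    {ε : ℝ} (hε : 0 ≤ ε) : typeII A B ε ≤ typeII A B' ε := by
  refine le_csInf (typeII_set_nonempty A B' hε) ?_
  rintro _ ⟨E, hE, hE1, hA, rfl⟩
  refine typeII_le (fun σ hσ => (hB σ hσ).1) hE hE1 hA
    (h E hE _ fun σ hσ => pair_le_sSup hB' hE1 hσ) (Real.sSup_nonneg ?_)
  rintro x ⟨σ, hσ, rfl⟩
  exact pair_nonneg (hB' σ hσ).1 hE

lemma negLog_anti {x y : ℝ} (h : x ≤ y) : negLog y ≤ negLog x := by
  unfold negLog
  split_ifs with h1 h2 h2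
  · exact le_rfl
  · exact absurd (h.trans h1) h2
  · exact le_top
  · exact EReal.coe_le_coe_iff.2 (neg_le_neg (Real.log_le_log (not_le.1 h2) h))

lemma cFrac_nonneg (n : ℕ) : 0 ≤ cFrac n :=
  EReal.coe_nonneg.2 (inv_nonneg.2 (Nat.cast_nonneg n))

variable {ι : Type*} [Fintype ι] [DecidableEq ι]

lemma steinExponent_anti {A B B' : ∀ n : ℕ, Set (MatN ι n)} (hB : ∀ n, ∀ σ ∈ B n, IsState σ)
    (hB' : ∀ n, ∀ σ ∈ B' n, IsState σ)
    (h : ∀ n, ∀ E : MatN ι n, E.PosSemidef → ∀ c, (∀ σ ∈ B' n, pair σ E ≤ c) →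
      ∀ σ ∈ B n, pair σ E ≤ c) : steinExponent A B' ≤ steinExponent A B :=
  iInf₂_mono fun _ hε => liminf_le_liminf (Eventually.of_forall fun n =>
    mul_le_mul_of_nonneg_left (negLog_anti (typeII_mono (hB n) (hB' n) (h n) hε.1.le))
      (cFrac_nonneg n))

lemma isState_of_mem_iidSet {G : Set (MatC ι)} (hG : ∀ ρ ∈ G, IsState ρ) {n : ℕ} {ω : MatN ι n}
    (hω : ω ∈ iidSet G n) : IsState ω :=
  isState_of_mem_avSet hG (iidSet_subset_avSet G hω)

lemma steinExponent_avSet_le_iidSet (A : ∀ n : ℕ, Set (MatN ι n)) {G : Set (MatC ι)}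
    (hG : ∀ ρ ∈ G, IsState ρ) : steinExponent A (avSet G) ≤ steinExponent A (iidSet G) :=
  steinExponent_anti (fun _ _ => isState_of_mem_iidSet hG) (fun _ _ => isState_of_mem_avSet hG)
    fun _ _ _ _ h σ hσ => h σ (iidSet_subset_avSet G hσ)

lemma isState_of_mem_convexHull {F : Set (MatC ι)} (hF : ∀ ρ ∈ F, IsState ρ) {ρ : MatC ι}
    (hρ : ρ ∈ convexHull ℝ F) : IsState ρ :=
  convexHull_min hF convex_isState hρ

lemma pair_le_of_mem_avSet_convexHull {F : Set (MatC ι)} {n : ℕ} {E : MatN ι n} {c : ℝ}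
    (h : ∀ ω ∈ avSet F n, pair ω E ≤ c) : ∀ ω ∈ avSet (convexHull ℝ F) n, pair ω E ≤ c := by
  rintro _ ⟨f, hf, rfl⟩
  have h1 : ∀ p, ∃ t : Finset (MatC ι), ↑t ⊆ F ∧ f p ∈ convexHull ℝ (t : Set (MatC ι)) := by
    intro p
    have := hf p
    rw [convexHull_eq_union_convexHull_finite_subsets] at this
    simpa using this
  choose t htF hft using h1
  set T := Finset.univ.biUnion t
  have h2 : ∀ p, ∃ w : MatC ι → ℝ, (∀ a ∈ T, 0 ≤ w a) ∧ ∑ a ∈ T, w a = 1 ∧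
      ∑ a ∈ T, w a • a = f p := fun p =>
    Finset.mem_convexHull'.1 (convexHull_mono
      (Finset.coe_subset.2 (Finset.subset_biUnion_of_mem t (Finset.mem_univ p))) (hft p))
  choose w hw0 hw1 hwf using h2
  have h3 := pair_tensorProdFam_sum_le T w id E hw0 (M := c) fun g hg => h _ ⟨g, fun p => by
    obtain ⟨q, -, hq⟩ := Finset.mem_biUnion.1 (hg p)
    exact htF q hq, rfl⟩
  simpa only [id, hwf, hw1, Finset.prod_const_one, one_mul] using h3

theorem steinExponent_avSet_convexHull (A : ∀ n : ℕ, Set (MatN ι n)) {F : Set (MatC ι)}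
    (hF : ∀ ρ ∈ F, IsState ρ) :
    steinExponent A (avSet (convexHull ℝ F)) = steinExponent A (avSet F) := by
  apply le_antisymm
  · refine steinExponent_anti (fun _ _ => isState_of_mem_avSet hF)
      (fun _ _ => isState_of_mem_avSet fun _ => isState_of_mem_convexHull hF)
      fun _ _ _ _ h σ hσ => h σ ?_
    obtain ⟨f, hf, rfl⟩ := hσ
    exact ⟨f, fun p => subset_convexHull ℝ F (hf p), rfl⟩
  · exact steinExponent_anti (fun _ _ => isState_of_mem_avSet fun _ => isState_of_mem_convexHull hF)
      (fun _ _ => isState_of_mem_avSet hF) fun _ _ _ _ => pair_le_of_mem_avSet_convexHull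

end Comparison

section Mixtures

open scoped Matrix

variable {ι : Type*} [Fintype ι] [DecidableEq ι] {C : Set (MatC ι)} {n : ℕ}

lemma measurable_tensorPow_apply (i j : Fin n → ι) :
    Measurable fun σ : C => tensorPow (σ : MatC ι) n i j := by
  refine Finset.measurable_prod _ fun k _ => ?_
  have h : Measurable fun A : MatC ι => A (i k) (j k) :=
    (measurable_pi_apply (j k)).comp (measurable_pi_apply (X := fun _ : ι => ι → ℂ) (i k))
  exact h.comp measurable_subtype_coe

lemma integrable_tensorPow_apply (hC : ∀ ρ ∈ C, IsState ρ) (μ : Measure C) [IsFiniteMeasure μ]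
    (i j : Fin n → ι) : Integrable (fun σ : C => tensorPow (σ : MatC ι) n i j) μ := by
  refine Integrable.of_bound (measurable_tensorPow_apply i j).aestronglyMeasurable 1
    (Eventually.of_forall fun σ => ?_)
  exact IsState.norm_apply_le_one (IsState.tensorProdFam fun _ => hC σ σ.2) i j

lemma trace_iidMix_mul (hC : ∀ ρ ∈ C, IsState ρ) (μ : Measure C) [IsFiniteMeasure μ]
    (E : MatN ι n) :
    (iidMix μ n * E).trace = ∫ σ, (tensorPow (σ : MatC ι) n * E).trace ∂μ := by
  have hinteg : ∀ i j, Integrable (fun σ : C => tensorPow (σ : MatC ι) n i j * E j i) μ :=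
    fun i j => (integrable_tensorPow_apply hC μ i j).mul_const _
  simp only [Matrix.trace, Matrix.diag_apply, Matrix.mul_apply]
  rw [integral_finsetSum _ fun i _ => integrable_finsetSum _ fun j _ => hinteg i j]
  refine Finset.sum_congr rfl fun i _ => ?_
  rw [integral_finsetSum _ fun j _ => hinteg i j]
  refine Finset.sum_congr rfl fun j _ => ?_
  rw [integral_mul_const]
  rfl

lemma integrable_pair_tensorPow (hC : ∀ ρ ∈ C, IsState ρ) (μ : Measure C) [IsFiniteMeasure μ]
    (E : MatN ι n) : Integrable (fun σ : C => pair (tensorPow (σ : MatC ι) n) E) μ := by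
  have h : Integrable (fun σ : C => (tensorPow (σ : MatC ι) n * E).trace) μ := by
    simp only [Matrix.trace, Matrix.diag_apply, Matrix.mul_apply]
    exact integrable_finsetSum _ fun i _ => integrable_finsetSum _ fun j _ =>
      (integrable_tensorPow_apply hC μ i j).mul_const _
  exact h.re

lemma pair_iidMix (hC : ∀ ρ ∈ C, IsState ρ) (μ : Measure C) [IsFiniteMeasure μ]
    (E : MatN ι n) : pair (iidMix μ n) E = ∫ σ, pair (tensorPow (σ : MatC ι) n) E ∂μ := by
  have h : Integrable (fun σ : C => (tensorPow (σ : MatC ι) n * E).trace) μ := by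
    simp only [Matrix.trace, Matrix.diag_apply, Matrix.mul_apply]
    exact integrable_finsetSum _ fun i _ => integrable_finsetSum _ fun j _ =>
      (integrable_tensorPow_apply hC μ i j).mul_const _
  rw [pair_apply, trace_iidMix_mul hC]
  exact (integral_re h).symm

lemma isHermitian_iidMix (hC : ∀ ρ ∈ C, IsState ρ) (μ : Measure C) :
    (iidMix μ n).IsHermitian := by
  ext i j
  rw [Matrix.conjTranspose_apply]
  change (starRingEnd ℂ) (∫ σ : C, tensorPow (σ : MatC ι) n j i ∂μ) =
    ∫ σ : C, tensorPow (σ : MatC ι) n i j ∂μ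
  rw [← integral_conj]
  refine integral_congr_ae (Eventually.of_forall fun σ => ?_)
  exact (IsState.tensorProdFam (n := n) fun _ => hC σ σ.2).1.1.apply i j

lemma posSemidef_iidMix (hC : ∀ ρ ∈ C, IsState ρ) (μ : Measure C) [IsFiniteMeasure μ] :
    (iidMix μ n).PosSemidef := by
  refine posSemidef_of_forall_pair (isHermitian_iidMix hC μ) fun B hB => ?_
  rw [pair_iidMix hC]
  exact integral_nonneg fun σ => pair_nonneg (IsState.tensorProdFam fun _ => hC σ σ.2).1 hB

lemma trace_iidMix (hC : ∀ ρ ∈ C, IsState ρ) (μ : Measure C) [IsProbabilityMeasure μ] :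
    (iidMix μ n).trace.re = 1 := by
  rw [← pair_one_right, pair_iidMix hC]
  have h : ∀ σ : C, pair (tensorPow (σ : MatC ι) n) 1 = 1 := fun σ => by
    rw [pair_one_right, ← tensorProdFam_const,
      (IsState.tensorProdFam fun _ => hC σ σ.2).2, Complex.one_re]
  simp [h]

lemma pair_iidMix_le (hC : ∀ ρ ∈ C, IsState ρ) (μ : Measure C) [IsProbabilityMeasure μ]
    {E : MatN ι n} {c : ℝ} (h : ∀ ω ∈ iidSet C n, pair ω E ≤ c) : pair (iidMix μ n) E ≤ c := by
  rw [pair_iidMix hC]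
  calc ∫ σ, pair (tensorPow (σ : MatC ι) n) E ∂μ ≤ ∫ _σ, c ∂μ :=
        integral_mono (integrable_pair_tensorPow hC μ E) (integrable_const c)
          fun σ => h _ ⟨σ, σ.2, rfl⟩
    _ = c := by simp

lemma neg_le_relEnt {κ : Type*} [Fintype κ] [DecidableEq κ] {σ ω : Matrix κ κ ℂ}
    (hσ : IsState σ) (hω : ω.PosSemidef) (hω1 : ω.trace.re ≤ 1) :
    ((-6 : ℝ) : EReal) ≤ relEnt σ ω := by
  by_contra! h
  have := weak_converse hσ hω hω1 (E := 1) Matrix.PosSemidef.one (ε := 0) (β := 1)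
    (by simp [Matrix.PosSemidef.zero]) (by simp) (by simpa [pair_one_right] using hω1) h.le one_pos
  have := Real.exp_one_lt_three
  linarith

lemma lt_exp_of_lt_negLog {x t : ℝ} (h : (t : EReal) < negLog x) : x < Real.exp (-t) := by
  unfold negLog at h
  split_ifs at h with hx
  · exact hx.trans_lt (Real.exp_pos _)
  · rw [EReal.coe_lt_coe_iff, lt_neg] at h
    exact (Real.log_lt_iff_lt_exp (not_le.1 hx)).1 h

/-- The weak converse: the Stein exponent is bounded by the regularised relative entropy to any
mixture of the alternative. -/
theorem steinExponent_le_liminf (hC : ∀ ρ ∈ C, IsState ρ) (μ : Measure C)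
    [IsProbabilityMeasure μ] {A : ∀ n : ℕ, Set (MatN ι n)} (hA : ∀ n, ∀ σ ∈ A n, IsState σ) :
    steinExponent A (iidSet C) ≤
      liminf (fun n : ℕ => cFrac n * ⨅ σ ∈ A n, relEnt σ (iidMix μ n)) atTop := by
  refine EReal.ge_of_forall_gt_iff_ge.1 fun z hz => ?_
  by_contra! hlt
  obtain ⟨z', hz'l, hz'⟩ := EReal.lt_iff_exists_real_btwn.1 hlt
  rw [EReal.coe_lt_coe_iff] at hz'
  have hfreq := frequently_lt_of_liminf_lt (by isBoundedDefault) hz'l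
  have hex : ∀ n : ℕ, 0 < n → (cFrac n * ⨅ σ ∈ A n, relEnt σ (iidMix μ n)) < z' →
      ∃ σ ∈ A n, relEnt σ (iidMix μ n) < ((z' * n : ℝ) : EReal) := by
    intro n hn h
    by_contra! h1
    refine absurd h (not_lt.2 ?_)
    have h2 := mul_le_mul_of_nonneg_left (le_iInf₂ h1) (cFrac_nonneg n)
    rw [cFrac_mul_coe] at h2
    rwa [mul_div_cancel_right₀ _ (Nat.cast_ne_zero.2 hn.ne')] at h2
  have hz0 : 0 ≤ z' := by
    by_contra! hneg
    obtain ⟨n, hn, hn0, hn6⟩ := (hfreq.and_eventually ((eventually_gt_atTop 0).and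
      (eventually_ge_atTop ⌈6 / -z'⌉₊))).exists
    obtain ⟨σ, hσ, h⟩ := hex n hn0 hn
    have h1 := (neg_le_relEnt (hA n σ hσ) (posSemidef_iidMix hC μ)
      (trace_iidMix hC μ).le).trans_lt h
    rw [EReal.coe_lt_coe_iff] at h1
    have h2 := Nat.ceil_le.1 hn6
    rw [div_le_iff₀ (by linarith)] at h2
    linarith
  obtain ⟨t, hzt, htz⟩ := exists_between hz'
  have ht : 0 < t := hz0.trans_lt hzt
  set g := 1 - z' / t
  have hg : 0 < g := sub_pos.2 ((div_lt_one ht).2 hzt)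
  have hg1 : g ≤ 1 := sub_le_self _ (div_nonneg hz0 ht.le)
  have hε : g / 8 ∈ Set.Ioo (0 : ℝ) 1 := ⟨by linarith, by linarith⟩
  have hev := eventually_lt_of_lt_liminf (hz.trans_le (iInf₂_le (g / 8) hε)) (by isBoundedDefault)
  have ht1 : Tendsto (fun n : ℕ => 1 / (t * n)) atTop (𝓝 0) := by
    have := (tendsto_inv_atTop_nhds_zero_nat (𝕜 := ℝ)).const_mul (1 / t)
    rw [mul_zero] at this
    refine this.congr fun n => ?_
    rw [one_div, one_div, mul_inv]
  have ht2 : Tendsto (fun n : ℕ => Real.exp (-((z - t) * n))) atTop (𝓝 0) :=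
    Real.tendsto_exp_neg_atTop_nhds_zero.comp
      (tendsto_natCast_atTop_atTop.const_mul_atTop (sub_pos.2 htz))
  obtain ⟨n, hn, hn0, hnβ, hn1, hn2⟩ := (hfreq.and_eventually ((eventually_gt_atTop 0).and
    (hev.and ((ht1.eventually (gt_mem_nhds (show 0 < g / 4 by linarith))).and
      (ht2.eventually (gt_mem_nhds (show 0 < g / 8 by linarith))))))).exists
  obtain ⟨σ, hσ, h⟩ := hex n hn0 hn
  have hn0' : (0 : ℝ) < n := Nat.cast_pos.2 hn0
  obtain ⟨E, hE, hE1, hEA, hEB⟩ := exists_test_of_typeII_lt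
    (fun _ hω => isState_of_mem_iidSet hC hω) hε.1.le
    (lt_exp_of_lt_negLog (coe_lt_cFrac_mul hn0 hnβ))
  have key := weak_converse (hA n σ hσ) (posSemidef_iidMix hC μ) (trace_iidMix hC μ).le hE hE1
    (hEA σ hσ) (pair_iidMix_le hC μ hEB) h.le (mul_pos ht hn0')
  rw [← Real.exp_add, show t * n + -(z * n) = -((z - t) * n) by ring] at key
  have h3 : (z' * n + 1) / (t * n) = z' / t + 1 / (t * n) := by
    field_simp
  rw [h3] at key
  linarith

end Mixtures

section UniversalMixture

open scoped Matrix

variable {ι : Type*} [Fintype ι] [DecidableEq ι] {C : Set (MatC ι)} {n : ℕ}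

lemma exists_iidMix_eq (hC : ∀ ρ ∈ C, IsState ρ) {ω : MatN ι n}
    (hω : ω ∈ convexHull ℝ (iidSet C n)) :
    ∃ μ : Measure C, IsProbabilityMeasure μ ∧ iidMix μ n = ω := by
  refine convexHull_iidSet_induction (P := fun ω : MatN ι n =>
    ∃ μ : Measure C, IsProbabilityMeasure μ ∧ iidMix μ n = ω) ?_ (fun ρ hρ => ?_) hω
  · rintro _ ⟨μ, hμ, rfl⟩ _ ⟨ν, hν, rfl⟩ a b ha hb hab
    refine ⟨ENNReal.ofReal a • μ + ENNReal.ofReal b • ν, ⟨?_⟩, ?_⟩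
    · simp [← ENNReal.ofReal_add ha hb, hab]
    · ext i j
      change ∫ σ : C, tensorPow (σ : MatC ι) n i j ∂(ENNReal.ofReal a • μ + ENNReal.ofReal b • ν) =
        a • ∫ σ : C, tensorPow (σ : MatC ι) n i j ∂μ + b • ∫ σ : C, tensorPow (σ : MatC ι) n i j ∂ν
      rw [integral_add_measure
        ((integrable_tensorPow_apply hC μ i j).smul_measure ENNReal.ofReal_ne_top)
        ((integrable_tensorPow_apply hC ν i j).smul_measure ENNReal.ofReal_ne_top),
        integral_smul_measure, integral_smul_measure, ENNReal.toReal_ofReal ha,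
        ENNReal.toReal_ofReal hb]
  · refine ⟨Measure.dirac ⟨ρ, hρ⟩, inferInstance, ?_⟩
    ext i j
    exact integral_dirac' (fun σ : C => tensorPow (σ : MatC ι) n i j) ⟨ρ, hρ⟩
      (measurable_tensorPow_apply i j).stronglyMeasurable

lemma iidMix_sub_posSemidef (hC : ∀ ρ ∈ C, IsState ρ) {μ ν : Measure C} [IsFiniteMeasure μ]
    [IsFiniteMeasure ν] {c : ℝ} (hc : 0 ≤ c) (h : ENNReal.ofReal c • ν ≤ μ) :
    (iidMix μ n - c • iidMix ν n).PosSemidef := by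
  have hherm : (iidMix μ n - c • iidMix ν n).IsHermitian :=
    (isHermitian_iidMix hC μ).sub (posSemidef_real_smul (posSemidef_iidMix hC ν) hc).1
  refine posSemidef_of_forall_pair hherm fun B hB => ?_
  rw [map_sub, map_smul, LinearMap.sub_apply, LinearMap.smul_apply, pair_iidMix hC,
    pair_iidMix hC, sub_nonneg]
  calc c • ∫ σ, pair (tensorPow (σ : MatC ι) n) B ∂ν
      = ∫ σ, pair (tensorPow (σ : MatC ι) n) B ∂(ENNReal.ofReal c • ν) := by
        rw [integral_smul_measure, ENNReal.toReal_ofReal hc]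
    _ ≤ _ := integral_mono_measure h (Eventually.of_forall fun σ =>
        pair_nonneg (IsState.tensorProdFam fun _ => hC σ σ.2).1 hB)
        (integrable_pair_tensorPow hC μ B)

/-- A countable mixture of probability measures dominating each of them with polynomially small
weights. -/
lemma exists_measure_dominating {α : Type*} [MeasurableSpace α] (μ : ℕ → Measure α)
    (hμ : ∀ n, IsProbabilityMeasure (μ n)) : ∃ (ν : Measure α) (A : ℝ), IsProbabilityMeasure ν ∧
      1 ≤ A ∧ ∀ n : ℕ, ENNReal.ofReal (((n : ℝ) + 1) ^ 2 * A)⁻¹ • μ n ≤ ν := by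
  have hs : Summable fun n : ℕ => (((n : ℝ) + 1) ^ 2)⁻¹ := by
    have := (summable_nat_add_iff 1).2 (Real.summable_nat_pow_inv (p := 2).2 one_lt_two)
    exact_mod_cast this
  obtain ⟨A, hsum⟩ := hs
  have hnn : ∀ n : ℕ, 0 ≤ (((n : ℝ) + 1) ^ 2)⁻¹ := fun n => by positivity
  have hA : 1 ≤ A := by
    have := le_hasSum hsum 0 fun n _ => hnn n
    simpa using this
  have hA0 : 0 < A := zero_lt_one.trans_le hA
  refine ⟨Measure.sum fun n : ℕ => ENNReal.ofReal (((n : ℝ) + 1) ^ 2 * A)⁻¹ • μ n, A, ⟨?_⟩, hA,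
    fun n => Measure.le_sum (fun n : ℕ => ENNReal.ofReal (((n : ℝ) + 1) ^ 2 * A)⁻¹ • μ n) n⟩
  have hsum' : HasSum (fun n : ℕ => (((n : ℝ) + 1) ^ 2 * A)⁻¹) 1 := by
    simpa only [mul_inv, mul_inv_cancel₀ hA0.ne'] using hsum.mul_right A⁻¹
  rw [Measure.sum_apply _ MeasurableSet.univ]
  simp only [Measure.smul_apply, measure_univ, smul_eq_mul, mul_one]
  rw [← ENNReal.ofReal_tsum_of_nonneg (fun n => by positivity) hsum'.summable, hsum'.tsum_eq,
    ENNReal.ofReal_one]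

/-- Some mixture of the alternative asymptotically attains the smallest relative entropy over all
mixtures. -/
theorem exists_limsup_le (hC : ∀ ρ ∈ C, IsState ρ) (hne : C.Nonempty)
    {A : ∀ n : ℕ, Set (MatN ι n)} (hA : ∀ n, ∀ σ ∈ A n, IsState σ) :
    ∃ μ : Measure C, IsProbabilityMeasure μ ∧
      limsup (fun n : ℕ => cFrac n * ⨅ σ ∈ A n, relEnt σ (iidMix μ n)) atTop ≤
        limsup (fun n : ℕ => cFrac n *
          ⨅ σ ∈ A n, ⨅ ω ∈ convexHull ℝ (iidSet C n), relEnt σ ω) atTop := by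
  set b : ℕ → EReal := fun n => ⨅ σ ∈ A n, ⨅ ω ∈ convexHull ℝ (iidSet C n), relEnt σ ω
  have hb : ∀ n, ((-6 : ℝ) : EReal) ≤ b n := fun n =>
    le_iInf₂ fun σ hσ => le_iInf₂ fun ω hω => by
      have hω' := isState_of_mem_convexHull_iidSet hC hω
      exact neg_le_relEnt (hA n σ hσ) hω'.1 (by rw [hω'.2, Complex.one_re])
  have h1 : ∀ n, ∃ μ : Measure C, IsProbabilityMeasure μ ∧ ∀ x : ℝ, b n < x →
      ∃ σ ∈ A n, relEnt σ (iidMix μ n) ≤ ((x + 1 : ℝ) : EReal) := by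
    intro n
    have hbot : b n ≠ ⊥ := ((EReal.bot_lt_coe _).trans_le (hb n)).ne'
    by_cases htop : b n = ⊤
    · obtain ⟨ρ, hρ⟩ := hne
      exact ⟨Measure.dirac ⟨ρ, hρ⟩, inferInstance, fun x hx => absurd hx (by simp [htop])⟩
    · lift b n to ℝ using ⟨htop, hbot⟩ with y hy
      have h2 : b n < ((y + 1 : ℝ) : EReal) := by
        rw [← hy]
        exact EReal.coe_lt_coe_iff.2 (lt_add_one y)
      obtain ⟨σ, h3⟩ := iInf_lt_iff.1 h2
      obtain ⟨hσ, h3⟩ := iInf_lt_iff.1 h3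
      obtain ⟨ω, h3⟩ := iInf_lt_iff.1 h3
      obtain ⟨hω, h3⟩ := iInf_lt_iff.1 h3
      obtain ⟨μ, hμ, rfl⟩ := exists_iidMix_eq hC hω
      refine ⟨μ, hμ, fun x hx => ⟨σ, hσ, h3.le.trans (EReal.coe_le_coe_iff.2 ?_)⟩⟩
      have := EReal.coe_lt_coe_iff.1 hx
      linarith
  choose μ hμ hμb using h1
  obtain ⟨ν, a, hν, ha, hdom⟩ := exists_measure_dominating μ hμ
  refine ⟨ν, hν, EReal.le_of_forall_lt_iff_le.1 fun z hz => ?_⟩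
  obtain ⟨x, hx, hxz⟩ := EReal.lt_iff_exists_real_btwn.1 hz
  rw [EReal.coe_lt_coe_iff] at hxz
  have ht : Tendsto (fun k : ℕ => (Real.log (2 * (k + 1) ^ 2) + 1 + (0 : ℕ) *
      (Real.log (k + 1) + 1)) / (k : ℝ) + Real.log a * (k : ℝ)⁻¹) atTop (𝓝 0) := by
    simpa using (tendsto_log_polynomial_div 0 2).add
      ((tendsto_inv_atTop_nhds_zero_nat (𝕜 := ℝ)).const_mul (Real.log a))
  refine limsup_le_of_le (by isBoundedDefault) ?_
  filter_upwards [eventually_lt_of_limsup_lt hx (by isBoundedDefault), eventually_gt_atTop 0,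
    ht.eventually (gt_mem_nhds (sub_pos.2 hxz))] with n hn hn0 herr
  have hn0' : (0 : ℝ) < n := Nat.cast_pos.2 hn0
  have hbn : b n < ((x * n : ℝ) : EReal) := by
    by_contra! h
    have h' := mul_le_mul_of_nonneg_left h (cFrac_nonneg n)
    rw [cFrac_mul_coe, mul_div_cancel_right₀ _ hn0'.ne'] at h'
    exact (not_lt.2 h') hn
  obtain ⟨σ, hσ, hle⟩ := hμb n _ hbn
  have hc : 0 < (((n : ℝ) + 1) ^ 2 * a)⁻¹ := by positivity
  have hc1 : (((n : ℝ) + 1) ^ 2 * a)⁻¹ ≤ 1 :=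
    inv_le_one_of_one_le₀ (one_le_mul_of_one_le_of_one_le (one_le_pow₀ (by linarith)) ha)
  have hrel := relEnt_le_of_smul_le (hA n σ hσ) (posSemidef_iidMix hC (μ n)) hc hc1
    (iidMix_sub_posSemidef hC hc.le (hdom n))
  have h4 : (⨅ σ ∈ A n, relEnt σ (iidMix ν n)) ≤
      ((x * n + 1 + -Real.log (((n : ℝ) + 1) ^ 2 * a)⁻¹ : ℝ) : EReal) := by
    refine (iInf₂_le σ hσ).trans (hrel.trans ?_)
    rw [EReal.coe_add]
    gcongr
  refine (mul_le_mul_of_nonneg_left h4 (cFrac_nonneg n)).trans ?_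
  rw [cFrac_mul_coe, EReal.coe_le_coe_iff, div_le_iff₀ hn0', Real.log_inv, neg_neg,
    Real.log_mul (by positivity) (by positivity)]
  rw [Real.log_mul two_ne_zero (by positivity)] at herr
  have h5 := Real.log_nonneg one_le_two
  have h6 := mul_lt_mul_of_pos_right herr hn0'
  rw [add_mul, div_mul_cancel₀ _ hn0'.ne', inv_mul_cancel_right₀ hn0'.ne'] at h6
  push_cast at h6
  linarith

end UniversalMixture

/-- **Entanglement testing, arbitrarily varying alternative.**
`Stein(𝒮‖𝒻₁^{av}) = Stein(𝒮‖co(𝒻₁)^{av}) = Stein(𝒮‖co(𝒻₁)^{iid})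
  = min*_{μ∈𝒫(co(𝒻₁))} lim_n (1/n) inf_{σ∈𝒮_{Aⁿ:Bⁿ}} D(σ‖∫dμ(ρ) ρ^{⊗n})`. -/
theorem entanglement_testing_av (dA dB : ℕ)
    (F1 : Set (MatC (Fin dA × Fin dB)))
    (hF_states : ∀ ρ ∈ F1, IsState ρ)
    (hF_ne : F1.Nonempty) (hF_closed : IsClosed F1) :
    ∃ S : EReal,
      steinExponent (sepSet (Fin dA) (Fin dB)) (avSet F1) = S ∧
      steinExponent (sepSet (Fin dA) (Fin dB)) (avSet (convexHull ℝ F1)) = S ∧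
      steinExponent (sepSet (Fin dA) (Fin dB)) (iidSet (convexHull ℝ F1)) = S ∧
      (∃ μ : Measure ↥(convexHull ℝ F1), IsProbabilityMeasure μ ∧
        Filter.Tendsto
          (fun n : ℕ => cFrac n * ⨅ σ ∈ sepSet (Fin dA) (Fin dB) n, relEnt σ (iidMix μ n))
          Filter.atTop (nhds S)) ∧
      (∀ μ : Measure ↥(convexHull ℝ F1), IsProbabilityMeasure μ → ∀ L : EReal,
        Filter.Tendsto
          (fun n : ℕ => cFrac n * ⨅ σ ∈ sepSet (Fin dA) (Fin dB) n, relEnt σ (iidMix μ n))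
          Filter.atTop (nhds L) → S ≤ L) := by
  have hF : IsCompact F1 := isCompact_isState.of_isClosed_subset hF_closed hF_states
  have hG : IsCompact (convexHull ℝ F1) := isCompact_convexHull_of_isCompact hF
  have hGne : (convexHull ℝ F1).Nonempty := hF_ne.convexHull
  have hGstate : ∀ ρ ∈ convexHull ℝ F1, IsState ρ := fun ρ hρ =>
    isState_of_mem_convexHull hF_states hρ
  obtain ⟨i, j⟩ : Nonempty (Fin dA × Fin dB) := by
    obtain ⟨ρ, hρ⟩ := hF_ne
    by_contra h
    rw [not_nonempty_iff] at h
    have := (hF_states ρ hρ).2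
    simp [Matrix.trace] at this
  have : Nonempty (Fin dA) := ⟨i⟩
  have : Nonempty (Fin dB) := ⟨j⟩
  have hA : ∀ n, ∀ σ ∈ sepSet (Fin dA) (Fin dB) n, IsState σ := fun n σ hσ =>
    isState_of_mem_sepSet hσ
  have hav := limsup_le_steinExponent_avSet (ιA := Fin dA) (ιB := Fin dB) hG
    (convex_convexHull ℝ F1) hGne hGstate
  have hiid := steinExponent_avSet_le_iidSet (sepSet (Fin dA) (Fin dB)) (G := convexHull ℝ F1)
    hGstate
  have hmix : ∀ μ : Measure ↥(convexHull ℝ F1), IsProbabilityMeasure μ → _ :=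
    fun μ _ => steinExponent_le_liminf hGstate μ hA
  obtain ⟨μ, hμ, hsup⟩ := exists_limsup_le hGstate hGne hA
  have hback : _ ≤ steinExponent (sepSet (Fin dA) (Fin dB)) (avSet (convexHull ℝ F1)) :=
    hsup.trans hav
  have hS : steinExponent (sepSet (Fin dA) (Fin dB)) (avSet (convexHull ℝ F1)) =
      steinExponent (sepSet (Fin dA) (Fin dB)) (iidSet (convexHull ℝ F1)) :=
    hiid.antisymm ((hmix μ hμ).trans ((liminf_le_limsup).trans hback))
  refine ⟨_, ?_, hS, rfl, ⟨μ, hμ, ?_⟩, fun ν hν L hL => (hmix ν hν).trans hL.liminf_eq.le⟩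
  · rw [← hS, steinExponent_avSet_convexHull _ hF_states]
  · exact tendsto_of_le_liminf_of_limsup_le (hmix μ hμ) (hback.trans hiid)

end QSanov
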